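/- arXiv:1603.03426 — 3 statements merged into one kernel-verified Lean document; each statement's English description precedes it below -/
import Mathlib

section
/- For every p ∈ (1,∞), G^p ∩ A_FB^p = G^p ∩ A_par^p; that is, a (p,q)-integral operator on L^p(ℝ) leaves invariant every subspace of the Fourier binest if and only if it belongs to the parabolic algebra. -/
open MeasureTheory Complex Filter Topology
open scoped ENNReal NNReal

noncomputable section

/-- `L^p(ℝ)` with complex values. -/
abbrev LpR (p : ℝ≥0∞) := MeasureTheory.Lp ℂ p (volume : Measure ℝ)

/-- The Bochner space `L^p(ℝ; L^q(ℝ))`. -/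
abbrev LpLq (p q : ℝ≥0∞) [Fact (1 ≤ q)] := MeasureTheory.Lp (LpR q) p (volume : Measure ℝ)

/-- `T` is the operator of multiplication by `φ`. -/
def IsMulOp (p : ℝ≥0∞) [Fact (1 ≤ p)] (φ : ℝ → ℂ) (T : LpR p →L[ℂ] LpR p) : Prop :=
  ∀ f : LpR p, (T f : ℝ → ℂ) =ᵐ[volume] fun x => φ x * (f : ℝ → ℂ) x

/-- `T` is the operator of translation by `μ`: `(T f)(x) = f (x - μ)`. -/
def IsTransOp (p : ℝ≥0∞) [Fact (1 ≤ p)] (μ : ℝ) (T : LpR p →L[ℂ] LpR p) : Prop :=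
  ∀ f : LpR p, (T f : ℝ → ℂ) =ᵐ[volume] fun x => (f : ℝ → ℂ) (x - μ)

/-- A set of operators is closed in the strong operator topology (the topology of
pointwise norm convergence) if it contains every operator which is an SOT-limit point. -/
def IsSOTClosed (p : ℝ≥0∞) [Fact (1 ≤ p)] (S : Set (LpR p →L[ℂ] LpR p)) : Prop :=
  ∀ T : LpR p →L[ℂ] LpR p,
    (⇑T ∈ closure ((fun A : LpR p →L[ℂ] LpR p => (A : LpR p → LpR p)) '' S)) → T ∈ S

/-- The generators of the parabolic algebra: multiplications `M_λ`, `λ ≥ 0`, and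
translations `D_μ`, `μ ≥ 0`. -/
def parabolicGens (p : ℝ≥0∞) [Fact (1 ≤ p)] : Set (LpR p →L[ℂ] LpR p) :=
  {T | ∃ l : ℝ, 0 ≤ l ∧ IsMulOp p (fun x => Complex.exp (Complex.I * l * x)) T} ∪
  {T | ∃ m : ℝ, 0 ≤ m ∧ IsTransOp p m T}

/-- The parabolic algebra: the smallest SOT-closed subalgebra of `B(L^p(ℝ))` containing
the multiplication semigroup and the translation semigroup. -/
def parabolicAlgebra (p : ℝ≥0∞) [Fact (1 ≤ p)] : Set (LpR p →L[ℂ] LpR p) :=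
  ⋂₀ {S | parabolicGens p ⊆ S ∧ IsSOTClosed p S ∧
      ∃ A : Subalgebra ℂ (LpR p →L[ℂ] LpR p), (A : Set (LpR p →L[ℂ] LpR p)) = S}

/-- The Hardy space `H^p(ℝ)`, as a subset of `L^p(ℝ)`. -/
def hardy (p : ℝ≥0∞) [Fact (1 ≤ p)] : Set (LpR p) :=
  {f | ∀ u : ℂ, 0 < u.im → ∫ x : ℝ, (f : ℝ → ℂ) x / ((x : ℂ) + u) = 0}

/-- `L^p[t,∞)`, the subspace of functions vanishing a.e. on `(-∞, t)`. -/
def LpHalfLine (p : ℝ≥0∞) [Fact (1 ≤ p)] (t : ℝ) : Set (LpR p) :=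
  {f | ∀ᵐ x : ℝ, x < t → (f : ℝ → ℂ) x = 0}

/-- The image of the Hardy space under multiplication by the function `φ`. -/
def mulHardy (p : ℝ≥0∞) [Fact (1 ≤ p)] (φ : ℝ → ℂ) : Set (LpR p) :=
  {g | ∃ f ∈ hardy p, (g : ℝ → ℂ) =ᵐ[volume] fun x => φ x * (f : ℝ → ℂ) x}

/-- The Fourier binest algebra: operators leaving invariant each `L^p[t,∞)` and each
`e^{iλx}H^p(ℝ)`. -/
def fourierBinest (p : ℝ≥0∞) [Fact (1 ≤ p)] : Set (LpR p →L[ℂ] LpR p) :=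
  {T | (∀ t : ℝ, ∀ f ∈ LpHalfLine p t, T f ∈ LpHalfLine p t) ∧
       (∀ l : ℝ, ∀ f ∈ mulHardy p (fun x => Complex.exp (Complex.I * l * x)),
          T f ∈ mulHardy p (fun x => Complex.exp (Complex.I * l * x)))}

/-- `T` is the `(p,q)`-integral operator with kernel `k`. -/
def IsIntOp (p q : ℝ≥0∞) [Fact (1 ≤ p)] [Fact (1 ≤ q)] (k : LpLq p q)
    (T : LpR p →L[ℂ] LpR p) : Prop :=
  ∀ f : LpR p, (T f : ℝ → ℂ) =ᵐ[volume]
    fun x => ∫ y : ℝ, ((k : ℝ → LpR q) x : ℝ → ℂ) y * (f : ℝ → ℂ) y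

/-- `G^p`, the set of `(p,q)`-integral operators on `L^p(ℝ)`. -/
def Gp (p q : ℝ≥0∞) [Fact (1 ≤ p)] [Fact (1 ≤ q)] : Set (LpR p →L[ℂ] LpR p) :=
  {T | ∃ k : LpLq p q, IsIntOp p q k T}

section Basic

variable {p : ℝ≥0∞} [Fact (1 ≤ p)]

/-- Translation by `y` as a continuous linear map. -/
def transL (p : ℝ≥0∞) [Fact (1 ≤ p)] (y : ℝ) : LpR p →L[ℂ] LpR p :=
  (Lp.compMeasurePreservingₗᵢ ℂ (fun x : ℝ => x - y)
    (measurePreserving_sub_right volume y)).toContinuousLinearMap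

/-- The reflection `f ↦ f (x - ·)` as a continuous linear map. -/
def reflL (p : ℝ≥0∞) [Fact (1 ≤ p)] (x : ℝ) : LpR p →L[ℂ] LpR p :=
  (Lp.compMeasurePreservingₗᵢ ℂ (fun t : ℝ => x - t)
    (Measure.measurePreserving_sub_left volume x)).toContinuousLinearMap

theorem coeFn_transL (y : ℝ) (f : LpR p) :
    (transL p y f : ℝ → ℂ) =ᵐ[volume] fun x => (f : ℝ → ℂ) (x - y) :=
  Lp.coeFn_compMeasurePreserving f (measurePreserving_sub_right volume y)

theorem coeFn_reflL (x : ℝ) (f : LpR p) :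
    (reflL p x f : ℝ → ℂ) =ᵐ[volume] fun t => (f : ℝ → ℂ) (x - t) :=
  Lp.coeFn_compMeasurePreserving f (Measure.measurePreserving_sub_left volume x)

theorem norm_transL (y : ℝ) (f : LpR p) : ‖transL p y f‖ = ‖f‖ :=
  Lp.norm_compMeasurePreserving f (measurePreserving_sub_right volume y)

theorem norm_reflL (x : ℝ) (f : LpR p) : ‖reflL p x f‖ = ‖f‖ :=
  Lp.norm_compMeasurePreserving f (Measure.measurePreserving_sub_left volume x)

/-- Translation is jointly continuous in the shift and the function. -/
theorem continuous_transL (hp : p ≠ ⊤) :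
    Continuous fun z : ℝ × LpR p => transL p z.1 z.2 := by
  let g : ℝ × LpR p → C(ℝ, ℝ) := fun z => ⟨fun x => x - z.1, by fun_prop⟩
  have hg : Continuous g :=
    ContinuousMap.continuous_of_continuous_uncurry _ (by
      change Continuous fun w : (ℝ × LpR p) × ℝ => w.2 - w.1.1
      fun_prop)
  exact Continuous.compMeasurePreservingLp (g := g) continuous_snd hg
    (fun z => measurePreserving_sub_right volume z.1) hp

theorem continuous_reflL (hp : p ≠ ⊤) :
    Continuous fun z : ℝ × LpR p => reflL p z.1 z.2 := by
  let g : ℝ × LpR p → C(ℝ, ℝ) := fun z => ⟨fun x => z.1 - x, by fun_prop⟩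
  have hg : Continuous g :=
    ContinuousMap.continuous_of_continuous_uncurry _ (by
      change Continuous fun w : (ℝ × LpR p) × ℝ => w.1.1 - w.2
      fun_prop)
  exact Continuous.compMeasurePreservingLp (g := g) continuous_snd hg
    (fun z => Measure.measurePreserving_sub_left volume z.1) hp

/-- Multiplication by an essentially bounded function. -/
def mulOp (p : ℝ≥0∞) [Fact (1 ≤ p)] {φ : ℝ → ℂ} (hφ : MemLp φ ∞ (volume : Measure ℝ)) :
    LpR p →L[ℂ] LpR p :=
  (ContinuousLinearMap.mul ℂ ℂ).holderL volume ∞ p p (hφ.toLp φ)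

theorem coeFn_mulOp {φ : ℝ → ℂ} (hφ : MemLp φ ∞ (volume : Measure ℝ)) (f : LpR p) :
    (mulOp p hφ f : ℝ → ℂ) =ᵐ[volume] fun x => φ x * (f : ℝ → ℂ) x := by
  filter_upwards [(ContinuousLinearMap.mul ℂ ℂ).coeFn_holder (r := p) (hφ.toLp φ) f,
    hφ.coeFn_toLp] with x h1 h2
  change ((ContinuousLinearMap.mul ℂ ℂ).holder p (hφ.toLp φ) f : ℝ → ℂ) x = _
  rw [h1, h2]; rfl

theorem tendsto_mulOp (hp : p ≠ ⊤) {ι : Type*} {l : Filter ι} [l.IsCountablyGenerated]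
    {φ : ι → ℝ → ℂ} {φ₀ : ℝ → ℂ} (hφ : ∀ i, MemLp (φ i) ∞ (volume : Measure ℝ))
    (h₀ : MemLp φ₀ ∞ (volume : Measure ℝ)) (C : ℝ) (hC : ∀ᶠ i in l, ∀ x, ‖φ i x‖ ≤ C)
    (hC₀ : ∀ x, ‖φ₀ x‖ ≤ C)
    (hlim : ∀ x, Tendsto (fun i => φ i x) l (𝓝 (φ₀ x))) (f : LpR p) :
    Tendsto (fun i => mulOp p (hφ i) f) l (𝓝 (mulOp p h₀ f)) := by
  have hp0 : p ≠ 0 := (zero_lt_one.trans_le (Fact.out : 1 ≤ p)).ne'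
  have hpr : 0 < p.toReal := ENNReal.toReal_pos hp0 hp
  rw [Lp.tendsto_Lp_iff_tendsto_eLpNorm']
  have key : ∀ i, eLpNorm (⇑(mulOp p (hφ i) f) - ⇑(mulOp p h₀ f)) p volume =
      (∫⁻ x, ‖(φ i x - φ₀ x) * f x‖ₑ ^ p.toReal) ^ (1 / p.toReal) := by
    intro i
    rw [← eLpNorm_eq_lintegral_rpow_enorm_toReal hp0 hp]
    apply eLpNorm_congr_ae
    filter_upwards [coeFn_mulOp (hφ i) f, coeFn_mulOp h₀ f] with x h1 h2
    simp only [Pi.sub_apply, h1, h2]; ring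
  simp_rw [key]
  have h0 : (0 : ℝ≥0∞) = (0 : ℝ≥0∞) ^ (1 / p.toReal) := by
    rw [ENNReal.zero_rpow_of_pos]; positivity
  rw [h0]
  refine Tendsto.ennrpow_const _ ?_
  have h00 : (0 : ℝ≥0∞) = ∫⁻ x : ℝ, 0 := by simp
  rw [h00]
  have hmeas : ∀ i, AEMeasurable (fun x => ‖(φ i x - φ₀ x) * f x‖ₑ ^ p.toReal) volume := fun i =>
    (((hφ i).1.sub h₀.1).mul (Lp.aestronglyMeasurable f)).enorm.pow_const _
  have hfin : ∫⁻ x : ℝ, (ENNReal.ofReal (2 * C) * ‖f x‖ₑ) ^ p.toReal ≠ ∞ := by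
    have := (Lp.memLp f).2
    rw [eLpNorm_lt_top_iff_lintegral_rpow_enorm_lt_top hp0 hp] at this
    simp_rw [ENNReal.mul_rpow_of_nonneg _ _ hpr.le]
    rw [lintegral_const_mul' _ _ (by finiteness)]
    exact ENNReal.mul_ne_top (by finiteness) this.ne
  refine tendsto_lintegral_filter_of_dominated_convergence'
    (fun x => (ENNReal.ofReal (2 * C) * ‖f x‖ₑ) ^ p.toReal) (Eventually.of_forall hmeas) ?_ hfin ?_
  · filter_upwards [hC] with i hi
    refine Eventually.of_forall fun x => ?_
    gcongr
    rw [enorm_mul]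
    gcongr
    rw [← ofReal_norm]
    apply ENNReal.ofReal_le_ofReal
    linarith [norm_sub_le (φ i x) (φ₀ x), hi x, hC₀ x]
  · refine Eventually.of_forall fun x => ?_
    have h1 : Tendsto (fun i => (φ i x - φ₀ x) * f x) l (𝓝 0) := by
      have := ((hlim x).sub_const (φ₀ x)).mul_const (f x)
      simpa using this
    have h2 := h1.enorm.ennrpow_const p.toReal
    simpa [ENNReal.zero_rpow_of_pos hpr] using h2

end Basic

section Cauchy

/-- The function `x ↦ 1 / (x + v)`. -/
def cauchyFun (v : ℂ) : ℝ → ℂ := fun x => ((x : ℂ) + v)⁻¹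

theorem im_le_norm_ofReal_add (v : ℂ) (x : ℝ) : v.im ≤ ‖(x : ℂ) + v‖ := by
  have := Complex.abs_im_le_norm ((x : ℂ) + v)
  simp only [add_im, ofReal_im, zero_add] at this
  exact (le_abs_self _).trans this

theorem ofReal_add_ne_zero {v : ℂ} (hv : 0 < v.im) (x : ℝ) : (x : ℂ) + v ≠ 0 :=
  norm_pos_iff.1 (hv.trans_le (im_le_norm_ofReal_add v x))

theorem norm_cauchyFun_le {v : ℂ} (hv : 0 < v.im) (x : ℝ) : ‖cauchyFun v x‖ ≤ v.im⁻¹ := by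
  rw [cauchyFun, norm_inv]
  gcongr
  exact im_le_norm_ofReal_add v x

theorem continuous_cauchyFun {v : ℂ} (hv : 0 < v.im) : Continuous (cauchyFun v) :=
  Continuous.inv₀ (by fun_prop) (ofReal_add_ne_zero hv)

theorem memLp_top_cauchyFun {v : ℂ} (hv : 0 < v.im) :
    MemLp (cauchyFun v) ∞ (volume : Measure ℝ) :=
  memLp_top_of_bound (continuous_cauchyFun hv).aestronglyMeasurable _
    (Eventually.of_forall (norm_cauchyFun_le hv))

theorem memLp_one_add_norm_inv {r : ℝ≥0∞} (h1 : 1 < r) (hr : r ≠ ⊤) :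
    MemLp (fun x : ℝ => (1 + ‖x‖)⁻¹) r volume := by
  have hr0 : r ≠ 0 := (zero_lt_one.trans h1).ne'
  have h1r : 1 < r.toReal := by
    simpa using (ENNReal.toReal_lt_toReal ENNReal.one_ne_top hr).2 h1
  have hcont : Continuous fun x : ℝ => (1 + ‖x‖)⁻¹ :=
    Continuous.inv₀ (by fun_prop) fun x => by positivity
  rw [← integrable_norm_rpow_iff hcont.aestronglyMeasurable hr0 hr]
  have := integrable_one_add_norm (E := ℝ) (μ := volume) (r := r.toReal) (by simpa using h1r)
  refine this.congr (Eventually.of_forall fun x => ?_)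
  have h0 : (0 : ℝ) ≤ 1 + ‖x‖ := by positivity
  have h2 : (0 : ℝ) ≤ (1 + ‖x‖)⁻¹ := by positivity
  change (1 + ‖x‖) ^ (-r.toReal) = ‖(1 + ‖x‖)⁻¹‖ ^ r.toReal
  rw [Real.norm_of_nonneg h2, Real.inv_rpow h0, Real.rpow_neg h0]

theorem memLp_cauchyFun {r : ℝ≥0∞} (h1 : 1 < r) (hr : r ≠ ⊤) {v : ℂ} (hv : 0 < v.im) :
    MemLp (cauchyFun v) r (volume : Measure ℝ) := by
  refine ((memLp_one_add_norm_inv h1 hr).const_mul (1 + (1 + ‖v‖) / v.im)).of_le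
    (continuous_cauchyFun hv).aestronglyMeasurable (Eventually.of_forall fun x => ?_)
  have h2 := im_le_norm_ofReal_add v x
  have h3 : 0 < ‖(x : ℂ) + v‖ := hv.trans_le h2
  have h4 : ‖x‖ ≤ ‖(x : ℂ) + v‖ + ‖v‖ := by
    have := norm_sub_le ((x : ℂ) + v) v
    simpa using this
  have h5 : (1 + ‖v‖) ≤ (1 + ‖v‖) / v.im * ‖(x : ℂ) + v‖ := by
    rw [div_mul_eq_mul_div, le_div_iff₀ hv]
    gcongr
  have h0 : (0 : ℝ) < 1 + ‖x‖ := by positivity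
  rw [cauchyFun, norm_inv, Real.norm_of_nonneg (by positivity), ← div_eq_mul_inv,
    inv_le_comm₀ h3 (by positivity), inv_div, div_le_iff₀ (by positivity)]
  nlinarith

/-- `x ↦ 1 / (x + v)` as an element of `L^r`. -/
def cauchyLp (r : ℝ≥0∞) (h1 : 1 < r) (hr : r ≠ ⊤) (v : ℂ) (hv : 0 < v.im) : LpR r :=
  (memLp_cauchyFun h1 hr hv).toLp _

theorem cauchyFun_mul_cauchyFun {v w : ℂ} (hv : 0 < v.im) (hw : 0 < w.im) (hvw : w ≠ v) (x : ℝ) :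
    cauchyFun v x * cauchyFun w x = (w - v)⁻¹ * (cauchyFun v x - cauchyFun w x) := by
  have h1 := ofReal_add_ne_zero hv x
  have h2 := ofReal_add_ne_zero hw x
  have h3 : w - v ≠ 0 := sub_ne_zero.2 hvw
  simp only [cauchyFun]
  field_simp
  ring

theorem integral_cauchyFun_mul_cauchyFun {v w : ℂ} (hv : 0 < v.im) (hw : 0 < w.im) :
    ∫ x, cauchyFun v x * cauchyFun w x = 0 := by
  have hinteg : Integrable (fun x => cauchyFun v x * cauchyFun w x) volume :=
    (memLp_cauchyFun (r := 2) (by norm_num) (by norm_num) hv).integrable_mul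
      (memLp_cauchyFun (r := 2) (by norm_num) (by norm_num) hw)
  have hlim : ∀ u : ℂ, ∀ l : Filter ℝ, Tendsto (fun x : ℝ => ‖x‖) l atTop →
      Tendsto (cauchyFun u) l (𝓝 0) := by
    intro u l hl
    refine tendsto_inv₀_cobounded.comp ?_
    rw [← tendsto_norm_atTop_iff_cobounded]
    refine tendsto_atTop_mono (f := fun x : ℝ => ‖x‖ - ‖u‖) (fun x => ?_)
      (tendsto_atTop_add_const_right _ _ hl)
    have := norm_sub_le ((x : ℂ) + u) u
    simp only [add_sub_cancel_right, norm_real] at this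
    linarith
  by_cases hvw : w = v
  · subst hvw
    have hd : ∀ x : ℝ, HasDerivAt (fun x => -cauchyFun w x) (cauchyFun w x * cauchyFun w x) x := by
      intro x
      have h1 := ofReal_add_ne_zero hw x
      have := (((hasDerivAt_id x).ofReal_comp.add_const w).inv h1).neg
      convert! this using 1
      simp only [cauchyFun, id]
      field_simp
      simp
    rw [integral_of_hasDerivAt_of_tendsto hd hinteg
      ((hlim w atBot tendsto_abs_atBot_atTop).neg) ((hlim w atTop tendsto_abs_atTop_atTop).neg)]
    simp
  · have h3 : w - v ≠ 0 := sub_ne_zero.2 hvw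
    let g : ℝ → ℂ := fun x => 1 + (v - w) * cauchyFun w x
    have hg : ∀ x, g x = ((x : ℂ) + v) / ((x : ℂ) + w) := by
      intro x
      have h2 := ofReal_add_ne_zero hw x
      simp only [g, cauchyFun]
      field_simp
      ring
    have hslit : ∀ x, g x ∈ slitPlane := by
      intro x
      rw [mem_slitPlane_iff_not_le_zero, hg]
      intro hle
      obtain ⟨hre, him⟩ := Complex.le_def.1 hle
      set c := ((x : ℂ) + v) / ((x : ℂ) + w) with hc
      have h2 := ofReal_add_ne_zero hw x
      have h4 : (x : ℂ) + v = c * ((x : ℂ) + w) := by rw [hc]; field_simp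
      have h5 := congrArg Complex.im h4
      simp only [add_im, ofReal_im, zero_add, mul_im, him, zero_im, zero_mul, add_zero] at h5
      simp only [zero_re] at hre
      nlinarith
    have hd : ∀ x : ℝ, HasDerivAt (fun x => (w - v)⁻¹ * Complex.log (g x))
        (cauchyFun v x * cauchyFun w x) x := by
      intro x
      have h1 := ofReal_add_ne_zero hv x
      have h2 := ofReal_add_ne_zero hw x
      have hg' : HasDerivAt g ((v - w) * (-1 / ((x : ℂ) + w) ^ 2)) x := by
        have := ((((hasDerivAt_id x).ofReal_comp.add_const w).inv h2).const_mul (v - w)).const_add 1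
        simpa [g, cauchyFun] using this
      have := (hg'.clog_real (hslit x)).const_mul (w - v)⁻¹
      convert! this using 1
      rw [hg]
      simp only [cauchyFun]
      field_simp
      ring
    have hl : ∀ l : Filter ℝ, Tendsto (fun x : ℝ => ‖x‖) l atTop →
        Tendsto (fun x => (w - v)⁻¹ * Complex.log (g x)) l (𝓝 0) := by
      intro l hl
      have h1 : Tendsto g l (𝓝 1) := by
        simpa [g] using ((hlim w l hl).const_mul (v - w)).const_add 1
      have h2 := (h1.clog (by simp)).const_mul (w - v)⁻¹
      simpa using h2
    rw [integral_of_hasDerivAt_of_tendsto hd hinteg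
      (hl atBot tendsto_abs_atBot_atTop) (hl atTop tendsto_abs_atTop_atTop)]
    simp

end Cauchy

section Pairing

theorem integrable_mul_Lp {p q : ℝ≥0∞} [ENNReal.HolderConjugate q p] (g : LpR q) (f : LpR p) :
    Integrable (fun x => g x * f x) volume :=
  (Lp.memLp g).integrable_mul (Lp.memLp f)

variable {p q : ℝ≥0∞} [Fact (1 ≤ p)] [Fact (1 ≤ q)] [ENNReal.HolderConjugate q p]

/-- The duality pairing `(g, f) ↦ ∫ g f` between `L^q` and `L^p`. -/
def pairL (q p : ℝ≥0∞) [Fact (1 ≤ p)] [Fact (1 ≤ q)] [ENNReal.HolderConjugate q p] :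
    LpR q →L[ℂ] LpR p →L[ℂ] ℂ :=
  (ContinuousLinearMap.mul ℂ ℂ).lpPairing volume q p

theorem pairL_apply (g : LpR q) (f : LpR p) : pairL q p g f = ∫ x, g x * f x :=
  ContinuousLinearMap.lpPairing_eq_integral _ g f

theorem norm_pairL_le (g : LpR q) (f : LpR p) : ‖pairL q p g f‖ ≤ ‖g‖ * ‖f‖ := by
  have h := (ContinuousLinearMap.mul ℂ ℂ).norm_holder_apply_apply_le (r := 1) g f
  have h2 : pairL q p g f = L1.integral ((ContinuousLinearMap.mul ℂ ℂ).holder 1 g f) := by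
    rw [pairL_apply, L1.integral_eq_integral]
    exact (integral_congr_ae ((ContinuousLinearMap.mul ℂ ℂ).coeFn_holder g f)).symm
  rw [h2]
  refine (L1.norm_integral_le _).trans (h.trans ?_)
  have : ‖ContinuousLinearMap.mul ℂ ℂ‖ ≤ 1 := ContinuousLinearMap.opNorm_mul_le ℂ ℂ
  calc _ ≤ 1 * ‖g‖ * ‖f‖ := by gcongr
    _ = _ := by ring

theorem pairL_mulOp {φ : ℝ → ℂ} (hφ : MemLp φ ∞ (volume : Measure ℝ)) (g : LpR q) (f : LpR p) :
    pairL q p g (mulOp p hφ f) = ∫ x, g x * (φ x * f x) := by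
  rw [pairL_apply]
  refine integral_congr_ae ?_
  filter_upwards [coeFn_mulOp hφ f] with x hx
  rw [hx]

theorem pairL_cauchyLp (h1 : 1 < q) (hq : q ≠ ⊤) {v : ℂ} (hv : 0 < v.im) (f : LpR p) :
    pairL q p (cauchyLp q h1 hq v hv) f = ∫ x : ℝ, f x / ((x : ℂ) + v) := by
  rw [pairL_apply]
  refine integral_congr_ae ?_
  filter_upwards [(memLp_cauchyFun h1 hq hv).coeFn_toLp] with x hx
  rw [cauchyLp, hx, cauchyFun, div_eq_mul_inv, mul_comm]

theorem eq_zero_of_pairL_eq_zero (hq : q ≠ ⊤) (g : LpR q) (h : ∀ f : LpR p, pairL q p g f = 0) :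
    g = 0 := by
  rw [Lp.eq_zero_iff_ae_eq_zero]
  refine Lp.ae_eq_zero_of_forall_setIntegral_eq_zero g (zero_lt_one.trans_le Fact.out).ne' hq
    (fun s _ hs => integrableOn_Lp_of_measure_ne_top g Fact.out hs.ne) fun s hs hμ => ?_
  rw [← h (indicatorConstLp p hs hμ.ne 1), pairL_apply, ← integral_indicator hs]
  refine integral_congr_ae ?_
  filter_upwards [indicatorConstLp_coeFn (p := p) (hs := hs) (hμs := hμ.ne) (c := (1 : ℂ))]
    with x hx
  rw [hx]
  by_cases hxs : x ∈ s <;> simp [hxs]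

end Pairing

section Exponential

/-- The character `x ↦ e^{ilx}`. -/
def expi (l : ℝ) : ℝ → ℂ := fun x => Complex.exp (Complex.I * l * x)

theorem norm_expi (l x : ℝ) : ‖expi l x‖ = 1 := by
  rw [expi, show Complex.I * l * x = ((l * x : ℝ) : ℂ) * Complex.I by push_cast; ring]
  exact Complex.norm_exp_ofReal_mul_I _

theorem continuous_expi : Continuous fun z : ℝ × ℝ => expi z.1 z.2 := by
  unfold expi
  fun_prop

theorem memLp_expi (l : ℝ) : MemLp (expi l) ∞ (volume : Measure ℝ) :=
  memLp_top_of_bound (continuous_expi.comp (Continuous.prodMk_right l)).aestronglyMeasurable 1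
    (Eventually.of_forall fun x => (norm_expi l x).le)

theorem expi_add (l m x : ℝ) : expi (l + m) x = expi l x * expi m x := by
  simp only [expi, ← Complex.exp_add]
  congr 1
  push_cast
  ring

theorem expi_neg_mul (l x : ℝ) : expi (-l) x * expi l x = 1 := by
  rw [← expi_add]
  simp [expi]

theorem expi_sub (l x y : ℝ) : expi l (x - y) = expi l x * expi (-l) y := by
  simp only [expi, ← Complex.exp_add]
  congr 1
  push_cast
  ring

end Exponential

section Hardy

variable {p q : ℝ≥0∞} [Fact (1 ≤ p)] [Fact (1 ≤ q)] [ENNReal.HolderConjugate q p]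

theorem mem_hardy_iff (h1 : 1 < q) (hq : q ≠ ⊤) (f : LpR p) :
    f ∈ hardy p ↔ ∀ (u : ℂ) (hu : 0 < u.im), pairL q p (cauchyLp q h1 hq u hu) f = 0 := by
  simp_rw [pairL_cauchyLp]
  rfl

theorem mem_mulHardy_iff {p : ℝ≥0∞} [Fact (1 ≤ p)] (l : ℝ) (g : LpR p) :
    g ∈ mulHardy p (fun x => Complex.exp (Complex.I * l * x)) ↔
      mulOp p (memLp_expi (-l)) g ∈ hardy p := by
  constructor
  · rintro ⟨f, hf, hg⟩
    have : mulOp p (memLp_expi (-l)) g = f := by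
      apply Lp.ext
      filter_upwards [coeFn_mulOp (memLp_expi (-l)) g, hg] with x h1 h2
      rw [h1, h2]
      change expi (-l) x * (expi l x * _) = _
      rw [← mul_assoc, expi_neg_mul, one_mul]
    rwa [this]
  · intro h
    refine ⟨_, h, ?_⟩
    filter_upwards [coeFn_mulOp (memLp_expi (-l)) g] with x h1
    rw [h1]
    change _ = expi l x * (expi (-l) x * _)
    rw [← mul_assoc, mul_comm (expi l x), expi_neg_mul, one_mul]

theorem mulOp_comm {p : ℝ≥0∞} [Fact (1 ≤ p)] {φ ψ : ℝ → ℂ}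
    (hφ : MemLp φ ∞ (volume : Measure ℝ)) (hψ : MemLp ψ ∞ (volume : Measure ℝ)) (f : LpR p) :
    mulOp p hφ (mulOp p hψ f) = mulOp p hψ (mulOp p hφ f) := by
  apply Lp.ext
  filter_upwards [coeFn_mulOp hφ (mulOp p hψ f), coeFn_mulOp hψ f,
    coeFn_mulOp hψ (mulOp p hφ f), coeFn_mulOp hφ f] with x h1 h2 h3 h4
  rw [h1, h2, h3, h4]
  ring

theorem mulOp_cauchyFun_mem_hardy (h1 : 1 < q) (hq : q ≠ ⊤) (hp : p ≠ ⊤) {v : ℂ} (hv : 0 < v.im)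
    {f : LpR p} (hf : f ∈ hardy p) : mulOp p (memLp_top_cauchyFun hv) f ∈ hardy p := by
  have hne : ∀ (w : ℂ) (hw : 0 < w.im) (u : ℂ) (hu : 0 < u.im), u ≠ w →
      pairL q p (cauchyLp q h1 hq u hu) (mulOp p (memLp_top_cauchyFun hw) f) = 0 := by
    intro w hw u hu huw
    have e : ∫ x, cauchyLp q h1 hq u hu x * (cauchyFun w x * f x) =
        ∫ x, (u - w)⁻¹ * (cauchyLp q h1 hq w hw x * f x - cauchyLp q h1 hq u hu x * f x) := by
      refine integral_congr_ae ?_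
      filter_upwards [(memLp_cauchyFun h1 hq hu).coeFn_toLp,
        (memLp_cauchyFun h1 hq hw).coeFn_toLp] with x h3 h4
      rw [cauchyLp, cauchyLp, h3, h4, ← mul_assoc, mul_comm (cauchyFun u x),
        cauchyFun_mul_cauchyFun hw hu huw]
      ring
    rw [pairL_mulOp, e, integral_const_mul, integral_sub (integrable_mul_Lp _ _)
      (integrable_mul_Lp _ _), ← pairL_apply, ← pairL_apply, (mem_hardy_iff h1 hq f).1 hf u hu,
      (mem_hardy_iff h1 hq f).1 hf w hw]
    simp
  rw [mem_hardy_iff h1 hq]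
  intro u hu
  by_cases huv : u = v
  · subst huv
    have him : ∀ n : ℕ, 0 < (u + (1 / ((n : ℝ) + 1) : ℝ) * Complex.I).im := by
      intro n
      simp only [add_im, mul_im, ofReal_re, I_im, ofReal_im, I_re]
      positivity
    have hn : Tendsto (fun n : ℕ => u + (1 / ((n : ℝ) + 1) : ℝ) * Complex.I) atTop (𝓝 u) := by
      have h := (Complex.continuous_ofReal.tendsto 0).comp
        (tendsto_one_div_add_atTop_nhds_zero_nat (𝕜 := ℝ))
      simpa using (h.mul_const Complex.I).const_add u
    have hlim := tendsto_mulOp hp (l := atTop) (fun n => memLp_top_cauchyFun (him n))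
      (memLp_top_cauchyFun hu) u.im⁻¹ (Eventually.of_forall fun n x => by
        refine (norm_cauchyFun_le (him n) x).trans ?_
        gcongr
        simp only [add_im, mul_im, ofReal_re, I_im, ofReal_im, I_re]
        have : 0 < 1 / ((n : ℝ) + 1) := by positivity
        linarith) (norm_cauchyFun_le hu) (fun x => by
        exact (hn.const_add (x : ℂ)).inv₀ (ofReal_add_ne_zero hu x)) f
    have := ((pairL q p (cauchyLp q h1 hq u hu)).continuous.tendsto _).comp hlim
    refine tendsto_nhds_unique this (tendsto_const_nhds.congr fun n => ?_)
    refine (hne _ (him n) u hu ?_).symm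
    intro h
    have := congrArg Complex.im h
    have h0 : 0 < 1 / ((n : ℝ) + 1) := by positivity
    simp only [add_im, mul_im, ofReal_re, I_im, ofReal_im, I_re] at this
    linarith
  · exact hne v hv u hu huv

theorem isClosed_hardy (h1 : 1 < q) (hq : q ≠ ⊤) : IsClosed (hardy p) := by
  have : hardy p = ⋂ (u : ℂ) (hu : 0 < u.im),
      (pairL q p (cauchyLp q h1 hq u hu)) ⁻¹' {0} := by
    ext f
    simp only [mem_hardy_iff h1 hq, Set.mem_iInter, Set.mem_preimage, Set.mem_singleton_iff]
  rw [this]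
  exact isClosed_iInter fun u => isClosed_iInter fun hu =>
    isClosed_singleton.preimage (pairL q p (cauchyLp q h1 hq u hu)).continuous

/-- `H^p` as a submodule of `L^p`. -/
def hardySub (h1 : 1 < q) (hq : q ≠ ⊤) : Submodule ℂ (LpR p) where
  carrier := hardy p
  add_mem' {f g} hf hg := by
    rw [mem_hardy_iff h1 hq] at *
    intro u hu
    rw [map_add, hf u hu, hg u hu, add_zero]
  zero_mem' := by
    rw [mem_hardy_iff h1 hq]
    intro u hu
    rw [map_zero]
  smul_mem' c f hf := by
    rw [mem_hardy_iff h1 hq] at *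
    intro u hu
    rw [map_smul, hf u hu, smul_zero]

theorem smul_mem_hardy (h1 : 1 < q) (hq : q ≠ ⊤) (c : ℂ) {f : LpR p} (hf : f ∈ hardy p) :
    c • f ∈ hardy p :=
  (hardySub h1 hq).smul_mem c hf

theorem mulOp_expi_mem_hardy (h1 : 1 < q) (hq : q ≠ ⊤) (hp : p ≠ ⊤) {l : ℝ} (hl : 0 ≤ l)
    {f : LpR p} (hf : f ∈ hardy p) : mulOp p (memLp_expi l) f ∈ hardy p := by
  rcases hl.eq_or_lt with rfl | hl
  · have : mulOp p (memLp_expi 0) f = f := by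
      apply Lp.ext
      filter_upwards [coeFn_mulOp (memLp_expi 0) f] with x h
      rw [h]
      simp [expi]
    rwa [this]
  let b : ℕ → ℝ → ℂ := fun n x => 1 + (-(Complex.I * l * x)) / n
  have hbre : ∀ n x, (b n x).re = 1 := by
    intro n x
    simp only [b, add_re, one_re, div_natCast_re, neg_re, mul_re, I_re, ofReal_re, I_im, ofReal_im,
      mul_im]
    simp
  have hb1 : ∀ n x, 1 ≤ ‖b n x‖ := fun n x => by
    have := Complex.re_le_norm (b n x)
    rwa [hbre] at this
  have hb0 : ∀ n x, b n x ≠ 0 := fun n x => norm_pos_iff.1 (zero_lt_one.trans_le (hb1 n x))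
  have hbc : ∀ n, Continuous (b n) := fun n => by
    simp only [b]
    fun_prop
  have hle : ∀ n k x, ‖((b n x)⁻¹) ^ k‖ ≤ 1 := fun n k x => by
    rw [norm_pow, norm_inv]
    exact pow_le_one₀ (by positivity) (inv_le_one_of_one_le₀ (hb1 n x))
  have hmem : ∀ n k, MemLp (fun x => ((b n x)⁻¹) ^ k) ∞ (volume : Measure ℝ) := fun n k =>
    memLp_top_of_bound (((hbc n).inv₀ (hb0 n)).pow k).aestronglyMeasurable 1
      (Eventually.of_forall (hle n k))
  have hmain : ∀ n : ℕ, 0 < n → ∀ k, mulOp p (hmem n k) f ∈ hardy p := by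
    intro n hn k
    induction k with
    | zero =>
      have : mulOp p (hmem n 0) f = f := by
        apply Lp.ext
        filter_upwards [coeFn_mulOp (hmem n 0) f] with x h
        rw [h]
        simp
      rwa [this]
    | succ k ih =>
      have hn' : (0 : ℝ) < n := by exact_mod_cast hn
      set v : ℂ := ((n / l : ℝ) : ℂ) * Complex.I with hvdef
      have hv : 0 < v.im := by
        simp only [hvdef, mul_im, ofReal_re, I_im, ofReal_im, I_re]
        have : 0 < n / l := by positivity
        linarith
      have hbv : ∀ x, (b n x)⁻¹ = v * cauchyFun v x := by
        intro x
        have h2 := ofReal_add_ne_zero hv x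
        have h3 := hb0 n x
        have hlC : (l : ℂ) ≠ 0 := by exact_mod_cast hl.ne'
        have hnC : (n : ℂ) ≠ 0 := by exact_mod_cast hn.ne'
        rw [cauchyFun, ← div_eq_mul_inv, eq_div_iff h2, inv_mul_eq_iff_eq_mul₀ h3]
        simp only [hvdef, b]
        push_cast
        field_simp
        ring_nf
        simp only [I_sq]
        ring
      have : mulOp p (hmem n (k + 1)) f =
          v • mulOp p (memLp_top_cauchyFun hv) (mulOp p (hmem n k) f) := by
        apply Lp.ext
        filter_upwards [coeFn_mulOp (hmem n (k + 1)) f, coeFn_mulOp (hmem n k) f,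
          coeFn_mulOp (memLp_top_cauchyFun hv) (mulOp p (hmem n k) f),
          Lp.coeFn_smul v (mulOp p (memLp_top_cauchyFun hv) (mulOp p (hmem n k) f))]
          with x e1 e2 e3 e4
        rw [e1, e4, Pi.smul_apply, e3, e2, pow_succ, hbv, smul_eq_mul]
        ring
      rw [this]
      exact smul_mem_hardy h1 hq v (mulOp_cauchyFun_mem_hardy h1 hq hp hv ih)
  have hlim := tendsto_mulOp hp (l := atTop) (fun n => hmem n n) (memLp_expi l) 1
    (Eventually.of_forall fun n => hle n n) (fun x => (norm_expi l x).le) (fun x => by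
      have h := (Complex.tendsto_one_add_div_pow_exp (-(Complex.I * l * x))).inv₀
        (Complex.exp_ne_zero _)
      rw [← Complex.exp_neg, neg_neg] at h
      refine h.congr fun n => ?_
      rw [inv_pow]) f
  exact (isClosed_hardy h1 hq).mem_of_tendsto hlim
    ((eventually_gt_atTop 0).mono fun n hn => hmain n hn n)

theorem transL_mem_hardy {p : ℝ≥0∞} [Fact (1 ≤ p)] (m : ℝ) {f : LpR p} (hf : f ∈ hardy p) :
    transL p m f ∈ hardy p := by
  intro u hu
  have e : ∫ x : ℝ, (transL p m f : ℝ → ℂ) x / ((x : ℂ) + u) =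
      ∫ x : ℝ, (fun y : ℝ => (f : ℝ → ℂ) y / ((y : ℂ) + (m + u))) (x - m) := by
    refine integral_congr_ae ?_
    filter_upwards [coeFn_transL m f] with x hx
    rw [hx]
    congr 1
    push_cast
    ring
  rw [e, integral_sub_right_eq_self (fun y : ℝ => (f : ℝ → ℂ) y / ((y : ℂ) + (m + u)))]
  exact hf _ (by simpa using hu)

theorem mulOp_expi_transL {p : ℝ≥0∞} [Fact (1 ≤ p)] (l m : ℝ) (f : LpR p) :
    mulOp p (memLp_expi l) (transL p m f) =
      expi l m • transL p m (mulOp p (memLp_expi l) f) := by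
  apply Lp.ext
  have h := (measurePreserving_sub_right (volume : Measure ℝ) m).quasiMeasurePreserving.ae
    (coeFn_mulOp (memLp_expi l) f)
  filter_upwards [coeFn_mulOp (memLp_expi l) (transL p m f), coeFn_transL m f,
    Lp.coeFn_smul (expi l m) (transL p m (mulOp p (memLp_expi l) f)),
    coeFn_transL m (mulOp p (memLp_expi l) f), h] with x e1 e2 e3 e4 e5
  rw [e1, e2, e3, Pi.smul_apply, e4, e5, expi_sub, smul_eq_mul]
  have := expi_neg_mul l m
  calc _ = expi l x * f (x - m) * 1 := by ring
    _ = _ := by rw [← this]; ring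

end Hardy

section EasyInclusion

variable {p q : ℝ≥0∞} [Fact (1 ≤ p)] [Fact (1 ≤ q)] [ENNReal.HolderConjugate q p]

theorem eq_mulOp_of_isMulOp {p : ℝ≥0∞} [Fact (1 ≤ p)] {l : ℝ} {T : LpR p →L[ℂ] LpR p}
    (hT : IsMulOp p (fun x => Complex.exp (Complex.I * l * x)) T) :
    T = mulOp p (memLp_expi l) := by
  ext1 f
  exact Lp.ext ((hT f).trans (coeFn_mulOp (memLp_expi l) f).symm)

theorem eq_transL_of_isTransOp {p : ℝ≥0∞} [Fact (1 ≤ p)] {m : ℝ} {T : LpR p →L[ℂ] LpR p}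
    (hT : IsTransOp p m T) : T = transL p m := by
  ext1 f
  exact Lp.ext ((hT f).trans (coeFn_transL m f).symm)

theorem memLp_indicator_Iio (t : ℝ) :
    MemLp ((Set.Iio t).indicator fun _ => (1 : ℂ)) ∞ (volume : Measure ℝ) :=
  (memLp_top_const (1 : ℂ)).indicator measurableSet_Iio

theorem mem_LpHalfLine_iff {p : ℝ≥0∞} [Fact (1 ≤ p)] (t : ℝ) (f : LpR p) :
    f ∈ LpHalfLine p t ↔ mulOp p (memLp_indicator_Iio t) f = 0 := by
  rw [Lp.eq_zero_iff_ae_eq_zero]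
  constructor
  · intro h
    filter_upwards [coeFn_mulOp (memLp_indicator_Iio t) f, h] with x h1 h2
    rw [h1]
    by_cases hx : x < t
    · simp [h2 hx]
    · simp [hx]
  · intro h
    have h' : ∀ᵐ x : ℝ, (mulOp p (memLp_indicator_Iio t) f : ℝ → ℂ) x = 0 := h
    change ∀ᵐ x : ℝ, x < t → (f : ℝ → ℂ) x = 0
    filter_upwards [coeFn_mulOp (memLp_indicator_Iio t) f, h'] with x h1 h2 hx
    rw [h1] at h2
    simpa [hx] using h2

/-- The closed submodules forming the Fourier binest, indexed by `ℝ ⊕ ℝ`. -/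
def binestSub (h1 : 1 < q) (hq : q ≠ ⊤) : ℝ ⊕ ℝ → Submodule ℂ (LpR p)
  | .inl t => (mulOp p (memLp_indicator_Iio t)).toLinearMap.ker
  | .inr l => (hardySub h1 hq).comap (mulOp p (memLp_expi (-l))).toLinearMap

theorem isClosed_binestSub (h1 : 1 < q) (hq : q ≠ ⊤) (i : ℝ ⊕ ℝ) :
    IsClosed (binestSub (p := p) h1 hq i : Set (LpR p)) := by
  cases i with
  | inl t => exact isClosed_singleton.preimage (mulOp p (memLp_indicator_Iio t)).continuous
  | inr l => exact (isClosed_hardy h1 hq).preimage (mulOp p (memLp_expi (-l))).continuous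

theorem mem_fourierBinest_iff (h1 : 1 < q) (hq : q ≠ ⊤) (T : LpR p →L[ℂ] LpR p) :
    T ∈ fourierBinest p ↔ ∀ i, ∀ f ∈ binestSub (p := p) h1 hq i, T f ∈ binestSub h1 hq i := by
  have hl : ∀ (t : ℝ) (f : LpR p), f ∈ LpHalfLine p t ↔ f ∈ binestSub (p := p) h1 hq (.inl t) :=
    fun t f => mem_LpHalfLine_iff t f
  have hr : ∀ (l : ℝ) (f : LpR p), f ∈ mulHardy p (fun x => Complex.exp (Complex.I * l * x)) ↔
      f ∈ binestSub (p := p) h1 hq (.inr l) := fun l f => mem_mulHardy_iff l f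
  simp only [fourierBinest, Set.mem_ofPred_eq, hl, hr, Sum.forall]

/-- The algebra of operators leaving invariant a family of submodules. -/
def invariantAlgebra {p : ℝ≥0∞} [Fact (1 ≤ p)] {ι : Type*} (N : ι → Submodule ℂ (LpR p)) :
    Subalgebra ℂ (LpR p →L[ℂ] LpR p) where
  carrier := {T | ∀ i, ∀ f ∈ N i, T f ∈ N i}
  mul_mem' hS hT i f hf := hS i _ (hT i f hf)
  add_mem' hS hT i f hf := (N i).add_mem (hS i f hf) (hT i f hf)
  algebraMap_mem' c i f hf := by
    rw [Algebra.algebraMap_eq_smul_one]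
    exact (N i).smul_mem c hf

theorem isSOTClosed_invariantAlgebra {p : ℝ≥0∞} [Fact (1 ≤ p)] {ι : Type*}
    (N : ι → Submodule ℂ (LpR p)) (hN : ∀ i, IsClosed (N i : Set (LpR p))) :
    IsSOTClosed p (invariantAlgebra N) := by
  intro T hT i f hf
  refine closure_minimal ?_ ((hN i).preimage (continuous_apply f)) hT
  rintro _ ⟨A, hA, rfl⟩
  exact hA i f hf

theorem parabolicAlgebra_subset_fourierBinest (h1 : 1 < q) (hq : q ≠ ⊤) (hp : p ≠ ⊤) :
    parabolicAlgebra p ⊆ fourierBinest p := by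
  have hS : fourierBinest p = invariantAlgebra (binestSub (p := p) h1 hq) := by
    ext T
    exact mem_fourierBinest_iff h1 hq T
  refine Set.sInter_subset_of_mem ⟨?_, ?_, ⟨_, hS.symm⟩⟩
  · rintro T (⟨l, hl, hT⟩ | ⟨m, hm, hT⟩)
    · rw [eq_mulOp_of_isMulOp hT, mem_fourierBinest_iff h1 hq]
      rintro (t | s) f hf
      · change mulOp p _ _ = 0
        rw [mulOp_comm, show mulOp p (memLp_indicator_Iio t) f = 0 from hf, map_zero]
      · change mulOp p _ _ ∈ hardy p
        rw [mulOp_comm]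
        exact mulOp_expi_mem_hardy h1 hq hp hl hf
    · rw [eq_transL_of_isTransOp hT]
      constructor
      · intro t f hf
        have hf' : ∀ᵐ x : ℝ, x < t → (f : ℝ → ℂ) x = 0 := hf
        change ∀ᵐ x : ℝ, x < t → (transL p m f : ℝ → ℂ) x = 0
        filter_upwards [coeFn_transL m f,
          (measurePreserving_sub_right (volume : Measure ℝ) m).quasiMeasurePreserving.ae hf']
          with x h2 h3 hx
        rw [h2]
        exact h3 (by linarith)
      · intro l f hf
        rw [mem_mulHardy_iff] at hf ⊢
        rw [mulOp_expi_transL]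
        exact smul_mem_hardy h1 hq _ (transL_mem_hardy m hf)
  · rw [hS]
    exact isSOTClosed_invariantAlgebra _ (isClosed_binestSub h1 hq)

end EasyInclusion

section ClosedSpan

theorem Submodule.integral_mem_of_isClosed {α E : Type*} [MeasurableSpace α] {μ : Measure α}
    [NormedAddCommGroup E] [NormedSpace ℂ E] [CompleteSpace E] {W : Submodule ℂ E}
    (hW : IsClosed (W : Set E)) {f : α → E} (hf : Integrable f μ) (h : ∀ᵐ a ∂μ, f a ∈ W) :
    ∫ a, f a ∂μ ∈ W := by
  have := hW
  have h1 := W.mkQL.integral_comp_comm hf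
  have h2 : ∫ a, W.mkQL (f a) ∂μ = 0 := by
    refine integral_eq_zero_of_ae ?_
    filter_upwards [h] with a ha
    exact (Submodule.Quotient.mk_eq_zero W).2 ha
  rw [h2] at h1
  exact (Submodule.Quotient.mk_eq_zero W).1 h1.symm

variable {p : ℝ≥0∞} [Fact (1 ≤ p)] {ι : Type*}

/-- The closed span of the simultaneous orbit of a family of vectors. -/
def orbitClosure (S : Subalgebra ℂ (LpR p →L[ℂ] LpR p)) (F : ι → LpR p) :
    Submodule ℂ (ι → LpR p) :=
  ((Subalgebra.toSubmodule S).map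
    (LinearMap.pi fun i =>
      (ContinuousLinearMap.apply ℂ (LpR p) (F i)).toLinearMap)).topologicalClosure

theorem isClosed_orbitClosure (S : Subalgebra ℂ (LpR p →L[ℂ] LpR p)) (F : ι → LpR p) :
    IsClosed (orbitClosure S F : Set (ι → LpR p)) :=
  Submodule.isClosed_topologicalClosure _

theorem apply_mem_orbitClosure {S : Subalgebra ℂ (LpR p →L[ℂ] LpR p)} {A : LpR p →L[ℂ] LpR p}
    (hA : A ∈ S) (F : ι → LpR p) : (fun i => A (F i)) ∈ orbitClosure S F :=
  Submodule.le_topologicalClosure _ ⟨A, hA, rfl⟩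

theorem comp_mem_orbitClosure {S : Subalgebra ℂ (LpR p →L[ℂ] LpR p)} {A : LpR p →L[ℂ] LpR p}
    (hA : A ∈ S) {F G : ι → LpR p} (hG : G ∈ orbitClosure S F) :
    (fun i => A (G i)) ∈ orbitClosure S F := by
  have hc : Continuous fun H : ι → LpR p => fun i => A (H i) := by fun_prop
  refine closure_minimal ?_ ((isClosed_orbitClosure S F).preimage hc) hG
  rintro _ ⟨B, hB, rfl⟩
  exact apply_mem_orbitClosure (S.mul_mem hA hB) F

theorem mem_of_forall_mem_orbitClosure {S : Subalgebra ℂ (LpR p →L[ℂ] LpR p)}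
    (hS : IsSOTClosed p (S : Set (LpR p →L[ℂ] LpR p))) {T : LpR p →L[ℂ] LpR p}
    (h : ∀ I : Finset (LpR p), (fun i : I => T i) ∈ orbitClosure S fun i : I => (i : LpR p)) :
    T ∈ S := by
  refine hS T (mem_closure_iff.2 fun o ho hTo => ?_)
  obtain ⟨I, u, hu, hIo⟩ := isOpen_pi_iff.1 ho _ hTo
  have hopen : IsOpen (Set.univ.pi fun i : I => u i) :=
    isOpen_set_pi Set.finite_univ fun i _ => (hu i i.2).1
  obtain ⟨_, hG, ⟨A, hA, rfl⟩⟩ := mem_closure_iff.1 (h I) _ hopen fun i _ => (hu _ i.2).2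
  exact ⟨A, hIo fun a ha => hG ⟨a, ha⟩ trivial, A, hA, rfl⟩

theorem IsSOTClosed.mem_of_tendsto {S : Set (LpR p →L[ℂ] LpR p)} (hS : IsSOTClosed p S)
    {κ : Type*} {l : Filter κ} [l.NeBot] {A : κ → LpR p →L[ℂ] LpR p} (hA : ∀ᶠ i in l, A i ∈ S)
    {T : LpR p →L[ℂ] LpR p} (h : ∀ f, Tendsto (fun i => A i f) l (𝓝 (T f))) : T ∈ S :=
  hS T (mem_closure_of_tendsto (tendsto_pi_nhds.2 h)
    (hA.mono fun _ hi => Set.mem_image_of_mem _ hi))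

end ClosedSpan

section Multipliers

variable {p : ℝ≥0∞} [Fact (1 ≤ p)]

/-- Multiplication by `φ` is a bounded operator belonging to `S`. -/
def IsMultiplier (S : Subalgebra ℂ (LpR p →L[ℂ] LpR p)) (φ : ℝ → ℂ) : Prop :=
  ∃ hφ : MemLp φ ∞ (volume : Measure ℝ), mulOp p hφ ∈ S

variable {S : Subalgebra ℂ (LpR p →L[ℂ] LpR p)} {φ ψ : ℝ → ℂ}

theorem IsMultiplier.zero : IsMultiplier S fun _ => 0 := by
  refine ⟨MemLp.zero', ?_⟩
  convert S.zero_mem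
  ext1 f
  apply Lp.ext
  filter_upwards [coeFn_mulOp (φ := fun _ => 0) MemLp.zero' f,
    Lp.coeFn_zero ℂ p (volume : Measure ℝ)] with x h1 h2
  rw [h1, zero_mul]
  exact h2.symm

theorem IsMultiplier.add (hφ : IsMultiplier S φ) (hψ : IsMultiplier S ψ) :
    IsMultiplier S fun x => φ x + ψ x := by
  obtain ⟨h1, hA⟩ := hφ
  obtain ⟨h2, hB⟩ := hψ
  refine ⟨h1.add h2, ?_⟩
  convert S.add_mem hA hB
  ext1 f
  apply Lp.ext
  filter_upwards [coeFn_mulOp (h1.add h2) f, coeFn_mulOp h1 f, coeFn_mulOp h2 f,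
    Lp.coeFn_add (mulOp p h1 f) (mulOp p h2 f)] with x e1 e2 e3 e4
  simp only [add_apply, e1, e4, Pi.add_apply, e2, e3, add_mul]

theorem IsMultiplier.const_mul (c : ℂ) (hφ : IsMultiplier S φ) :
    IsMultiplier S fun x => c * φ x := by
  obtain ⟨h1, hA⟩ := hφ
  refine ⟨h1.const_mul c, ?_⟩
  convert S.smul_mem hA c
  ext1 f
  apply Lp.ext
  filter_upwards [coeFn_mulOp (h1.const_mul c) f, coeFn_mulOp h1 f,
    Lp.coeFn_smul c (mulOp p h1 f)] with x e1 e2 e3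
  simp only [smul_apply, e1, e3, Pi.smul_apply, e2, smul_eq_mul, mul_assoc]

theorem IsMultiplier.mul (hφ : IsMultiplier S φ) (hψ : IsMultiplier S ψ) :
    IsMultiplier S fun x => φ x * ψ x := by
  obtain ⟨h1, hA⟩ := hφ
  obtain ⟨h2, hB⟩ := hψ
  have h3 : MemLp (fun x => φ x * ψ x) ∞ (volume : Measure ℝ) := h2.mul h1
  refine ⟨h3, ?_⟩
  convert S.mul_mem hA hB
  ext1 f
  apply Lp.ext
  filter_upwards [coeFn_mulOp h3 f, coeFn_mulOp h1 (mulOp p h2 f), coeFn_mulOp h2 f]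
    with x e1 e2 e3
  rw [mul_apply_eq_comp, e1, e2, e3, mul_assoc]

theorem IsMultiplier.of_tendsto (hp : p ≠ ⊤) (hS : IsSOTClosed p (S : Set (LpR p →L[ℂ] LpR p)))
    {κ : Type*} {l : Filter κ} [l.NeBot] [l.IsCountablyGenerated] {φ : κ → ℝ → ℂ}
    (hφ : ∀ i, IsMultiplier S (φ i)) (hψ : MemLp ψ ∞ (volume : Measure ℝ)) (C : ℝ)
    (hC : ∀ i x, ‖φ i x‖ ≤ C) (hlim : ∀ x, Tendsto (fun i => φ i x) l (𝓝 (ψ x))) :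
    IsMultiplier S ψ := by
  choose h1 h2 using hφ
  exact ⟨hψ, hS.mem_of_tendsto (Eventually.of_forall h2)
    (tendsto_mulOp hp h1 hψ C (Eventually.of_forall hC)
      (fun x => le_of_tendsto (hlim x).norm (Eventually.of_forall fun i => hC i x)) hlim)⟩

theorem isMultiplier_expi (hgens : parabolicGens p ⊆ S) {l : ℝ} (hl : 0 ≤ l) :
    IsMultiplier S (expi l) :=
  ⟨memLp_expi l, hgens (Or.inl ⟨l, hl, coeFn_mulOp (memLp_expi l)⟩)⟩

theorem transL_mem (hgens : parabolicGens p ⊆ S) {m : ℝ} (hm : 0 ≤ m) : transL p m ∈ S :=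
  hgens (Or.inr ⟨m, hm, coeFn_transL m⟩)

theorem tendsto_riemann_sum_exp {w : ℂ} (hw : 0 < w.im) :
    Tendsto (fun N : ℕ => ∑ n ∈ Finset.range ((N + 1) * (N + 1)),
      (((N + 1 : ℝ)⁻¹ : ℝ) : ℂ) * Complex.exp (Complex.I * (n * (N + 1 : ℝ)⁻¹ : ℝ) * w))
      atTop (𝓝 (Complex.I * w⁻¹)) := by
  have hw0 : w ≠ 0 := by rintro rfl; simp at hw
  have hh : Tendsto (fun N : ℕ => ((N + 1 : ℝ)⁻¹ : ℝ)) atTop (𝓝[≠] 0) := by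
    refine tendsto_nhdsWithin_iff.2 ⟨?_, Eventually.of_forall fun N => ?_⟩
    · simpa using tendsto_one_div_add_atTop_nhds_zero_nat (𝕜 := ℝ)
    · have : (0 : ℝ) < N + 1 := by positivity
      simpa using this.ne'
  have hd : HasDerivAt (fun t : ℝ => Complex.exp (Complex.I * t * w)) (Complex.I * w) 0 := by
    have h1 : HasDerivAt (fun t : ℝ => Complex.I * (t : ℂ) * w) (Complex.I * 1 * w) 0 :=
      ((Complex.ofRealCLM.hasDerivAt (x := (0 : ℝ))).const_mul Complex.I).mul_const w
    simpa using h1.cexp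
  have hs := (hasDerivAt_iff_tendsto_slope.1 hd).comp hh
  have hq : ∀ N : ℕ, ‖Complex.exp (Complex.I * ((N + 1 : ℝ)⁻¹ : ℝ) * w)‖ < 1 := by
    intro N
    rw [Complex.norm_exp, Real.exp_lt_one_iff]
    have : (0 : ℝ) < N + 1 := by positivity
    simp only [mul_re, I_re, ofReal_re, I_im, ofReal_im, mul_im]
    have : 0 < (N + 1 : ℝ)⁻¹ * w.im := by positivity
    linarith
  have hlast : Tendsto (fun N : ℕ => Complex.exp (Complex.I * ((N + 1 : ℝ) : ℂ) * w))
      atTop (𝓝 0) := by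
    rw [tendsto_zero_iff_norm_tendsto_zero]
    have e : ∀ N : ℕ, ‖Complex.exp (Complex.I * ((N + 1 : ℝ) : ℂ) * w)‖ =
        Real.exp (-(((N : ℝ) + 1) * w.im)) := by
      intro N
      rw [Complex.norm_exp]
      simp
    simp_rw [e]
    refine Real.tendsto_exp_neg_atTop_nhds_zero.comp ?_
    exact (tendsto_atTop_add_const_right _ _ tendsto_natCast_atTop_atTop).atTop_mul_const hw
  have hlim := (hs.inv₀ (mul_ne_zero Complex.I_ne_zero hw0)).mul (hlast.sub_const 1)
  have e0 : (Complex.I * w)⁻¹ * (0 - 1) = Complex.I * w⁻¹ := by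
    rw [mul_inv, Complex.inv_I]; ring
  rw [e0] at hlim
  refine hlim.congr fun N => ?_
  have hN : (N + 1 : ℂ) ≠ 0 := by exact_mod_cast Nat.succ_ne_zero N
  set z := Complex.exp (Complex.I * ((N + 1 : ℝ)⁻¹ : ℝ) * w) with hz
  have hz1 : z - 1 ≠ 0 := by
    intro h0
    have := hq N
    rw [← hz, sub_eq_zero.1 h0] at this
    simp at this
  have hterm : ∀ n : ℕ, Complex.exp (Complex.I * (n * (N + 1 : ℝ)⁻¹ : ℝ) * w) = z ^ n := by
    intro n
    rw [hz, ← Complex.exp_nat_mul]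
    congr 1
    push_cast
    ring
  have hend : Complex.exp (Complex.I * ((N + 1 : ℝ) : ℂ) * w) = z ^ ((N + 1) * (N + 1)) := by
    rw [← hterm]
    congr 2
    push_cast
    field_simp
  simp_rw [hterm]
  rw [← Finset.mul_sum, geom_sum_eq (sub_ne_zero.1 hz1), hend]
  simp only [Function.comp, slope_def_module, sub_zero, ofReal_zero, mul_zero, zero_mul,
    Complex.exp_zero, ← hz]
  rw [inv_inv, Complex.real_smul, mul_inv]
  push_cast
  ring

theorem sum_exp_neg_le {h y : ℝ} (hh : 0 < h) (hy : 0 < y) (M : ℕ) :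
    ∑ n ∈ Finset.range M, h * Real.exp (-(n * h * y)) ≤ y⁻¹ + h := by
  have ht : 0 < h * y := mul_pos hh hy
  have hr : Real.exp (-(h * y)) ≤ (1 + h * y)⁻¹ := by
    rw [Real.exp_neg]
    gcongr
    linarith [Real.add_one_le_exp (h * y)]
  have hr1 : (1 + h * y)⁻¹ < 1 := inv_lt_one_of_one_lt₀ (by linarith)
  have hsum : ∀ r : ℝ, 0 ≤ r → r < 1 → ∑ n ∈ Finset.range M, r ^ n ≤ (1 - r)⁻¹ := fun r h0 h1 =>
    (summable_geometric_of_lt_one h0 h1).sum_le_tsum _ (fun _ _ => by positivity) |>.trans_eq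
      (tsum_geometric_of_lt_one h0 h1)
  calc ∑ n ∈ Finset.range M, h * Real.exp (-(n * h * y))
      = h * ∑ n ∈ Finset.range M, Real.exp (-(h * y)) ^ n := by
        rw [Finset.mul_sum]
        refine Finset.sum_congr rfl fun n _ => ?_
        rw [← Real.exp_nat_mul]
        ring_nf
    _ ≤ h * (1 - (1 + h * y)⁻¹)⁻¹ := by
        gcongr
        refine (Finset.sum_le_sum fun n _ => ?_).trans (hsum _ (by positivity) hr1)
        gcongr
    _ = y⁻¹ + h := by
        have : 1 + h * y ≠ 0 := by positivity
        field_simp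
        ring

theorem isMultiplier_cauchyFun (hp : p ≠ ⊤) (hS : IsSOTClosed p (S : Set (LpR p →L[ℂ] LpR p)))
    (hgens : parabolicGens p ⊆ S) {v : ℂ} (hv : 0 < v.im) : IsMultiplier S (cauchyFun v) := by
  have hsum : ∀ (c : ℕ → ℂ) (l : ℕ → ℝ) (_ : ∀ n, 0 ≤ l n) (M : ℕ),
      IsMultiplier S fun x => ∑ n ∈ Finset.range M, c n * expi (l n) x := by
    intro c l hl M
    induction M with
    | zero => simpa using IsMultiplier.zero
    | succ M ih =>
      simp_rw [Finset.sum_range_succ]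
      exact ih.add ((isMultiplier_expi hgens (hl M)).const_mul (c M))
  have hterm : ∀ (N n : ℕ) (x : ℝ),
      (((N + 1 : ℝ)⁻¹ : ℝ) : ℂ) * Complex.exp (Complex.I * (n * (N + 1 : ℝ)⁻¹ : ℝ) * (x + v)) =
      ((((N + 1 : ℝ)⁻¹ : ℝ) : ℂ) * Complex.exp (Complex.I * (n * (N + 1 : ℝ)⁻¹ : ℝ) * v)) *
        expi (n * (N + 1 : ℝ)⁻¹) x := by
    intro N n x
    rw [expi, mul_add, Complex.exp_add]
    ring
  have key : IsMultiplier S fun x => Complex.I * cauchyFun v x := by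
    refine IsMultiplier.of_tendsto hp hS (l := atTop) (φ := fun (N : ℕ) x =>
      ∑ n ∈ Finset.range ((N + 1) * (N + 1)),
        (((N + 1 : ℝ)⁻¹ : ℝ) : ℂ) * Complex.exp (Complex.I * (n * (N + 1 : ℝ)⁻¹ : ℝ) * (x + v)))
      (fun N => ?_) ((memLp_top_cauchyFun hv).const_mul _) (v.im⁻¹ + 1) (fun N x => ?_)
      fun x => tendsto_riemann_sum_exp (by simpa using hv)
    · simp_rw [hterm]
      exact hsum _ _ (fun n => by positivity) _
    · have hN : (0 : ℝ) < (N + 1 : ℝ)⁻¹ := by positivity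
      have hN1 : (N + 1 : ℝ)⁻¹ ≤ 1 := inv_le_one_of_one_le₀ (by linarith [N.cast_nonneg (α := ℝ)])
      refine (norm_sum_le _ _).trans (le_trans (le_of_eq ?_)
        ((sum_exp_neg_le hN hv ((N + 1) * (N + 1))).trans (by gcongr)))
      refine Finset.sum_congr rfl fun n _ => ?_
      rw [norm_mul, Complex.norm_exp]
      congr 1
      · rw [Complex.norm_real, Real.norm_of_nonneg hN.le]
      · simp only [mul_re, mul_im, I_re, I_im, ofReal_re, ofReal_im, add_re, add_im]
        ring_nf
  simpa [← mul_assoc] using key.const_mul (-Complex.I)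

end Multipliers

section Causality

variable {p q : ℝ≥0∞} [Fact (1 ≤ p)] [Fact (1 ≤ q)] [ENNReal.HolderConjugate q p]

theorem memLp_indicator_Ici (t : ℝ) :
    MemLp ((Set.Ici t).indicator fun _ => (1 : ℂ)) ∞ (volume : Measure ℝ) :=
  (memLp_top_const (1 : ℂ)).indicator measurableSet_Ici

theorem pairL_mulOp_comm {φ : ℝ → ℂ} (hφ : MemLp φ ∞ (volume : Measure ℝ)) (g : LpR q)
    (f : LpR p) : pairL q p (mulOp q hφ g) f = pairL q p g (mulOp p hφ f) := by
  rw [pairL_mulOp, pairL_apply]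
  refine integral_congr_ae ?_
  filter_upwards [coeFn_mulOp hφ g] with x hx
  rw [hx]
  ring

theorem ae_reflL_eq_zero_of_invariant (hp : p ≠ ⊤) (hq : q ≠ ⊤) {T : LpR p →L[ℂ] LpR p}
    {k : ℝ → LpR q} (hk : ∀ f : LpR p, (T f : ℝ → ℂ) =ᵐ[volume] fun x => pairL q p (k x) f)
    (hT : ∀ t : ℝ, ∀ f ∈ LpHalfLine p t, T f ∈ LpHalfLine p t) :
    ∀ᵐ s : ℝ, ∀ᵐ t : ℝ, t < 0 → (reflL q s (k s) : ℝ → ℂ) t = 0 := by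
  have : Fact (p ≠ ∞) := ⟨hp⟩
  let d := TopologicalSpace.denseSeq (LpR p)
  have hmem : ∀ (a : ℝ) (f : LpR p), mulOp p (memLp_indicator_Ici a) f ∈ LpHalfLine p a := by
    intro a f
    change ∀ᵐ x : ℝ, x < a → (mulOp p (memLp_indicator_Ici a) f : ℝ → ℂ) x = 0
    filter_upwards [coeFn_mulOp (memLp_indicator_Ici a) f] with x hx hxa
    rw [hx, Set.indicator_of_notMem (by simpa using hxa), zero_mul]
  have h1 : ∀ᵐ x : ℝ, ∀ (a : ℚ) (n : ℕ), x < a →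
      pairL q p (k x) (mulOp p (memLp_indicator_Ici a) (d n)) = 0 := by
    refine ae_all_iff.2 fun a => ae_all_iff.2 fun n => ?_
    have h2 : ∀ᵐ x : ℝ, x < a →
      (T (mulOp p (memLp_indicator_Ici a) (d n)) : ℝ → ℂ) x = 0 := hT a _ (hmem a (d n))
    filter_upwards [h2, hk (mulOp p (memLp_indicator_Ici a) (d n))] with x hx hx' hxa
    rw [← hx', hx hxa]
  filter_upwards [h1] with s hs
  have h3 : ∀ a : ℚ, s < a → ∀ᵐ t : ℝ, (a : ℝ) ≤ t → (k s : ℝ → ℂ) t = 0 := by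
    intro a ha
    have h4 : mulOp q (memLp_indicator_Ici a) (k s) = 0 := by
      refine eq_zero_of_pairL_eq_zero (p := p) hq _ fun f => ?_
      rw [pairL_mulOp_comm]
      have h5 : (fun f => pairL q p (k s) (mulOp p (memLp_indicator_Ici (a : ℝ)) f)) =
          fun _ => 0 :=
        Continuous.ext_on (TopologicalSpace.denseRange_denseSeq (LpR p)) (by fun_prop)
          continuous_const (by rintro _ ⟨n, rfl⟩; exact hs a n ha)
      exact congrFun h5 f
    have h6 : ∀ᵐ t : ℝ, (mulOp q (memLp_indicator_Ici (a : ℝ)) (k s) : ℝ → ℂ) t = 0 :=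
      (Lp.eq_zero_iff_ae_eq_zero.1 h4)
    filter_upwards [h6, coeFn_mulOp (memLp_indicator_Ici (a : ℝ)) (k s)] with t ht ht' hat
    rw [ht', Set.indicator_of_mem (by simpa using hat), one_mul] at ht
    exact ht
  have h7 : ∀ᵐ t : ℝ, s < t → (k s : ℝ → ℂ) t = 0 := by
    have h8 : ∀ᵐ t : ℝ, ∀ a : ℚ, s < a → (a : ℝ) ≤ t → (k s : ℝ → ℂ) t = 0 :=
      ae_all_iff.2 fun a => by
        by_cases ha : s < a
        · filter_upwards [h3 a ha] with t ht _ using ht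
        · exact Eventually.of_forall fun t h => absurd h ha
    filter_upwards [h8] with t ht hst
    obtain ⟨a, ha, hat⟩ := exists_rat_btwn hst
    exact ht a ha hat.le
  filter_upwards [coeFn_reflL s (k s),
    (Measure.measurePreserving_sub_left (volume : Measure ℝ) s).quasiMeasurePreserving.ae h7]
    with t ht ht' h0
  rw [ht]
  exact ht' (by linarith)

end Causality

section ApproxOne

/-- The bounded functions `x ↦ i (n + 1) / (x + i (n + 1))`, converging pointwise to `1`. -/
def approxOne (n : ℕ) : ℝ → ℂ :=
  fun x => (((n + 1 : ℝ) : ℂ) * I) * cauchyFun (((n + 1 : ℝ) : ℂ) * I) x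

theorem ofReal_succ_mul_I_im_pos (n : ℕ) : 0 < ((((n + 1 : ℝ) : ℂ)) * I).im := by
  rw [mul_I_im, ofReal_re]
  positivity

theorem norm_approxOne_le (n : ℕ) (x : ℝ) : ‖approxOne n x‖ ≤ 1 := by
  have hn : (0 : ℝ) < n + 1 := by positivity
  have h := norm_cauchyFun_le (ofReal_succ_mul_I_im_pos n) x
  rw [approxOne, norm_mul, norm_mul, norm_I, mul_one, Complex.norm_real, Real.norm_of_nonneg hn.le]
  rw [mul_I_im, ofReal_re] at h
  calc (n + 1 : ℝ) * _ ≤ (n + 1) * (n + 1 : ℝ)⁻¹ := by gcongr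
    _ = 1 := mul_inv_cancel₀ hn.ne'

theorem memLp_approxOne (n : ℕ) : MemLp (approxOne n) ∞ (volume : Measure ℝ) :=
  (memLp_top_cauchyFun (ofReal_succ_mul_I_im_pos n)).const_mul _

theorem tendsto_approxOne (x : ℝ) : Tendsto (fun n => approxOne n x) atTop (𝓝 1) := by
  have h1 : Tendsto (fun n : ℕ => ((n : ℂ) + 1)⁻¹) atTop (𝓝 0) := by
    simpa using tendsto_one_div_add_atTop_nhds_zero_nat (𝕜 := ℂ)
  have h2 : Tendsto (fun n : ℕ => (((n : ℂ) + 1)⁻¹ * (-I * x) + 1)⁻¹) atTop (𝓝 1) := by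
    simpa using ((h1.mul_const (-I * (x : ℂ))).add_const 1).inv₀ (by simp)
  refine h2.congr fun n => ?_
  have hn : ((n : ℂ) + 1) ≠ 0 := by exact_mod_cast n.succ_ne_zero
  have h3 := ofReal_add_ne_zero (ofReal_succ_mul_I_im_pos n) x
  have h4 : ((n : ℂ) + 1)⁻¹ * (-I * x) + 1 =
      ((x : ℂ) + ((n + 1 : ℝ) : ℂ) * I) * ((((n + 1 : ℝ) : ℂ)) * I)⁻¹ := by
    push_cast
    rw [mul_inv, Complex.inv_I]
    linear_combination (((n : ℂ) + 1) * ((n : ℂ) + 1)⁻¹) * Complex.I_mul_I -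
      mul_inv_cancel₀ hn
  rw [h4, mul_inv, inv_inv, approxOne, cauchyFun, mul_comm]

theorem mulOp_eq_self {p : ℝ≥0∞} [Fact (1 ≤ p)]
    (h : MemLp (fun _ => (1 : ℂ)) ∞ (volume : Measure ℝ)) (f : LpR p) : mulOp p h f = f := by
  apply Lp.ext
  filter_upwards [coeFn_mulOp h f] with x hx
  rw [hx, one_mul]

theorem tendsto_mulOp_approxOne {p : ℝ≥0∞} [Fact (1 ≤ p)] (hp : p ≠ ⊤) (f : LpR p) :
    Tendsto (fun n => mulOp p (memLp_approxOne n) f) atTop (𝓝 f) := by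
  have h := tendsto_mulOp hp memLp_approxOne (memLp_top_const (1 : ℂ)) 1
    (Eventually.of_forall norm_approxOne_le) (by simp) tendsto_approxOne f
  rwa [mulOp_eq_self] at h

theorem norm_mulOp_le {p : ℝ≥0∞} [Fact (1 ≤ p)] {φ : ℝ → ℂ}
    (hφ : MemLp φ ∞ (volume : Measure ℝ)) {C : ℝ} (hC : ∀ x, ‖φ x‖ ≤ C) (f : LpR p) :
    ‖mulOp p hφ f‖ ≤ C * ‖f‖ := by
  refine Lp.norm_le_mul_norm_of_ae_le_mul ?_
  filter_upwards [coeFn_mulOp hφ f] with x hx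
  rw [hx, norm_mul]
  gcongr
  exact hC x

end ApproxOne

section HardyInvariance

variable {p q : ℝ≥0∞} [Fact (1 ≤ p)] [Fact (1 ≤ q)] [ENNReal.HolderConjugate q p]

theorem continuous_mulOp_expi {p : ℝ≥0∞} [Fact (1 ≤ p)] (hp : p ≠ ⊤) (f : LpR p) :
    Continuous fun l => mulOp p (memLp_expi l) f :=
  continuous_iff_continuousAt.2 fun l =>
    tendsto_mulOp hp memLp_expi (memLp_expi l) 1
      (Eventually.of_forall fun m x => (norm_expi m x).le) (fun x => (norm_expi l x).le)
      (fun x => (continuous_expi.comp (Continuous.prodMk_left x)).tendsto l) f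

theorem cauchyLp_mem_hardy (h1 : 1 < p) (hp : p ≠ ⊤) {v : ℂ} (hv : 0 < v.im) :
    cauchyLp p h1 hp v hv ∈ hardy p := by
  intro u hu
  rw [← integral_cauchyFun_mul_cauchyFun hv hu]
  refine integral_congr_ae ?_
  filter_upwards [(memLp_cauchyFun h1 hp hv).coeFn_toLp] with x hx
  rw [cauchyLp, hx, div_eq_mul_inv, cauchyFun, cauchyFun]

theorem integrable_norm_mul_cauchyFun {p q : ℝ≥0∞} [Fact (1 ≤ q)] [ENNReal.HolderConjugate q p]
    (h1q : 1 < q) (hq : q ≠ ⊤) (k : LpLq p q) {u : ℂ}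
    (hu : 0 < u.im) : Integrable (fun x => ‖(k : ℝ → LpR q) x‖ * ‖cauchyFun u x‖) volume :=
  ((memLp_cauchyFun h1q hq hu).norm).integrable_mul (p := q) (q := p) (Lp.memLp k).norm |>.congr
    (Eventually.of_forall fun _ => mul_comm _ _)

theorem aestronglyMeasurable_pairL {α : Type*} [MeasurableSpace α] {μ : Measure α}
    {g : α → LpR q} {f : α → LpR p} (hg : AEStronglyMeasurable g μ)
    (hf : AEStronglyMeasurable f μ) :
    AEStronglyMeasurable (fun a => pairL q p (g a) (f a)) μ :=
  (pairL q p).aestronglyMeasurable_comp₂ hg hf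

theorem pairL_mulOp_reflL_eq_integral (h1 : 1 < p) (hp : p ≠ ⊤) (g : LpR q) {ψ : ℝ → ℂ}
    (hψ : Integrable ψ volume) {φ : LpR p}
    (hφ : (φ : ℝ → ℂ) =ᵐ[volume] fun t => ∫ ξ, ψ ξ * expi (2 * Real.pi * ξ) t) {v : ℂ}
    (hv : 0 < v.im) (x : ℝ) :
    pairL q p g (mulOp p (memLp_top_cauchyFun hv) (reflL p x φ)) =
      ∫ ξ, ψ ξ * expi (2 * Real.pi * ξ) x *
        pairL q p g (mulOp p (memLp_expi (-(2 * Real.pi * ξ))) (cauchyLp p h1 hp v hv)) := by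
  have hgv : Integrable (fun y => g y * cauchyFun v y) volume :=
    (Lp.memLp g).integrable_mul (memLp_cauchyFun h1 hp hv)
  have hinteg : Integrable (fun z : ℝ × ℝ => g z.1 * cauchyFun v z.1 *
      (ψ z.2 * expi (2 * Real.pi * z.2) (x - z.1))) (volume.prod volume) := by
    have hc : Continuous fun z : ℝ × ℝ => expi (2 * Real.pi * z.2) (x - z.1) :=
      continuous_expi.comp (f := fun z : ℝ × ℝ => (2 * Real.pi * z.2, x - z.1)) (by fun_prop)
    refine ((hgv.mul_prod hψ).bdd_mul hc.aestronglyMeasurable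
      (Eventually.of_forall fun z => (norm_expi _ _).le)).congr
      (Eventually.of_forall fun z => ?_)
    simp only
    ring
  calc pairL q p g (mulOp p (memLp_top_cauchyFun hv) (reflL p x φ))
      = ∫ y, ∫ ξ, g y * cauchyFun v y * (ψ ξ * expi (2 * Real.pi * ξ) (x - y)) := by
        rw [pairL_mulOp]
        refine integral_congr_ae ?_
        filter_upwards [coeFn_reflL x φ, (Measure.measurePreserving_sub_left
          (volume : Measure ℝ) x).quasiMeasurePreserving.ae hφ] with y h2 h3
        rw [h2, h3, integral_const_mul, mul_assoc]
    _ = ∫ ξ, ∫ y, g y * cauchyFun v y * (ψ ξ * expi (2 * Real.pi * ξ) (x - y)) :=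
        integral_integral_swap hinteg
    _ = _ := by
        refine integral_congr_ae (Eventually.of_forall fun ξ => ?_)
        simp only
        rw [pairL_mulOp, ← integral_const_mul]
        refine integral_congr_ae ?_
        filter_upwards [(memLp_cauchyFun h1 hp hv).coeFn_toLp] with y hy
        rw [cauchyLp, hy, expi_sub]
        ring

theorem integral_cauchyFun_mul_pairL_mulOp_eq_zero (h1 : 1 < p) (hp : p ≠ ⊤) (h1q : 1 < q)
    (hq : q ≠ ⊤) {T : LpR p →L[ℂ] LpR p} (k : LpLq p q)
    (hk : ∀ f : LpR p, (T f : ℝ → ℂ) =ᵐ[volume] fun x => pairL q p ((k : ℝ → LpR q) x) f)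
    (hT : ∀ l : ℝ, ∀ f ∈ mulHardy p (fun x => Complex.exp (Complex.I * l * x)),
      T f ∈ mulHardy p (fun x => Complex.exp (Complex.I * l * x)))
    {ψ : ℝ → ℂ} (hψ : Integrable ψ volume) {φ : LpR p}
    (hφ : (φ : ℝ → ℂ) =ᵐ[volume] fun t => ∫ ξ, ψ ξ * expi (2 * Real.pi * ξ) t) {u v : ℂ}
    (hu : 0 < u.im) (hv : 0 < v.im) :
    ∫ x, cauchyFun u x * pairL q p ((k : ℝ → LpR q) x)
      (mulOp p (memLp_top_cauchyFun hv) (reflL p x φ)) = 0 := by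
  set h := cauchyLp p h1 hp v hv with hh
  have hinteg : Integrable (fun z : ℝ × ℝ => cauchyFun u z.1 * (ψ z.2 *
      expi (2 * Real.pi * z.2) z.1 * pairL q p ((k : ℝ → LpR q) z.1)
        (mulOp p (memLp_expi (-(2 * Real.pi * z.2))) h))) (volume.prod volume) := by
    have hb := (integrable_norm_mul_cauchyFun h1q hq k hu).mul_prod (hψ.norm.mul_const ‖h‖)
    refine hb.mono' ?_ (Eventually.of_forall fun z => ?_)
    · refine ((continuous_cauchyFun hu).comp continuous_fst).aestronglyMeasurable.mul
        ((hψ.1.comp_snd.mul (continuous_expi.comp (f := fun z : ℝ × ℝ =>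
          (2 * Real.pi * z.2, z.1)) (by fun_prop)).aestronglyMeasurable).mul
          (aestronglyMeasurable_pairL (Lp.aestronglyMeasurable k).comp_fst ?_))
      exact ((continuous_mulOp_expi hp h).comp (by fun_prop)).aestronglyMeasurable
    · rw [norm_mul, norm_mul, norm_mul, norm_expi, mul_one]
      have h2 := norm_pairL_le ((k : ℝ → LpR q) z.1)
        (mulOp p (memLp_expi (-(2 * Real.pi * z.2))) h)
      have h3 := norm_mulOp_le (memLp_expi (-(2 * Real.pi * z.2)))
        (fun x => (norm_expi _ x).le) h
      rw [one_mul] at h3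
      calc _ ≤ ‖cauchyFun u z.1‖ * (‖ψ z.2‖ * (‖(k : ℝ → LpR q) z.1‖ * ‖h‖)) := by
            gcongr
            exact h2.trans (by gcongr)
        _ = _ := by ring
  simp_rw [pairL_mulOp_reflL_eq_integral h1 hp _ hψ hφ hv, ← integral_const_mul]
  rw [integral_integral_swap hinteg]
  refine integral_eq_zero_of_ae (Eventually.of_forall fun ξ => ?_)
  set l := -(2 * Real.pi * ξ) with hl
  have hmem : mulOp p (memLp_expi l) h ∈ mulHardy p (fun x => Complex.exp (Complex.I * l * x)) :=
    ⟨h, cauchyLp_mem_hardy h1 hp hv, coeFn_mulOp (memLp_expi l) h⟩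
  have h4 := (mem_mulHardy_iff l _).1 (hT l _ hmem) u hu
  simp only [Pi.zero_apply]
  have h5 : ∫ x, cauchyFun u x * (ψ ξ * expi (2 * Real.pi * ξ) x *
      pairL q p ((k : ℝ → LpR q) x) (mulOp p (memLp_expi l) h)) =
      ψ ξ * ∫ x : ℝ, (mulOp p (memLp_expi (-l)) (T (mulOp p (memLp_expi l) h)) : ℝ → ℂ) x /
        ((x : ℂ) + u) := by
    rw [← integral_const_mul]
    refine integral_congr_ae ?_
    filter_upwards [hk (mulOp p (memLp_expi l) h),
      coeFn_mulOp (memLp_expi (-l)) (T (mulOp p (memLp_expi l) h))] with x e1 e2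
    rw [e2, e1, hl, neg_neg, cauchyFun, div_eq_mul_inv]
    ring
  rw [h5, h4, mul_zero]

theorem integral_cauchyFun_mul_pairL_reflL_eq_zero (h1 : 1 < p) (hp : p ≠ ⊤) (h1q : 1 < q)
    (hq : q ≠ ⊤) {T : LpR p →L[ℂ] LpR p} (k : LpLq p q)
    (hk : ∀ f : LpR p, (T f : ℝ → ℂ) =ᵐ[volume] fun x => pairL q p ((k : ℝ → LpR q) x) f)
    (hT : ∀ l : ℝ, ∀ f ∈ mulHardy p (fun x => Complex.exp (Complex.I * l * x)),
      T f ∈ mulHardy p (fun x => Complex.exp (Complex.I * l * x)))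
    (φ : LpR p) {u : ℂ} (hu : 0 < u.im) :
    ∫ x, cauchyFun u x * pairL q p ((k : ℝ → LpR q) x) (reflL p x φ) = 0 := by
  have hm : ∀ φ : LpR p, AEStronglyMeasurable (fun x : ℝ => cauchyFun u x *
      pairL q p ((k : ℝ → LpR q) x) (reflL p x φ)) volume := fun φ =>
    (continuous_cauchyFun hu).aestronglyMeasurable.mul
      (aestronglyMeasurable_pairL (Lp.aestronglyMeasurable k)
        ((continuous_reflL hp).comp (Continuous.prodMk_left φ)).aestronglyMeasurable)
  have hle : ∀ (φ : LpR p) (x : ℝ), ‖cauchyFun u x * pairL q p ((k : ℝ → LpR q) x)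
      (reflL p x φ)‖ ≤ (‖(k : ℝ → LpR q) x‖ * ‖cauchyFun u x‖) * ‖φ‖ := by
    intro φ x
    rw [norm_mul]
    have := norm_pairL_le ((k : ℝ → LpR q) x) (reflL p x φ)
    rw [norm_reflL] at this
    calc _ ≤ ‖cauchyFun u x‖ * (‖(k : ℝ → LpR q) x‖ * ‖φ‖) := by gcongr
      _ = _ := by ring
  have hb := integrable_norm_mul_cauchyFun h1q hq k hu
  have hi : ∀ φ : LpR p, Integrable (fun x : ℝ => cauchyFun u x *
      pairL q p ((k : ℝ → LpR q) x) (reflL p x φ)) volume := fun φ =>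
    (hb.mul_const ‖φ‖).mono' (hm φ) (Eventually.of_forall (hle φ))
  let J : LpR p →L[ℂ] ℂ := LinearMap.mkContinuous
    { toFun := fun φ => ∫ x, cauchyFun u x * pairL q p ((k : ℝ → LpR q) x) (reflL p x φ)
      map_add' := fun φ₁ φ₂ => by
        simp_rw [map_add, mul_add]
        exact integral_add (hi φ₁) (hi φ₂)
      map_smul' := fun c φ => by
        simp_rw [map_smul, smul_eq_mul, mul_left_comm _ c]
        exact integral_const_mul c _ }
    (∫ x, ‖(k : ℝ → LpR q) x‖ * ‖cauchyFun u x‖) fun φ => by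
      refine (norm_integral_le_of_norm_le (hb.mul_const ‖φ‖)
        (Eventually.of_forall (hle φ))).trans_eq ?_
      exact integral_mul_const _ _
  have hJ : ∀ f : SchwartzMap ℝ ℂ, J (SchwartzMap.toLpCLM ℂ ℂ p volume f) = 0 := by
    intro f
    set φ := SchwartzMap.toLpCLM ℂ ℂ p volume f with hφ'
    have hφ : (φ : ℝ → ℂ) =ᵐ[volume]
        fun t => ∫ ξ, (FourierTransform.fourier f) ξ * expi (2 * Real.pi * ξ) t := by
      filter_upwards [f.coeFn_toLp p volume] with t ht
      change (f.toLp p volume : ℝ → ℂ) t = _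
      rw [ht]
      have hinv : FourierTransformInv.fourierInv (FourierTransform.fourier f : SchwartzMap ℝ ℂ) = f :=
        FourierTransform.fourierInv_fourier_eq f
      conv_lhs => rw [← hinv]
      rw [SchwartzMap.fourierInv_coe, Real.fourierInv_eq']
      refine integral_congr_ae (Eventually.of_forall fun ξ => ?_)
      simp only [smul_eq_mul, expi]
      rw [mul_comm]
      congr 2
      simp
      ring
    have hlim : Tendsto (fun n : ℕ => ∫ x, cauchyFun u x * pairL q p ((k : ℝ → LpR q) x)
        (mulOp p (memLp_approxOne n) (reflL p x φ))) atTop (𝓝 (J φ)) := by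
      refine tendsto_integral_of_dominated_convergence
        (fun x => (‖(k : ℝ → LpR q) x‖ * ‖cauchyFun u x‖) * ‖φ‖) (fun n => ?_)
        (hb.mul_const _) (fun n => Eventually.of_forall fun x => ?_)
        (Eventually.of_forall fun x => ?_)
      · exact (continuous_cauchyFun hu).aestronglyMeasurable.mul
          (aestronglyMeasurable_pairL (Lp.aestronglyMeasurable k)
            ((mulOp p (memLp_approxOne n)).continuous.comp ((continuous_reflL hp).comp
              (Continuous.prodMk_left φ))).aestronglyMeasurable)
      · rw [norm_mul]
        have h2 := norm_pairL_le ((k : ℝ → LpR q) x) (mulOp p (memLp_approxOne n) (reflL p x φ))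
        have h3 := norm_mulOp_le (memLp_approxOne n) (norm_approxOne_le n) (reflL p x φ)
        rw [one_mul, norm_reflL] at h3
        calc _ ≤ ‖cauchyFun u x‖ * (‖(k : ℝ → LpR q) x‖ * ‖φ‖) := by
              gcongr
              exact h2.trans (by gcongr)
          _ = _ := by ring
      · exact (((pairL q p ((k : ℝ → LpR q) x)).continuous.tendsto _).comp
          (tendsto_mulOp_approxOne hp _)).const_mul _
    refine tendsto_nhds_unique hlim (tendsto_const_nhds.congr fun n => ?_)
    have h6 := integral_cauchyFun_mul_pairL_mulOp_eq_zero h1 hp h1q hq k hk hT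
      (FourierTransform.fourier f).integrable hφ hu (ofReal_succ_mul_I_im_pos n)
    symm
    calc _ = ∫ x, (((n + 1 : ℝ) : ℂ) * I) * (cauchyFun u x * pairL q p ((k : ℝ → LpR q) x)
          (mulOp p (memLp_top_cauchyFun (ofReal_succ_mul_I_im_pos n)) (reflL p x φ))) := by
          refine integral_congr_ae (Eventually.of_forall fun x => ?_)
          simp only
          rw [pairL_mulOp, pairL_mulOp, mul_left_comm, ← integral_const_mul (_ * I)]
          congr 1
          refine integral_congr_ae (Eventually.of_forall fun y => ?_)
          simp only [approxOne]
          ring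
      _ = 0 := by rw [integral_const_mul, h6, mul_zero]
  have hJ0 : ⇑J = fun _ => 0 :=
    Continuous.ext_on (SchwartzMap.denseRange_toLpCLM hp) J.continuous continuous_const
      (by rintro _ ⟨f, rfl⟩; exact hJ f)
  exact congrFun hJ0 φ

end HardyInvariance

section BochnerPointwise

variable {p q : ℝ≥0∞} [Fact (1 ≤ p)] [Fact (1 ≤ q)] [ENNReal.HolderConjugate q p]

theorem integral_norm_mul_le (g : LpR q) (f : LpR p) : ∫ x, ‖g x * f x‖ ≤ ‖g‖ * ‖f‖ := by
  have h := (ContinuousLinearMap.mul ℂ ℂ).norm_holder_apply_apply_le (r := 1) g f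
  have h2 : ∫ x, ‖g x * f x‖ = ‖(ContinuousLinearMap.mul ℂ ℂ).holder 1 g f‖ := by
    rw [L1.norm_eq_integral_norm]
    refine integral_congr_ae ?_
    filter_upwards [(ContinuousLinearMap.mul ℂ ℂ).coeFn_holder (r := 1) g f] with x hx
    rw [hx, ContinuousLinearMap.mul_apply']
  rw [h2]
  have : ‖ContinuousLinearMap.mul ℂ ℂ‖ ≤ 1 := ContinuousLinearMap.opNorm_mul_le ℂ ℂ
  calc _ ≤ 1 * ‖g‖ * ‖f‖ := h.trans (by gcongr)
    _ = _ := by ring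

theorem setIntegral_norm_le {A : Set ℝ} (hA : MeasurableSet A) (hA' : volume A ≠ ∞) (f : LpR p) :
    ∫ x in A, ‖f x‖ ≤ ‖indicatorConstLp q hA hA' (1 : ℂ)‖ * ‖f‖ := by
  refine le_trans (le_of_eq ?_) (integral_norm_mul_le _ f)
  rw [← integral_indicator hA]
  refine integral_congr_ae ?_
  filter_upwards [indicatorConstLp_coeFn (p := q) (hs := hA) (hμs := hA') (c := (1 : ℂ))]
    with x hx
  rw [hx]
  by_cases hxs : x ∈ A <;> simp [hxs]

theorem pairL_indicatorConstLp {A : Set ℝ} (hA : MeasurableSet A) (hA' : volume A ≠ ∞)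
    (f : LpR p) : pairL q p (indicatorConstLp q hA hA' 1) f = ∫ x in A, f x := by
  rw [pairL_apply, ← integral_indicator hA]
  refine integral_congr_ae ?_
  filter_upwards [indicatorConstLp_coeFn (p := q) (hs := hA) (hμs := hA') (c := (1 : ℂ))]
    with x hx
  rw [hx]
  by_cases hxs : x ∈ A <;> simp [hxs]

variable {α : Type*} [MeasurableSpace α] {μ : Measure α} {V : α → LpR p}
  {w : α → ℝ → ℂ}

theorem integrable_prod_restrict_of_ae_eq (q : ℝ≥0∞) [Fact (1 ≤ q)] [ENNReal.HolderConjugate q p]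
    (hV : Integrable V μ)
    (hw : AEStronglyMeasurable (fun z : α × ℝ => w z.1 z.2) (μ.prod volume))
    (hVw : ∀ᵐ a ∂μ, (V a : ℝ → ℂ) =ᵐ[volume] w a) {A : Set ℝ} (hA : MeasurableSet A)
    (hA' : volume A ≠ ∞) :
    Integrable (fun z : α × ℝ => w z.1 z.2) (μ.prod (volume.restrict A)) := by
  have hw' : AEStronglyMeasurable (fun z : α × ℝ => w z.1 z.2) (μ.prod (volume.restrict A)) :=
    hw.mono_ac (Measure.AbsolutelyContinuous.rfl.prod Measure.absolutelyContinuous_restrict)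
  rw [integrable_prod_iff hw']
  constructor
  · filter_upwards [hVw] with a ha
    exact (integrableOn_Lp_of_measure_ne_top (V a) Fact.out hA').congr (ae_restrict_of_ae ha)
  · refine (hV.norm.const_mul ‖indicatorConstLp q hA hA' (1 : ℂ)‖).mono'
      hw'.norm.integral_prod_right' ?_
    filter_upwards [hVw] with a ha
    rw [Real.norm_of_nonneg (integral_nonneg fun x => norm_nonneg _)]
    refine le_trans (le_of_eq ?_) (setIntegral_norm_le hA hA' (V a))
    refine integral_congr_ae (ae_restrict_of_ae ?_)
    filter_upwards [ha] with x hx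
    rw [hx]

theorem coeFn_integral_ae_eq [SFinite μ] (q : ℝ≥0∞) [Fact (1 ≤ q)] [ENNReal.HolderConjugate q p]
    (hV : Integrable V μ)
    (hw : AEStronglyMeasurable (fun z : α × ℝ => w z.1 z.2) (μ.prod volume))
    (hVw : ∀ᵐ a ∂μ, (V a : ℝ → ℂ) =ᵐ[volume] w a) :
    ((∫ a, V a ∂μ : LpR p) : ℝ → ℂ) =ᵐ[volume] fun x => ∫ a, w a x ∂μ := by
  refine ae_eq_of_forall_setIntegral_eq_of_sigmaFinite
    (fun A _ hA' => integrableOn_Lp_of_measure_ne_top _ Fact.out hA'.ne)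
    (fun A hA hA' => (integrable_prod_restrict_of_ae_eq q hV hw hVw hA hA'.ne).integral_prod_right)
    fun A hA hA' => ?_
  rw [← pairL_indicatorConstLp (q := q) hA hA'.ne, ← ContinuousLinearMap.integral_comp_comm _ hV,
    ← integral_integral_swap (integrable_prod_restrict_of_ae_eq q hV hw hVw hA hA'.ne)]
  refine integral_congr_ae ?_
  filter_upwards [hVw] with a ha
  rw [pairL_indicatorConstLp]
  exact integral_congr_ae (ae_restrict_of_ae ha)

end BochnerPointwise

section ConvolutionMultipliers

variable {p q : ℝ≥0∞} [Fact (1 ≤ p)] [Fact (1 ≤ q)] [ENNReal.HolderConjugate q p]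

theorem continuous_pairL_reflL (hp : p ≠ ⊤) (f : LpR p) (φ : LpR q) :
    Continuous fun x => pairL q p φ (reflL p x f) :=
  (pairL q p φ).continuous.comp ((continuous_reflL hp).comp (Continuous.prodMk_left f))

theorem norm_pairL_reflL_le (f : LpR p) (φ : LpR q) (x : ℝ) :
    ‖pairL q p φ (reflL p x f)‖ ≤ ‖φ‖ * ‖f‖ := by
  simpa only [norm_reflL] using norm_pairL_le φ (reflL p x f)

theorem memLp_top_pairL_reflL (hp : p ≠ ⊤) (f : LpR p) (φ : LpR q) :
    MemLp (fun x => pairL q p φ (reflL p x f)) ∞ (volume : Measure ℝ) :=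
  memLp_top_of_bound (continuous_pairL_reflL hp f φ).aestronglyMeasurable _
    (Eventually.of_forall (norm_pairL_reflL_le f φ))

/-- The bilinear map sending `φ` and `r` to the product of `r` with the convolution `φ * f`. -/
def convMulL (q : ℝ≥0∞) [Fact (1 ≤ q)] [ENNReal.HolderConjugate q p] (hp : p ≠ ⊤) (f : LpR p) :
    LpR q →L[ℂ] LpR p →L[ℂ] LpR p :=
  LinearMap.mkContinuous₂
    (LinearMap.mk₂ ℂ (fun φ r => mulOp p (memLp_top_pairL_reflL (q := q) hp f φ) r)
      (fun φ₁ φ₂ r => by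
        apply Lp.ext
        filter_upwards [coeFn_mulOp (memLp_top_pairL_reflL hp f (φ₁ + φ₂)) r,
          coeFn_mulOp (memLp_top_pairL_reflL hp f φ₁) r,
          coeFn_mulOp (memLp_top_pairL_reflL hp f φ₂) r,
          Lp.coeFn_add (mulOp p (memLp_top_pairL_reflL hp f φ₁) r)
            (mulOp p (memLp_top_pairL_reflL hp f φ₂) r)] with x e1 e2 e3 e4
        rw [e1, e4, Pi.add_apply, e2, e3, map_add, add_apply, add_mul])
      (fun c φ r => by
        apply Lp.ext
        filter_upwards [coeFn_mulOp (memLp_top_pairL_reflL hp f (c • φ)) r,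
          coeFn_mulOp (memLp_top_pairL_reflL hp f φ) r,
          Lp.coeFn_smul c (mulOp p (memLp_top_pairL_reflL hp f φ) r)] with x e1 e2 e3
        rw [e1, e3, Pi.smul_apply, e2, map_smul, smul_apply, smul_eq_mul, smul_eq_mul, mul_assoc])
      (fun φ r₁ r₂ => map_add _ r₁ r₂) (fun c φ r => map_smul _ c r)) ‖f‖ fun φ r => by
    refine (norm_mulOp_le _ (norm_pairL_reflL_le f φ) r).trans_eq ?_
    ring

theorem coeFn_convMulL (hp : p ≠ ⊤) (f : LpR p) (φ : LpR q) (r : LpR p) :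
    (convMulL q hp f φ r : ℝ → ℂ) =ᵐ[volume] fun x => pairL q p φ (reflL p x f) * r x :=
  coeFn_mulOp (memLp_top_pairL_reflL hp f φ) r

theorem norm_convMulL_le (hp : p ≠ ⊤) (f : LpR p) (φ : LpR q) (r : LpR p) :
    ‖convMulL q hp f φ r‖ ≤ ‖φ‖ * ‖f‖ * ‖r‖ :=
  norm_mulOp_le _ (norm_pairL_reflL_le f φ) r

variable {S : Subalgebra ℂ (LpR p →L[ℂ] LpR p)} {ι : Type*} [Fintype ι]

theorem integrableOn_transL (hp : p ≠ ⊤) {A : Set ℝ} (hA' : volume A ≠ ∞) (f : LpR p) :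
    IntegrableOn (fun t => transL p t f) A volume := by
  have : IsFiniteMeasure ((volume : Measure ℝ).restrict A) := ⟨by simpa using hA'.lt_top⟩
  refine Integrable.of_bound
    ((continuous_transL hp).comp (Continuous.prodMk_left f)).aestronglyMeasurable ‖f‖
    (Eventually.of_forall fun t => (norm_transL t f).le)

theorem setIntegral_transL_mem (hp : p ≠ ⊤) (hgens : parabolicGens p ⊆ S) {A : Set ℝ}
    (hA : MeasurableSet A) (hA' : volume A ≠ ∞) (hA0 : A ⊆ Set.Ici 0) (F : ι → LpR p) :
    (fun i => ∫ t in A, transL p t (F i)) ∈ orbitClosure S F := by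
  have hinteg : IntegrableOn (fun t i => transL p t (F i)) A volume :=
    Integrable.of_eval fun i => integrableOn_transL hp hA' (F i)
  have h := Submodule.integral_mem_of_isClosed (isClosed_orbitClosure S F) hinteg
    ((ae_restrict_iff' hA).2 (Eventually.of_forall fun t ht =>
      apply_mem_orbitClosure (transL_mem hgens (hA0 ht)) F))
  convert h using 1
  ext1 i
  exact (eval_integral (fun i => integrableOn_transL hp hA' (F i)) i).symm

theorem coeFn_setIntegral_transL (q : ℝ≥0∞) [Fact (1 ≤ q)] [ENNReal.HolderConjugate q p]
    (hp : p ≠ ⊤) {A : Set ℝ} (hA' : volume A ≠ ∞) (f : LpR p) :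
    ((∫ t in A, transL p t f : LpR p) : ℝ → ℂ) =ᵐ[volume] fun x => ∫ t in A, f (x - t) :=
  coeFn_integral_ae_eq q (integrableOn_transL hp hA' f)
    ((Lp.stronglyMeasurable f).comp_measurable
      (measurable_snd.sub measurable_fst)).aestronglyMeasurable
    (Eventually.of_forall fun t => coeFn_transL t f)

theorem convMulL_indicator_mem (hp : p ≠ ⊤) (hq : q ≠ ⊤) (hgens : parabolicGens p ⊆ S)
    {ρ : ℝ → ℂ} (hρ : IsMultiplier S ρ) {r : LpR p} (hr : (r : ℝ → ℂ) =ᵐ[volume] ρ)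
    (F : ι → LpR p) (φ : LpR q) :
    (fun i => convMulL q hp (F i) (mulOp q (memLp_indicator_Ici 0) φ) r) ∈ orbitClosure S F := by
  obtain ⟨hρ', hρS⟩ := hρ
  refine Lp.induction hq (fun φ : LpR q => (fun i => convMulL q hp (F i)
    (mulOp q (memLp_indicator_Ici 0) φ) r) ∈ orbitClosure S F) ?_ ?_ ?_ φ
  · intro c s hs hμs
    have hA : MeasurableSet (s ∩ Set.Ici 0) := hs.inter measurableSet_Ici
    have hA' : volume (s ∩ Set.Ici (0 : ℝ)) ≠ ∞ :=
      ((measure_mono Set.inter_subset_left).trans_lt hμs).ne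
    have hmem := (orbitClosure S F).smul_mem c (comp_mem_orbitClosure hρS
      (setIntegral_transL_mem hp hgens hA hA' Set.inter_subset_right F))
    convert hmem using 1
    ext1 i
    rw [Pi.smul_apply, Lp.simpleFunc.coe_indicatorConst]
    apply Lp.ext
    filter_upwards [coeFn_convMulL hp (F i) (mulOp q (memLp_indicator_Ici 0)
        (indicatorConstLp q hs hμs.ne c)) r, hr,
      Lp.coeFn_smul c (mulOp p hρ' (∫ t in s ∩ Set.Ici 0, transL p t (F i))),
      coeFn_mulOp hρ' (∫ t in s ∩ Set.Ici 0, transL p t (F i)),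
      coeFn_setIntegral_transL q hp hA' (F i)] with x e1 e2 e3 e4 e5
    rw [e1, e2, e3, Pi.smul_apply, e4, e5, smul_eq_mul, pairL_apply]
    have h6 : ∫ t, mulOp q (memLp_indicator_Ici 0) (indicatorConstLp q hs hμs.ne c) t *
        reflL p x (F i) t = c * ∫ t in s ∩ Set.Ici 0, F i (x - t) := by
      rw [← integral_indicator hA, ← integral_const_mul]
      refine integral_congr_ae ?_
      filter_upwards [coeFn_mulOp (memLp_indicator_Ici 0) (indicatorConstLp q hs hμs.ne c),
        coeFn_reflL x (F i),
        indicatorConstLp_coeFn (p := q) (hs := hs) (hμs := hμs.ne) (c := c)] with t d1 d2 d3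
      rw [d1, d2, d3]
      by_cases h1 : t ∈ s <;> by_cases h2 : 0 ≤ t <;> simp [h1, h2]
    rw [h6]
    ring
  · intro f g hf hg _ h1 h2
    simp only [map_add, add_apply]
    exact (orbitClosure S F).add_mem h1 h2
  · exact (isClosed_orbitClosure S F).preimage (by fun_prop)

theorem convMulL_mem (hp : p ≠ ⊤) (hq : q ≠ ⊤) (hgens : parabolicGens p ⊆ S)
    {ρ : ℝ → ℂ} (hρ : IsMultiplier S ρ) {r : LpR p} (hr : (r : ℝ → ℂ) =ᵐ[volume] ρ)
    (F : ι → LpR p) {φ : LpR q} (hφ : ∀ᵐ t : ℝ, t < 0 → (φ : ℝ → ℂ) t = 0) :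
    (fun i => convMulL q hp (F i) φ r) ∈ orbitClosure S F := by
  have h : mulOp q (memLp_indicator_Ici 0) φ = φ := by
    apply Lp.ext
    filter_upwards [coeFn_mulOp (memLp_indicator_Ici 0) φ, hφ] with t h1 h2
    rw [h1]
    by_cases ht : 0 ≤ t
    · simp [ht]
    · simp [ht, h2 (not_le.1 ht)]
  have h2 := convMulL_indicator_mem hp hq hgens hρ hr F φ
  rwa [h] at h2

end ConvolutionMultipliers

section Approximation

theorem aestronglyMeasurable_reflL {p q : ℝ≥0∞} [Fact (1 ≤ q)] (hq : q ≠ ⊤) (k : LpLq p q) :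
    AEStronglyMeasurable (fun s => reflL q s ((k : ℝ → LpR q) s)) (volume : Measure ℝ) :=
  Continuous.comp_aestronglyMeasurable (g := fun z : ℝ × LpR q => reflL q z.1 z.2)
    (f := fun s => (s, (k : ℝ → LpR q) s)) (continuous_reflL hq)
    (aestronglyMeasurable_id.prodMk (Lp.aestronglyMeasurable k))

variable {p q : ℝ≥0∞} [Fact (1 ≤ p)] [Fact (1 ≤ q)] [ENNReal.HolderConjugate q p]

/-- The function `x ↦ (x + v)⁻¹ (x - s + w)⁻¹` as an element of `L^p`, in partial fractions. -/
def cauchyProdLp (p : ℝ≥0∞) [Fact (1 ≤ p)] (h1 : 1 < p) (hp : p ≠ ⊤) {v w : ℂ} (hv : 0 < v.im)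
    (hw : 0 < w.im) (s : ℝ) : LpR p :=
  -cauchyFun (v - w) s • (cauchyLp p h1 hp v hv - transL p s (cauchyLp p h1 hp w hw))

theorem coeFn_cauchyProdLp (h1 : 1 < p) (hp : p ≠ ⊤) {v w : ℂ} (hv : 0 < v.im) (hw : 0 < w.im)
    (hvw : w.im < v.im) (s : ℝ) : (cauchyProdLp p h1 hp hv hw s : ℝ → ℂ) =ᵐ[volume]
      fun x => cauchyFun v x * cauchyFun (w - s) x := by
  have hws : 0 < (w - s).im := by simpa using hw
  have hne : w - s ≠ v := fun h => by
    have := congrArg Complex.im h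
    simp only [sub_im, ofReal_im, sub_zero] at this
    exact hvw.ne this
  filter_upwards [Lp.coeFn_smul (-cauchyFun (v - w) s)
      (cauchyLp p h1 hp v hv - transL p s (cauchyLp p h1 hp w hw)),
    Lp.coeFn_sub (cauchyLp p h1 hp v hv) (transL p s (cauchyLp p h1 hp w hw)),
    coeFn_transL s (cauchyLp p h1 hp w hw), (memLp_cauchyFun h1 hp hv).coeFn_toLp,
    (measurePreserving_sub_right volume s).quasiMeasurePreserving.ae
      (memLp_cauchyFun h1 hp hw).coeFn_toLp] with x e1 e2 e3 e4 e5
  rw [cauchyProdLp, e1, Pi.smul_apply, e2, Pi.sub_apply, e3, cauchyLp, cauchyLp, e4, e5,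
    cauchyFun_mul_cauchyFun hv hws hne, smul_eq_mul]
  congr 1
  · rw [cauchyFun, ← inv_neg]
    congr 1
    ring
  · congr 1
    simp only [cauchyFun]
    congr 1
    push_cast
    ring

theorem continuous_cauchyProdLp (h1 : 1 < p) (hp : p ≠ ⊤) {v w : ℂ} (hv : 0 < v.im)
    (hw : 0 < w.im) (hvw : w.im < v.im) : Continuous (cauchyProdLp p h1 hp hv hw) := by
  have h2 : 0 < (v - w).im := by simpa using hvw
  exact (continuous_cauchyFun h2).neg.smul (continuous_const.sub
    ((continuous_transL hp).comp (Continuous.prodMk_left _)))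

theorem norm_cauchyProdLp_le (h1 : 1 < p) (hp : p ≠ ⊤) {v w : ℂ} (hv : 0 < v.im)
    (hw : 0 < w.im) (s : ℝ) : ‖cauchyProdLp p h1 hp hv hw s‖ ≤
      ‖cauchyFun (v - w) s‖ * (‖cauchyLp p h1 hp v hv‖ + ‖cauchyLp p h1 hp w hw‖) := by
  rw [cauchyProdLp, norm_smul, norm_neg]
  gcongr
  refine (norm_sub_le _ _).trans_eq ?_
  rw [norm_transL]

theorem integrable_convMulL (h1 : 1 < p) (hp : p ≠ ⊤) (h1q : 1 < q) (hq : q ≠ ⊤) (k : LpLq p q)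
    (f : LpR p) {v w : ℂ} (hv : 0 < v.im) (hw : 0 < w.im) (hvw : w.im < v.im) :
    Integrable (fun s => convMulL q hp f (reflL q s ((k : ℝ → LpR q) s))
      (cauchyProdLp p h1 hp hv hw s)) volume := by
  have h2 : 0 < (v - w).im := by simpa using hvw
  refine ((integrable_norm_mul_cauchyFun h1q hq k h2).mul_const
    (‖f‖ * (‖cauchyLp p h1 hp v hv‖ + ‖cauchyLp p h1 hp w hw‖))).mono'
    ((convMulL q hp f).aestronglyMeasurable_comp₂ (aestronglyMeasurable_reflL hq k)
      (continuous_cauchyProdLp h1 hp hv hw hvw).aestronglyMeasurable)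
    (Eventually.of_forall fun s => ?_)
  refine (norm_convMulL_le hp f _ _).trans ?_
  rw [norm_reflL]
  calc _ ≤ ‖(k : ℝ → LpR q) s‖ * ‖f‖ * (‖cauchyFun (v - w) s‖ *
        (‖cauchyLp p h1 hp v hv‖ + ‖cauchyLp p h1 hp w hw‖)) := by
        gcongr
        exact norm_cauchyProdLp_le h1 hp hv hw s
    _ = _ := by ring

theorem pairL_reflL_reflL (g : LpR q) (f : LpR p) (s x : ℝ) :
    pairL q p (reflL q s g) (reflL p x f) = pairL q p g (transL p (s - x) f) := by
  rw [pairL_apply, pairL_apply, ← integral_sub_left_eq_self _ volume s]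
  refine integral_congr_ae ?_
  filter_upwards [(Measure.measurePreserving_sub_left volume s).quasiMeasurePreserving.ae
      (coeFn_reflL s g), (Measure.measurePreserving_sub_left volume s).quasiMeasurePreserving.ae
      (coeFn_reflL x f), coeFn_transL (s - x) f] with t h1 h2 h3
  rw [h1, h2, h3]
  congr 2 <;> ring

theorem pairL_reflL_reflL_eq (g : LpR q) (f : LpR p) (s x : ℝ) :
    pairL q p (reflL q s g) (reflL p x f) = pairL q p g (reflL p s (reflL p x f)) := by
  rw [pairL_apply, pairL_apply, ← integral_sub_left_eq_self _ volume s]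
  refine integral_congr_ae ?_
  filter_upwards [(Measure.measurePreserving_sub_left volume s).quasiMeasurePreserving.ae
      (coeFn_reflL s g), coeFn_reflL s (reflL p x f)] with t h1 h3
  rw [h1, h3]
  congr 2
  ring

/-- The Poisson average, at scale `ε`, of the conjugates of `T` by translations. -/
def poissonAverage (T : LpR p →L[ℂ] LpR p) (ε : ℝ) (f : LpR p) : LpR p :=
  ∫ σ : ℝ, (((1 + σ ^ 2)⁻¹ : ℝ) : ℂ) • transL p (ε * σ) (T (transL p (-(ε * σ)) f))

theorem continuous_transL_conj (hp : p ≠ ⊤) (T : LpR p →L[ℂ] LpR p) (f : LpR p) :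
    Continuous fun τ => transL p τ (T (transL p (-τ) f)) :=
  (continuous_transL hp).comp (continuous_id.prodMk (T.continuous.comp
    ((continuous_transL hp).comp (continuous_neg.prodMk continuous_const))))

theorem norm_transL_conj_le (T : LpR p →L[ℂ] LpR p) (f : LpR p) (σ τ : ℝ) :
    ‖(((1 + σ ^ 2)⁻¹ : ℝ) : ℂ) • transL p τ (T (transL p (-τ) f))‖ ≤
      (1 + σ ^ 2)⁻¹ * (‖T‖ * ‖f‖) := by
  rw [norm_smul, Complex.norm_real, Real.norm_of_nonneg (by positivity), norm_transL]
  gcongr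
  simpa only [norm_transL] using T.le_opNorm (transL p (-τ) f)

theorem aestronglyMeasurable_transL_conj (hp : p ≠ ⊤) (T : LpR p →L[ℂ] LpR p) (ε : ℝ)
    (f : LpR p) : AEStronglyMeasurable (fun σ : ℝ => (((1 + σ ^ 2)⁻¹ : ℝ) : ℂ) •
      transL p (ε * σ) (T (transL p (-(ε * σ)) f))) volume := by
  have h : Continuous fun σ : ℝ => (1 + σ ^ 2)⁻¹ :=
    Continuous.inv₀ (by fun_prop) fun σ => by positivity
  exact ((continuous_ofReal.comp h).smul ((continuous_transL_conj hp T f).comp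
    (continuous_const_mul ε))).aestronglyMeasurable

theorem integrable_transL_conj (hp : p ≠ ⊤) (T : LpR p →L[ℂ] LpR p) (ε : ℝ) (f : LpR p) :
    Integrable (fun σ : ℝ => (((1 + σ ^ 2)⁻¹ : ℝ) : ℂ) •
      transL p (ε * σ) (T (transL p (-(ε * σ)) f))) volume :=
  (integrable_inv_one_add_sq.mul_const (‖T‖ * ‖f‖)).mono'
    (aestronglyMeasurable_transL_conj hp T ε f)
    (Eventually.of_forall fun σ => norm_transL_conj_le T f σ (ε * σ))

theorem tendsto_poissonAverage (hp : p ≠ ⊤) (T : LpR p →L[ℂ] LpR p) (f : LpR p) :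
    Tendsto (fun ε => poissonAverage T ε f) (𝓝[>] 0) (𝓝 ((Real.pi : ℂ) • T f)) := by
  have hlim : ∫ σ : ℝ, (((1 + σ ^ 2)⁻¹ : ℝ) : ℂ) • T f = (Real.pi : ℂ) • T f := by
    rw [integral_smul_const, integral_complex_ofReal, integral_univ_inv_one_add_sq]
  rw [← hlim]
  refine tendsto_integral_filter_of_dominated_convergence
    (fun σ => (1 + σ ^ 2)⁻¹ * (‖T‖ * ‖f‖))
    (Eventually.of_forall fun ε => aestronglyMeasurable_transL_conj hp T ε f)
    (Eventually.of_forall fun ε => Eventually.of_forall fun σ =>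
      norm_transL_conj_le T f σ (ε * σ))
    (integrable_inv_one_add_sq.mul_const _) (Eventually.of_forall fun σ => ?_)
  have h0 : ∀ g : LpR p, transL p 0 g = g := fun g => by
    apply Lp.ext
    filter_upwards [coeFn_transL 0 g] with x hx
    rw [hx, sub_zero]
  have h := ((continuous_transL_conj hp T f).comp (continuous_mul_const σ)).tendsto 0
  simp only [Function.comp_apply, zero_mul, neg_zero, h0] at h
  exact (h.mono_left nhdsWithin_le_nhds).const_smul _

theorem coeFn_poissonAverage (hp : p ≠ ⊤) {T : LpR p →L[ℂ] LpR p} (k : LpLq p q)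
    (hk : ∀ f : LpR p, (T f : ℝ → ℂ) =ᵐ[volume] fun x => pairL q p ((k : ℝ → LpR q) x) f)
    (ε : ℝ) (f : LpR p) : (poissonAverage T ε f : ℝ → ℂ) =ᵐ[volume] fun x =>
      ∫ σ : ℝ, (((1 + σ ^ 2)⁻¹ : ℝ) : ℂ) *
        pairL q p ((k : ℝ → LpR q) (x - ε * σ)) (transL p (-(ε * σ)) f) := by
  refine coeFn_integral_ae_eq q (integrable_transL_conj hp T ε f) ?_
    (Eventually.of_forall fun σ => ?_)
  · refine AEStronglyMeasurable.mul ?_ (aestronglyMeasurable_pairL ?_ ?_)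
    · exact Measurable.aestronglyMeasurable (by fun_prop)
    · exact ((Lp.stronglyMeasurable k).comp_measurable (by fun_prop)).aestronglyMeasurable
    · exact ((continuous_transL hp).comp
        (Continuous.prodMk (by fun_prop) continuous_const)).aestronglyMeasurable
  · filter_upwards [Lp.coeFn_smul (((1 + σ ^ 2)⁻¹ : ℝ) : ℂ)
        (transL p (ε * σ) (T (transL p (-(ε * σ)) f))),
      coeFn_transL (ε * σ) (T (transL p (-(ε * σ)) f)),
      (measurePreserving_sub_right volume (ε * σ)).quasiMeasurePreserving.ae
        (hk (transL p (-(ε * σ)) f))] with x h1 h2 h3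
    rw [h1, Pi.smul_apply, h2, h3, smul_eq_mul]

end Approximation

section PoissonIdentity

theorem poisson_eq_cauchyFun_add {ε : ℝ} (hε : 0 < ε) (x s : ℝ) :
    cauchyFun (ε * I - s) x + cauchyFun (-x + ε * I) s =
      -2 * I * ((ε * ((x - s) ^ 2 + ε ^ 2)⁻¹ : ℝ) : ℂ) := by
  have h1 : (x : ℂ) + (ε * I - s) ≠ 0 := fun h => by
    have := congrArg Complex.im h
    simp at this
    exact hε.ne' this
  have h2 : (s : ℂ) + (-x + ε * I) ≠ 0 := fun h => by
    have := congrArg Complex.im h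
    simp at this
    exact hε.ne' this
  have h3 : ((x : ℂ) - s) ^ 2 + ε ^ 2 ≠ 0 := by
    have : (x - s) ^ 2 + ε ^ 2 ≠ 0 := by positivity
    exact_mod_cast this
  simp only [cauchyFun]
  push_cast
  field_simp
  linear_combination (2 * I * ε ^ 3) * I_sq

theorem norm_cauchyFun_sub_eq (ε x s : ℝ) :
    ‖cauchyFun (ε * I - s) x‖ = ‖cauchyFun (-x + ε * I) s‖ := by
  simp only [cauchyFun, norm_inv]
  congr 1
  rw [← norm_neg, ← norm_conj]
  congr 1
  simp
  ring

theorem integral_scale_eq {ε : ℝ} (hε : 0 < ε) (x : ℝ) (g : ℝ → ℂ) :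
    ∫ s, g s = ∫ σ, (ε : ℂ) * g (x - ε * σ) := by
  rw [integral_const_mul, Measure.integral_comp_mul_left (fun s => g (x - s)) ε,
    integral_sub_left_eq_self g volume x, abs_of_pos (inv_pos.2 hε), real_smul, ← mul_assoc,
    ← ofReal_mul, mul_inv_cancel₀ hε.ne', ofReal_one, one_mul]

variable {p q : ℝ≥0∞} [Fact (1 ≤ p)] [Fact (1 ≤ q)] [ENNReal.HolderConjugate q p]

theorem integral_pairL_mul_cauchyFun_eq (h1 : 1 < p) (hp : p ≠ ⊤) (h1q : 1 < q)
    (hq : q ≠ ⊤) {T : LpR p →L[ℂ] LpR p} (k : LpLq p q)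
    (hk : ∀ f : LpR p, (T f : ℝ → ℂ) =ᵐ[volume] fun x => pairL q p ((k : ℝ → LpR q) x) f)
    (hT : ∀ l : ℝ, ∀ f ∈ mulHardy p (fun x => Complex.exp (Complex.I * l * x)),
      T f ∈ mulHardy p (fun x => Complex.exp (Complex.I * l * x)))
    (f : LpR p) {ε : ℝ} (hε : 0 < ε) (x : ℝ) :
    ∫ s, pairL q p (reflL q s ((k : ℝ → LpR q) s)) (reflL p x f) * cauchyFun (ε * I - s) x =
      -2 * I * ∫ σ : ℝ, (((1 + σ ^ 2)⁻¹ : ℝ) : ℂ) *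
        pairL q p ((k : ℝ → LpR q) (x - ε * σ)) (transL p (-(ε * σ)) f) := by
  have hu : 0 < (-x + ε * I).im := by simpa using hε
  have hbound : ∀ s, ‖pairL q p (reflL q s ((k : ℝ → LpR q) s)) (reflL p x f)‖ ≤
      ‖(k : ℝ → LpR q) s‖ * ‖f‖ := fun s => by
    simpa only [norm_reflL] using norm_pairL_le (reflL q s ((k : ℝ → LpR q) s)) (reflL p x f)
  have hmeas : AEStronglyMeasurable
      (fun s => pairL q p (reflL q s ((k : ℝ → LpR q) s)) (reflL p x f)) volume :=
    aestronglyMeasurable_pairL (aestronglyMeasurable_reflL hq k) aestronglyMeasurable_const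
  have hinteg : ∀ g : ℝ → ℂ, Measurable g → (∀ s, ‖g s‖ = ‖cauchyFun (-x + ε * I) s‖) →
      Integrable (fun s => pairL q p (reflL q s ((k : ℝ → LpR q) s)) (reflL p x f) * g s)
        volume := fun g hg hgn => by
    refine ((integrable_norm_mul_cauchyFun h1q hq k hu).mul_const ‖f‖).mono'
      (hmeas.mul hg.aestronglyMeasurable) (Eventually.of_forall fun s => ?_)
    rw [norm_mul, hgn]
    calc _ ≤ ‖(k : ℝ → LpR q) s‖ * ‖f‖ * ‖cauchyFun (-x + ε * I) s‖ := by
          gcongr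
          exact hbound s
      _ = _ := by ring
  have hzero : ∫ s, pairL q p (reflL q s ((k : ℝ → LpR q) s)) (reflL p x f) *
      cauchyFun (-x + ε * I) s = 0 := by
    rw [← integral_cauchyFun_mul_pairL_reflL_eq_zero h1 hp h1q hq k hk hT (reflL p x f) hu]
    refine integral_congr_ae (Eventually.of_forall fun s => ?_)
    simp only [pairL_reflL_reflL_eq]
    ring
  have hm : Measurable fun s : ℝ => cauchyFun (ε * I - s) x := by
    unfold cauchyFun
    fun_prop
  rw [← add_zero (∫ s, _), ← hzero, ← integral_add (hinteg _ hm (norm_cauchyFun_sub_eq ε x))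
    (hinteg _ (continuous_cauchyFun hu).measurable fun _ => rfl), integral_scale_eq hε x,
    ← integral_const_mul]
  refine integral_congr_ae (Eventually.of_forall fun σ => ?_)
  simp only [← mul_add]
  rw [poisson_eq_cauchyFun_add hε, pairL_reflL_reflL]
  have h2 : x - (x - ε * σ) = ε * σ := by ring
  have h3 : x - ε * σ - x = -(ε * σ) := by ring
  have h4 : ε * (ε * ((ε * σ) ^ 2 + ε ^ 2)⁻¹) = (1 + σ ^ 2)⁻¹ := by
    have : (1 + σ ^ 2) ≠ 0 := by positivity
    field_simp
    ring
  rw [h2, h3, ← h4]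
  push_cast
  ring

theorem mulOp_poissonAverage (h1 : 1 < p) (hp : p ≠ ⊤) (h1q : 1 < q)
    (hq : q ≠ ⊤) {T : LpR p →L[ℂ] LpR p} (k : LpLq p q)
    (hk : ∀ f : LpR p, (T f : ℝ → ℂ) =ᵐ[volume] fun x => pairL q p ((k : ℝ → LpR q) x) f)
    (hT : ∀ l : ℝ, ∀ f ∈ mulHardy p (fun x => Complex.exp (Complex.I * l * x)),
      T f ∈ mulHardy p (fun x => Complex.exp (Complex.I * l * x)))
    (f : LpR p) {v : ℂ} (hv : 0 < v.im) {ε : ℝ} (hw : 0 < (ε * I).im) (hεv : (ε * I).im < v.im) :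
    mulOp p (memLp_top_cauchyFun hv) (poissonAverage T ε f) = (I / 2) •
      ∫ s, convMulL q hp f (reflL q s ((k : ℝ → LpR q) s)) (cauchyProdLp p h1 hp hv hw s) := by
  have hε : 0 < ε := by simpa using hw
  have h2 := coeFn_integral_ae_eq q (integrable_convMulL h1 hp h1q hq k f hv hw hεv)
    (w := fun s x => pairL q p (reflL q s ((k : ℝ → LpR q) s)) (reflL p x f) *
      (cauchyFun v x * cauchyFun (ε * I - s) x)) ?_ (Eventually.of_forall fun s => ?_)
  · apply Lp.ext
    filter_upwards [h2, coeFn_mulOp (memLp_top_cauchyFun hv) (poissonAverage T ε f),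
      coeFn_poissonAverage hp k hk ε f, Lp.coeFn_smul (I / 2) (∫ s, convMulL q hp f
        (reflL q s ((k : ℝ → LpR q) s)) (cauchyProdLp p h1 hp hv hw s))] with x e1 e2 e3 e4
    rw [e2, e3, e4, Pi.smul_apply, e1, smul_eq_mul]
    have h3 := integral_pairL_mul_cauchyFun_eq h1 hp h1q hq k hk hT f hε x
    simp only [mul_left_comm _ (cauchyFun v x)]
    rw [integral_const_mul, h3]
    linear_combination (cauchyFun v x * ∫ σ : ℝ, (((1 + σ ^ 2)⁻¹ : ℝ) : ℂ) *
        pairL q p ((k : ℝ → LpR q) (x - ε * σ)) (transL p (-(ε * σ)) f)) * I_sq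
  · refine AEStronglyMeasurable.mul (aestronglyMeasurable_pairL ?_ ?_) ?_
    · exact (aestronglyMeasurable_reflL hq k).comp_fst
    · exact ((continuous_reflL hp).comp (continuous_snd.prodMk
        continuous_const)).aestronglyMeasurable
    · refine Measurable.aestronglyMeasurable ?_
      unfold cauchyFun
      fun_prop
  · filter_upwards [coeFn_convMulL hp f (reflL q s ((k : ℝ → LpR q) s))
      (cauchyProdLp p h1 hp hv hw s), coeFn_cauchyProdLp h1 hp hv hw hεv s] with x e1 e2
    rw [e1, e2]

variable {S : Subalgebra ℂ (LpR p →L[ℂ] LpR p)}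

theorem mulOp_poissonAverage_mem_orbitClosure (h1 : 1 < p) (hp : p ≠ ⊤) (h1q : 1 < q)
    (hq : q ≠ ⊤) {T : LpR p →L[ℂ] LpR p} (k : LpLq p q)
    (hk : ∀ f : LpR p, (T f : ℝ → ℂ) =ᵐ[volume] fun x => pairL q p ((k : ℝ → LpR q) x) f)
    (hT : T ∈ fourierBinest p) (hS : IsSOTClosed p (S : Set (LpR p →L[ℂ] LpR p)))
    (hgens : parabolicGens p ⊆ S) {ι : Type*} [Fintype ι] (F : ι → LpR p) {v : ℂ}
    (hv : 0 < v.im) {ε : ℝ} (hε : 0 < ε) (hεv : ε < v.im) :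
    (fun i => mulOp p (memLp_top_cauchyFun hv) (poissonAverage T ε (F i))) ∈
      orbitClosure S F := by
  have hw : 0 < (ε * I).im := by simpa using hε
  have hwv : (ε * I).im < v.im := by simpa using hεv
  have hinteg := fun i => integrable_convMulL h1 hp h1q hq k (F i) hv hw hwv
  have h := (orbitClosure S F).smul_mem (I / 2) (Submodule.integral_mem_of_isClosed
    (isClosed_orbitClosure S F) (Integrable.of_eval hinteg) ?_)
  · convert h using 1
    ext1 i
    rw [Pi.smul_apply, mulOp_poissonAverage h1 hp h1q hq k hk hT.2 (F i) hv hw hwv]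
    exact congrArg _ (eval_integral hinteg i).symm
  · filter_upwards [ae_reflL_eq_zero_of_invariant hp hq hk hT.1] with s hs
    have hws : 0 < (ε * I - s).im := by simpa using hε
    exact convMulL_mem hp hq hgens ((isMultiplier_cauchyFun hp hS hgens hv).mul
      (isMultiplier_cauchyFun hp hS hgens hws)) (coeFn_cauchyProdLp h1 hp hv hw hwv s) F hs

theorem mem_of_mem_fourierBinest (h1 : 1 < p) (hp : p ≠ ⊤) (h1q : 1 < q)
    (hq : q ≠ ⊤) {T : LpR p →L[ℂ] LpR p} (k : LpLq p q)
    (hk : ∀ f : LpR p, (T f : ℝ → ℂ) =ᵐ[volume] fun x => pairL q p ((k : ℝ → LpR q) x) f)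
    (hT : T ∈ fourierBinest p) (hS : IsSOTClosed p (S : Set (LpR p →L[ℂ] LpR p)))
    (hgens : parabolicGens p ⊆ S) : T ∈ S := by
  refine mem_of_forall_mem_orbitClosure hS fun J => ?_
  set F : J → LpR p := fun i => (i : LpR p)
  refine (isClosed_orbitClosure S F).mem_of_tendsto (tendsto_pi_nhds.2 fun i =>
    tendsto_mulOp_approxOne hp (T (F i))) (Eventually.of_forall fun n => ?_)
  have hv := ofReal_succ_mul_I_im_pos n
  have hlim : (fun i => mulOp p (memLp_top_cauchyFun hv) ((Real.pi : ℂ) • T (F i))) ∈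
      orbitClosure S F := by
    refine (isClosed_orbitClosure S F).mem_of_tendsto (b := 𝓝[>] (0 : ℝ))
      (tendsto_pi_nhds.2 fun i => ((mulOp p (memLp_top_cauchyFun hv)).continuous.tendsto _).comp
        (tendsto_poissonAverage hp T (F i))) ?_
    filter_upwards [Ioo_mem_nhdsGT hv] with ε hε
    exact mulOp_poissonAverage_mem_orbitClosure h1 hp h1q hq k hk hT hS hgens F hv hε.1 hε.2
  have h := (orbitClosure S F).smul_mem ((((n + 1 : ℝ) : ℂ) * I) * (Real.pi : ℂ)⁻¹) hlim
  refine (congrArg (· ∈ orbitClosure S F) (funext fun i => ?_)).mpr h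
  have hpi : (Real.pi : ℂ) ≠ 0 := by exact_mod_cast Real.pi_ne_zero
  rw [Pi.smul_apply, map_smul, smul_smul, mul_assoc, inv_mul_cancel₀ hpi, mul_one]
  apply Lp.ext
  filter_upwards [coeFn_mulOp (memLp_approxOne n) (T (F i)),
    Lp.coeFn_smul (((n + 1 : ℝ) : ℂ) * I) (mulOp p (memLp_top_cauchyFun hv) (T (F i))),
    coeFn_mulOp (memLp_top_cauchyFun hv) (T (F i))] with x e1 e2 e3
  rw [e1, e2, Pi.smul_apply, e3, smul_eq_mul, approxOne, mul_assoc]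

end PoissonIdentity

/-- For every `p ∈ (1,∞)` with conjugate exponent `q`,
`G^p ∩ A_FB^p = G^p ∩ A_par^p`. -/
theorem Gp_inter_fourierBinest_eq_Gp_inter_parabolicAlgebra
    (p q : ℝ≥0∞) [Fact (1 ≤ p)] [Fact (1 ≤ q)]
    (hp : 1 < p) (hp' : p ≠ ⊤) (hq : 1 < q) (hq' : q ≠ ⊤)
    (hpq : 1 / p + 1 / q = 1) :
    Gp p q ∩ fourierBinest p = Gp p q ∩ parabolicAlgebra p := by
  have : ENNReal.HolderConjugate q p := by
    rw [ENNReal.holderConjugate_iff, add_comm]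
    simpa only [one_div] using hpq
  refine Set.Subset.antisymm ?_
    (Set.inter_subset_inter_right _ (parabolicAlgebra_subset_fourierBinest hq hq' hp'))
  rintro T ⟨⟨k, hk⟩, hT⟩
  refine ⟨⟨k, hk⟩, Set.mem_sInter.2 ?_⟩
  rintro _ ⟨hgens, hS, A, rfl⟩
  refine mem_of_mem_fourierBinest hp hp' hq hq' k (fun f => ?_) hT hS hgens
  filter_upwards [hk f] with x hx
  rw [hx, pairL_apply]

end
end

section
/- For p ∈ (1,∞), let h_n(x) = ni/(x+ni) and φ_n = n·χ_{[0,1/n]}, and let X_n = M_{h_n} Δ_{φ_n}, i.e. (X_n f)(x) = h_n(x) ∫_ℝ φ_n(x−y) f(y) dy. Then each X_n is a (p,q)-integral operator belonging to A_par^p, ‖X_n‖ ≤ 1 for all n, and X_n converges to the identity in the strong operator topology: ‖X_n f − f‖_p → 0 for every f ∈ L^p(ℝ). Thus A_par^p contains a bounded approximate identity of elements of G^p. -/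
open MeasureTheory Complex Filter Topology
open scoped ENNReal NNReal

noncomputable section

section Average

variable {E : Type*} [NormedAddCommGroup E] [NormedSpace ℂ E]

/-- A strongly continuous family of contractions is Bochner integrable at each vector. -/
lemma integrable_orbit (ν : Measure ℝ) [IsFiniteMeasure ν] {U : ℝ → E →L[ℂ] E}
    (hc : ∀ f, Continuous fun t => U t f) (hb : ∀ t f, ‖U t f‖ ≤ ‖f‖) (f : E) :
    Integrable (fun t => U t f) ν :=
  Integrable.of_bound (hc f).aestronglyMeasurable ‖f‖ (ae_of_all _ fun t => hb t f)

/-- The strong integral `f ↦ ∫ U t f ∂ν` of a strongly continuous family of contractions. -/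
def averageOp (ν : Measure ℝ) [IsProbabilityMeasure ν] (U : ℝ → E →L[ℂ] E)
    (hc : ∀ f, Continuous fun t => U t f) (hb : ∀ t f, ‖U t f‖ ≤ ‖f‖) : E →L[ℂ] E :=
  LinearMap.mkContinuous
    { toFun := fun f => ∫ t, U t f ∂ν
      map_add' := fun f g => by
        simp only [map_add]
        exact integral_add (integrable_orbit ν hc hb f) (integrable_orbit ν hc hb g)
      map_smul' := fun c f => by
        simp only [map_smul, RingHom.id_apply]
        exact integral_smul c _ } 1 fun f => by
    simpa using norm_integral_le_of_norm_le_const (μ := ν) (ae_of_all _ fun t => hb t f)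

lemma averageOp_apply (ν : Measure ℝ) [IsProbabilityMeasure ν] (U : ℝ → E →L[ℂ] E)
    (hc : ∀ f, Continuous fun t => U t f) (hb : ∀ t f, ‖U t f‖ ≤ ‖f‖) (f : E) :
    averageOp ν U hc hb f = ∫ t, U t f ∂ν := rfl

lemma norm_averageOp_le (ν : Measure ℝ) [IsProbabilityMeasure ν] (U : ℝ → E →L[ℂ] E)
    (hc : ∀ f, Continuous fun t => U t f) (hb : ∀ t f, ‖U t f‖ ≤ ‖f‖) :
    ‖averageOp ν U hc hb‖ ≤ 1 :=
  LinearMap.mkContinuous_norm_le _ zero_le_one _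

/-- An average of operators lying in a subspace `A` is a strong limit point of `A`. -/
lemma averageOp_mem_closure [CompleteSpace E] (ν : Measure ℝ) [IsProbabilityMeasure ν]
    (U : ℝ → E →L[ℂ] E) (hc : ∀ f, Continuous fun t => U t f) (hb : ∀ t f, ‖U t f‖ ≤ ‖f‖)
    (A : Submodule ℂ (E →L[ℂ] E)) (hA : ∀ᵐ t ∂ν, U t ∈ A) :
    ⇑(averageOp ν U hc hb) ∈ closure ((fun B : E →L[ℂ] E => (B : E → E)) '' A) := by
  rw [mem_closure_iff]
  intro o ho hT
  obtain ⟨I, u, hu, hsub⟩ := isOpen_pi_iff.1 ho _ hT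
  let ev : (E →L[ℂ] E) →ₗ[ℝ] (I → E) :=
    { toFun := fun B i => B i
      map_add' := fun B C => rfl
      map_smul' := fun c B => rfl }
  let K : Submodule ℝ (I → E) := (A.restrictScalars ℝ).map ev
  have hint : Integrable (fun t => ev (U t)) ν := by
    rw [integrable_pi_iff (f := fun t => ev (U t))]
    exact fun i => integrable_orbit ν hc hb (i : E)
  have hmem : (∫ t, ev (U t) ∂ν) ∈ closure (K : Set (I → E)) :=
    K.convex.closure.integral_mem isClosed_closure
      (hA.mono fun t ht => subset_closure ⟨U t, ht, rfl⟩) hint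
  have heval : ∀ i : I, (∫ t, ev (U t) ∂ν) i = averageOp ν U hc hb i := fun i =>
    eval_integral (f := fun t => ev (U t)) (fun i => integrable_orbit ν hc hb (i : E)) i
  obtain ⟨_, hz, B, hB, rfl⟩ := mem_closure_iff.1 hmem (Set.univ.pi fun i : I => u i)
    (isOpen_set_pi Set.finite_univ fun i _ => (hu i i.2).1)
    fun i _ => by rw [heval]; exact (hu i i.2).2
  exact ⟨B, hsub fun i hi => hz ⟨i, hi⟩ trivial, B, hB, rfl⟩

/-- Averages of `U (s n * t)` converge strongly to `U 0 = 1` as `s n → 0`. -/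
lemma tendsto_integral_orbit (ν : Measure ℝ) [IsProbabilityMeasure ν] {U : ℝ → E →L[ℂ] E}
    [CompleteSpace E]
    (hc : ∀ f, Continuous fun t => U t f) (hb : ∀ t f, ‖U t f‖ ≤ ‖f‖) (h0 : ∀ f, U 0 f = f)
    {s : ℕ → ℝ} (hs : Tendsto s atTop (𝓝 0)) (f : E) :
    Tendsto (fun n => ∫ t, U (s n * t) f ∂ν) atTop (𝓝 f) := by
  have : Tendsto (fun n => ∫ t, U (s n * t) f ∂ν) atTop (𝓝 (∫ _, f ∂ν)) := by
    refine tendsto_integral_of_dominated_convergence (fun _ => ‖f‖)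
      (fun n => ((hc f).comp (continuous_const_mul (s n))).aestronglyMeasurable)
      (integrable_const _) (fun n => ae_of_all _ fun t => hb _ f) (ae_of_all _ fun t => ?_)
    have h : Tendsto (fun n => s n * t) atTop (𝓝 0) := by simpa using hs.mul_const t
    simpa [h0, Function.comp_def] using ((hc f).tendsto 0).comp h
  simpa using this

end Average

section LpIntegral

variable {p : ℝ≥0∞} [Fact (1 ≤ p)]

lemma exists_setIntegral_norm_le {s : Set ℝ} (hs : volume s < ⊤) :
    ∃ C : ℝ, ∀ f : LpR p, IntegrableOn f s ∧ ∫ x in s, ‖f x‖ ≤ C * ‖f‖ := by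
  have : IsFiniteMeasure (volume.restrict s) := ⟨by simpa using hs⟩
  have hp : 1 ≤ p := Fact.out
  refine ⟨(volume s ^ (1 / (1 : ℝ≥0∞).toReal - 1 / p.toReal)).toReal, fun f => ?_⟩
  have hf : MemLp f p (volume.restrict s) := (Lp.memLp f).restrict s
  refine ⟨hf.integrable hp, ?_⟩
  rw [integral_norm_eq_lintegral_enorm hf.1, ← eLpNorm_one_eq_lintegral_enorm, Lp.norm_def,
    ← ENNReal.toReal_mul, mul_comm]
  have hexp : 0 ≤ 1 / (1 : ℝ≥0∞).toReal - 1 / p.toReal := by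
    rcases eq_or_ne p ⊤ with rfl | hp'
    · simp
    · have : 1 ≤ p.toReal := by simpa using ENNReal.toReal_mono hp' hp
      simpa using inv_le_one_of_one_le₀ this
  refine ENNReal.toReal_mono (ENNReal.mul_ne_top (Lp.eLpNorm_ne_top f)
    (ENNReal.rpow_ne_top_of_nonneg hexp hs.ne)) ?_
  refine (eLpNorm_le_eLpNorm_mul_rpow_measure_univ hp hf.1).trans ?_
  rw [Measure.restrict_apply_univ]
  gcongr
  exact Measure.restrict_le_self

/-- A Bochner integral in `L^p` is computed pointwise almost everywhere. -/
lemma coeFn_integral_Lp (ν : Measure ℝ) [IsFiniteMeasure ν] {F : ℝ → LpR p}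
    (hF : Continuous F) {C : ℝ} (hC : ∀ t, ‖F t‖ ≤ C) {G : ℝ × ℝ → ℂ} (hG : StronglyMeasurable G)
    (hFG : ∀ t, F t =ᵐ[volume] fun x => G (t, x)) :
    ((∫ t, F t ∂ν : LpR p) : ℝ → ℂ) =ᵐ[volume] fun x => ∫ t, G (t, x) ∂ν := by
  have hFint : Integrable F ν :=
    Integrable.of_bound hF.aestronglyMeasurable C (ae_of_all _ hC)
  have hprod : ∀ s, volume s < ⊤ → Integrable G (ν.prod (volume.restrict s)) := by
    intro s hs
    obtain ⟨D, hD⟩ := exists_setIntegral_norm_le (p := p) hs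
    rw [integrable_prod_iff hG.aestronglyMeasurable]
    refine ⟨ae_of_all _ fun t => (hD (F t)).1.congr (ae_restrict_of_ae (hFG t)), ?_⟩
    refine Integrable.of_bound (C := |D| * C)
      hG.norm.integral_prod_right.aestronglyMeasurable (ae_of_all _ fun t => ?_)
    rw [Real.norm_of_nonneg (integral_nonneg fun _ => norm_nonneg _),
      ← integral_congr_ae ((ae_restrict_of_ae (hFG t)).mono fun x hx => congrArg norm hx)]
    refine (hD (F t)).2.trans ?_
    gcongr
    exacts [le_abs_self D, hC t]
  refine ae_eq_of_forall_setIntegral_eq_of_sigmaFinite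
    (fun s _ hs => ((exists_setIntegral_norm_le (p := p) hs).choose_spec _).1)
    (fun s _ hs => (hprod s hs).integral_prod_right) fun s _ hs => ?_
  obtain ⟨D, hD⟩ := exists_setIntegral_norm_le (p := p) hs
  let L : LpR p →L[ℂ] ℂ := LinearMap.mkContinuous
    { toFun := fun f => ∫ x in s, f x
      map_add' := fun f g => by
        rw [← integral_add (hD f).1 (hD g).1]
        exact integral_congr_ae (ae_restrict_of_ae (Lp.coeFn_add f g))
      map_smul' := fun c f => by
        rw [RingHom.id_apply, ← integral_smul]
        exact integral_congr_ae (ae_restrict_of_ae (Lp.coeFn_smul c f)) } D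
    fun f => (norm_integral_le_integral_norm _).trans (hD f).2
  calc ∫ x in s, (∫ t, F t ∂ν : LpR p) x = L (∫ t, F t ∂ν) := rfl
    _ = ∫ t, L (F t) ∂ν := (L.integral_comp_comm hFint).symm
    _ = ∫ t, (∫ x in s, G (t, x)) ∂ν :=
      integral_congr_ae (ae_of_all _ fun t => integral_congr_ae (ae_restrict_of_ae (hFG t)))
    _ = ∫ x in s, ∫ t, G (t, x) ∂ν := integral_integral_swap (f := fun t x => G (t, x)) (hprod s hs)

end LpIntegral

section Generators

variable (p : ℝ≥0∞)

lemma norm_exp_I_mul_mul (t x : ℝ) : ‖Complex.exp (Complex.I * t * x)‖ = 1 := by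
  rw [show Complex.I * t * x = ((t * x : ℝ) : ℂ) * Complex.I by push_cast; ring]
  exact Complex.norm_exp_ofReal_mul_I _

variable {p} in
lemma memLp_exp_mul (t : ℝ) (f : LpR p) :
    MemLp (fun x : ℝ => Complex.exp (Complex.I * t * x) * f x) p volume :=
  (Lp.memLp f).of_le_mul (c := 1)
    ((by fun_prop : Continuous fun x : ℝ =>
      Complex.exp (Complex.I * t * x)).aestronglyMeasurable.mul (Lp.aestronglyMeasurable f))
    (ae_of_all _ fun x => by rw [norm_mul, norm_exp_I_mul_mul])

variable [Fact (1 ≤ p)]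

/-- Translation by `t` on `L^p(ℝ)`. -/
def translateOp (t : ℝ) : LpR p →L[ℂ] LpR p :=
  LinearMap.mkContinuous
    { toFun := fun f => DomAddAct.mk (-t) +ᵥ f
      map_add' := fun f g => DomAddAct.vadd_Lp_add _ f g
      map_smul' := fun c f => by rcases f with ⟨⟨_⟩, _⟩; rfl } 1
    fun f => by simp

variable {p} in
lemma translateOp_apply (t : ℝ) (f : LpR p) :
    translateOp p t f = (DomAddAct.mk (-t) +ᵥ f : LpR p) := rfl

lemma isTransOp_translateOp (t : ℝ) : IsTransOp p t (translateOp p t) := fun f => by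
  filter_upwards [DomAddAct.vadd_Lp_ae_eq (DomAddAct.mk (-t)) f] with x hx
  rw [translateOp_apply, hx]
  simp [neg_add_eq_sub]

variable {p} in
lemma norm_translateOp_apply_le (t : ℝ) (f : LpR p) : ‖translateOp p t f‖ ≤ ‖f‖ := by
  rw [translateOp_apply, DomAddAct.norm_vadd_Lp]

variable {p} in
lemma translateOp_zero_apply (f : LpR p) : translateOp p 0 f = f := by
  simp [translateOp_apply]

variable {p} in
lemma continuous_translateOp_apply (hp : p ≠ ⊤) (f : LpR p) :
    Continuous fun t => translateOp p t f := by
  have : Fact (p ≠ ⊤) := ⟨hp⟩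
  simp only [translateOp_apply]
  have : Continuous fun t : ℝ => DomAddAct.mk (-t) :=
    DomAddAct.continuous_mk.comp continuous_neg
  exact this.vadd continuous_const

/-- Multiplication by `e^{itx}` on `L^p(ℝ)`. -/
def phaseOp (t : ℝ) : LpR p →L[ℂ] LpR p :=
  LinearMap.mkContinuous
    { toFun := fun f => (memLp_exp_mul t f).toLp _
      map_add' := fun f g => by
        rw [← MemLp.toLp_add]
        refine MemLp.toLp_congr _ _ ?_
        filter_upwards [Lp.coeFn_add f g] with x hx
        simp only [hx, Pi.add_apply, mul_add]
      map_smul' := fun c f => by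
        rw [RingHom.id_apply, ← MemLp.toLp_const_smul]
        refine MemLp.toLp_congr _ _ ?_
        filter_upwards [Lp.coeFn_smul c f] with x hx
        simp only [hx, Pi.smul_apply, smul_eq_mul]
        ring } 1
    fun f => by
      refine Lp.norm_le_mul_norm_of_ae_le_mul ?_
      filter_upwards [(memLp_exp_mul t f).coeFn_toLp] with x hx
      simp only [LinearMap.coe_mk, AddHom.coe_mk, hx, norm_mul, norm_exp_I_mul_mul, le_refl]

variable {p} in
lemma phaseOp_apply (t : ℝ) (f : LpR p) : phaseOp p t f = (memLp_exp_mul t f).toLp _ := rfl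

lemma isMulOp_phaseOp (t : ℝ) :
    IsMulOp p (fun x => Complex.exp (Complex.I * t * x)) (phaseOp p t) :=
  fun f => (memLp_exp_mul t f).coeFn_toLp

variable {p} in
lemma norm_phaseOp_apply_le (t : ℝ) (f : LpR p) : ‖phaseOp p t f‖ ≤ ‖f‖ := by
  simpa using (phaseOp p t).le_of_opNorm_le (LinearMap.mkContinuous_norm_le _ zero_le_one _) f

variable {p} in
lemma phaseOp_zero_apply (f : LpR p) : phaseOp p 0 f = f := by
  refine Lp.ext ?_
  filter_upwards [isMulOp_phaseOp p 0 f] with x hx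
  simp [hx]

variable {p} in
lemma continuous_phaseOp_apply (hp : p ≠ ⊤) (f : LpR p) :
    Continuous fun t => phaseOp p t f := by
  have hp0 : p ≠ 0 := (zero_lt_one.trans_le (Fact.out : 1 ≤ p)).ne'
  have hpos : 0 < p.toReal := ENNReal.toReal_pos hp0 hp
  refine continuous_iff_continuousAt.2 fun t₀ => ?_
  refine (Lp.tendsto_Lp_iff_tendsto_eLpNorm'' _ (fun t => memLp_exp_mul t f) _
    (memLp_exp_mul t₀ f)).2 ?_
  simp only [eLpNorm_eq_lintegral_rpow_enorm_toReal hp0 hp]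
  have key : Tendsto (fun t : ℝ => ∫⁻ x : ℝ,
      ‖((fun x : ℝ => Complex.exp (Complex.I * t * x) * f x) -
      fun x : ℝ => Complex.exp (Complex.I * t₀ * x) * f x) x‖ₑ ^ p.toReal) (𝓝 t₀)
      (𝓝 (∫⁻ _ : ℝ, 0)) := by
    refine tendsto_lintegral_filter_of_dominated_convergence'
      (fun x => (2 * ‖f x‖ₑ) ^ p.toReal) (Eventually.of_forall fun t => ?_)
      (Eventually.of_forall fun t => ae_of_all _ fun x => ?_) ?_ (ae_of_all _ fun x => ?_)
    · exact (((memLp_exp_mul t f).1.sub (memLp_exp_mul t₀ f).1).enorm).pow_const _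
    · gcongr
      simp only [Pi.sub_apply]
      refine (enorm_sub_le).trans ?_
      simp only [← ofReal_norm, norm_mul, norm_exp_I_mul_mul, two_mul, one_mul, le_refl]
    · simp_rw [ENNReal.mul_rpow_of_nonneg _ _ hpos.le]
      rw [lintegral_const_mul' _ _ (by finiteness)]
      exact ENNReal.mul_ne_top (by finiteness)
        ((eLpNorm_lt_top_iff_lintegral_rpow_enorm_lt_top hp0 hp).1 (Lp.eLpNorm_lt_top f)).ne
    · have hcont : Continuous fun t : ℝ => ‖Complex.exp (Complex.I * t * x) * f x -
          Complex.exp (Complex.I * t₀ * x) * f x‖ₑ ^ p.toReal :=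
        ENNReal.continuous_rpow_const.comp (by fun_prop)
      simpa [hpos] using hcont.tendsto t₀
  rw [lintegral_zero] at key
  simpa [hpos, Function.comp_def] using
    (ENNReal.continuous_rpow_const (y := 1 / p.toReal)).tendsto 0 |>.comp key

end Generators

section Measures

/-- The exponential distribution with density `e^{-t}` on `(0, ∞)`. -/
def unitExp : Measure ℝ :=
  (volume.restrict (Set.Ioi 0)).withDensity fun t => ENNReal.ofReal (Real.exp (-t))

lemma measurable_ofReal_exp_neg : Measurable fun t : ℝ => ENNReal.ofReal (Real.exp (-t)) := by
  fun_prop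

instance : IsProbabilityMeasure unitExp where
  measure_univ := by
    rw [unitExp, withDensity_apply _ MeasurableSet.univ, Measure.restrict_univ,
      ← ofReal_integral_eq_lintegral_ofReal (integrableOn_exp_neg_Ioi 0)
        (ae_of_all _ fun _ => (Real.exp_pos _).le), integral_exp_neg_Ioi_zero, ENNReal.ofReal_one]

lemma ae_unitExp_pos : ∀ᵐ t ∂unitExp, 0 < t :=
  (withDensity_absolutelyContinuous _ _).ae_le (ae_restrict_mem measurableSet_Ioi)

/-- The Fourier transform of the exponential distribution. -/
lemma integral_exp_unitExp (s x : ℝ) :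
    ∫ t, Complex.exp (Complex.I * (s * t : ℝ) * x) ∂unitExp = 1 / (1 - Complex.I * s * x) := by
  rw [unitExp, integral_withDensity_eq_integral_toReal_smul measurable_ofReal_exp_neg
    (ae_of_all _ fun _ => ENNReal.ofReal_lt_top)]
  have hre : (Complex.I * s * x - 1).re < 0 := by simp
  calc _ = ∫ t in Set.Ioi (0 : ℝ), Complex.exp ((Complex.I * s * x - 1) * t) := by
        refine integral_congr_ae (ae_of_all _ fun t => ?_)
        simp only [ENNReal.toReal_ofReal (Real.exp_pos _).le, Complex.real_smul,
          Complex.ofReal_exp, ← Complex.exp_add]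
        congr 1
        push_cast
        ring
    _ = _ := by
        rw [integral_exp_mul_complex_Ioi hre]
        rw [← neg_sub, ← neg_div_neg_eq]
        simp

/-- The uniform distribution on `[0, 1]`. -/
def unitUniform : Measure ℝ := volume.restrict (Set.Icc 0 1)

instance : IsProbabilityMeasure unitUniform where
  measure_univ := by simp [unitUniform]

lemma integral_unitUniform_comp_sub (f : ℝ → ℂ) {a : ℝ} (ha : 0 < a) (x : ℝ) :
    ∫ t, f (x - 1 / a * t) ∂unitUniform =
      ∫ y, (((Set.Icc (0 : ℝ) (1 / a)).indicator (fun _ => a) (x - y) : ℝ) : ℂ) * f y := by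
  let g : ℝ → ℂ := fun u =>
    (((Set.Icc (0 : ℝ) (1 / a)).indicator (fun _ => a) u : ℝ) : ℂ) * f (x - u)
  have h1 : ∫ y, (((Set.Icc (0 : ℝ) (1 / a)).indicator (fun _ => a) (x - y) : ℝ) : ℂ) * f y =
      ∫ u, g u := by
    rw [← integral_sub_left_eq_self g volume x]
    simp [g]
  have h2 : ∀ t, g (1 / a * t) =
      (Set.Icc (0 : ℝ) 1).indicator (fun t => (a : ℂ) * f (x - 1 / a * t)) t := by
    intro t
    have : 1 / a * t ∈ Set.Icc (0 : ℝ) (1 / a) ↔ t ∈ Set.Icc (0 : ℝ) 1 := by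
      have : 0 < 1 / a := by positivity
      simp only [Set.mem_Icc]
      refine and_congr (mul_nonneg_iff_of_pos_left this) ?_
      nth_rw 2 [← mul_one (1 / a)]
      exact mul_le_mul_iff_right₀ this
    by_cases ht : t ∈ Set.Icc (0 : ℝ) 1
    · simp only [g, Set.indicator_of_mem ht, Set.indicator_of_mem (this.2 ht)]
    · simp only [g, Set.indicator_of_notMem ht, Set.indicator_of_notMem (mt this.1 ht),
        Complex.ofReal_zero, zero_mul]
  have h3 := Measure.integral_comp_mul_left g (1 / a)
  simp only [h2, integral_indicator measurableSet_Icc, integral_const_mul] at h3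
  have ha' : (a : ℂ) ≠ 0 := by exact_mod_cast ha.ne'
  have : |(1 / a)⁻¹| = a := by rw [one_div, inv_inv, abs_of_pos ha]
  rw [this, Complex.real_smul] at h3
  rw [h1, unitUniform]
  exact mul_left_cancel₀ ha' h3

end Measures

section ApproximateIdentity

variable {p : ℝ≥0∞}

lemma norm_mul_I_div_add_mul_I_le {a : ℝ} (ha : 1 ≤ a) (x : ℝ) :
    ‖(a : ℂ) * Complex.I / (x + a * Complex.I)‖ ≤ 2 * a * ‖(1 + ‖x‖)⁻¹‖ := by
  have hre : |x| ≤ ‖(x : ℂ) + a * Complex.I‖ := by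
    simpa using Complex.abs_re_le_norm ((x : ℂ) + a * Complex.I)
  have him : |a| ≤ ‖(x : ℂ) + a * Complex.I‖ := by
    simpa using Complex.abs_im_le_norm ((x : ℂ) + a * Complex.I)
  have ha0 : 0 < a := zero_lt_one.trans_le ha
  rw [abs_of_pos ha0] at him
  have hx : 0 < 1 + |x| := by positivity
  rw [norm_div, norm_mul, Complex.norm_I, Complex.norm_real, mul_one, Real.norm_eq_abs,
    Real.norm_eq_abs, Real.norm_eq_abs, abs_of_pos ha0, abs_of_pos (inv_pos.2 hx),
    ← div_eq_mul_inv, div_le_div_iff₀ (by linarith) hx]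
  nlinarith

lemma memLp_mul_I_div_add_mul_I (hp : 1 < p) (hp' : p ≠ ⊤) {a : ℝ} (ha : 1 ≤ a) :
    MemLp (fun x : ℝ => (a : ℂ) * Complex.I / (x + a * Complex.I)) p volume := by
  have hp1 : 1 < p.toReal := by
    simpa using (ENNReal.toReal_lt_toReal ENNReal.one_ne_top hp').2 hp
  have hbase : MemLp (fun x : ℝ => (1 + ‖x‖)⁻¹) p volume := by
    rw [← integrable_norm_rpow_iff (by fun_prop) (zero_lt_one.trans hp).ne' hp']
    refine (integrable_one_add_norm (E := ℝ) (μ := volume) (r := p.toReal) (by simpa)).congr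
      (ae_of_all _ fun x => ?_)
    have hx : 0 < 1 + ‖x‖ := by positivity
    simp only [Real.norm_of_nonneg (inv_pos.2 hx).le, Real.rpow_neg hx.le, Real.inv_rpow hx.le]
  exact hbase.of_le_mul (by fun_prop : Measurable _).aestronglyMeasurable
    (ae_of_all _ (norm_mul_I_div_add_mul_I_le ha))

/-- The kernel `h(x) φ(x - y)`, with `h ∈ L^p` and `φ ∈ L^q`, defines an element of
`L^p(ℝ; L^q(ℝ))`. -/
lemma exists_kernel_mul_sub {q : ℝ≥0∞} [Fact (1 ≤ q)] (hq : q ≠ ⊤) {h φ : ℝ → ℂ}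
    (hh : MemLp h p volume) (hφ : MemLp φ q volume) :
    ∃ k : LpLq p q, ∀ᵐ x, (k x : ℝ → ℂ) =ᵐ[volume] fun y => h x * φ (x - y) := by
  have hφ' : MemLp (fun y => φ (-y)) q volume :=
    hφ.comp_measurePreserving (Measure.measurePreserving_neg volume)
  set g : LpR q := hφ'.toLp _ with hg
  have hk : MemLp (fun x => h x • translateOp q x g) p volume :=
    hh.of_le_mul (c := ‖g‖)
      (hh.1.smul (continuous_translateOp_apply hq g).aestronglyMeasurable)
      (ae_of_all _ fun x => by
        rw [norm_smul, mul_comm]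
        gcongr
        exact norm_translateOp_apply_le x g)
  refine ⟨hk.toLp _, ?_⟩
  filter_upwards [hk.coeFn_toLp] with x hx
  rw [hx]
  have hshift : ∀ᵐ y, g (y - x) = φ (-(y - x)) :=
    (measurePreserving_sub_right volume x).quasiMeasurePreserving.ae hφ'.coeFn_toLp
  filter_upwards [Lp.coeFn_smul (h x) (translateOp q x g), isTransOp_translateOp q x g, hshift]
    with y hy₁ hy₂ hy₃
  rw [hy₁, Pi.smul_apply, hy₂, hy₃, smul_eq_mul, neg_sub]

variable [Fact (1 ≤ p)]

/-- The operator `Δ_φ` of convolution by `φ = a · χ_{[0, 1/a]}`, with `s = 1/a`. -/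
def convOp (hp : p ≠ ⊤) (s : ℝ) : LpR p →L[ℂ] LpR p :=
  averageOp unitUniform (fun t => translateOp p (s * t))
    (fun f => (continuous_translateOp_apply hp f).comp (continuous_const_mul s))
    (fun _ f => norm_translateOp_apply_le _ f)

/-- The operator of multiplication by `x ↦ 1 / (1 - i s x)`. -/
def resolventOp (hp : p ≠ ⊤) (s : ℝ) : LpR p →L[ℂ] LpR p :=
  averageOp unitExp (fun t => phaseOp p (s * t))
    (fun f => (continuous_phaseOp_apply hp f).comp (continuous_const_mul s))
    (fun _ f => norm_phaseOp_apply_le _ f)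

lemma coeFn_convOp (hp : p ≠ ⊤) {a : ℝ} (ha : 0 < a) (f : LpR p) :
    (convOp hp (1 / a) f : ℝ → ℂ) =ᵐ[volume] fun x =>
      ∫ y, (((Set.Icc (0 : ℝ) (1 / a)).indicator (fun _ => a) (x - y) : ℝ) : ℂ) * f y := by
  simp only [← integral_unitUniform_comp_sub f ha]
  exact coeFn_integral_Lp (C := ‖f‖) unitUniform
    ((continuous_translateOp_apply hp f).comp (continuous_const_mul (1 / a)))
    (fun t => norm_translateOp_apply_le _ f) (G := fun z => f (z.2 - 1 / a * z.1))
    ((Lp.stronglyMeasurable f).comp_measurable (by fun_prop))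
    (fun t => isTransOp_translateOp p _ f)

lemma isMulOp_resolventOp (hp : p ≠ ⊤) (s : ℝ) :
    IsMulOp p (fun x => 1 / (1 - Complex.I * s * x)) (resolventOp hp s) := fun f => by
  have h := coeFn_integral_Lp (C := ‖f‖) unitExp
    ((continuous_phaseOp_apply hp f).comp (continuous_const_mul s))
    (fun t => norm_phaseOp_apply_le _ f)
    (G := fun z => Complex.exp (Complex.I * (s * z.1 : ℝ) * z.2) * f z.2)
    ((by fun_prop : Continuous fun z : ℝ × ℝ =>
      Complex.exp (Complex.I * (s * z.1 : ℝ) * z.2)).stronglyMeasurable.mul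
      ((Lp.stronglyMeasurable f).comp_measurable measurable_snd))
    (fun t => isMulOp_phaseOp p _ f)
  filter_upwards [h] with x hx
  rw [← integral_exp_unitExp, ← integral_mul_const]
  exact hx

lemma comp_mem_parabolicAlgebra (hp : p ≠ ⊤) {s : ℝ} (hs : 0 ≤ s) :
    resolventOp hp s ∘L convOp hp s ∈ parabolicAlgebra p := by
  rintro S ⟨hgen, hclosed, A, rfl⟩
  have hM : resolventOp hp s ∈ A := by
    refine hclosed _ (averageOp_mem_closure _ _ _ _ A.toSubmodule ?_)
    filter_upwards [ae_unitExp_pos] with t ht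
    exact hgen (Or.inl ⟨s * t, mul_nonneg hs ht.le, isMulOp_phaseOp p _⟩)
  have hT : convOp hp s ∈ A := by
    refine hclosed _ (averageOp_mem_closure _ _ _ _ A.toSubmodule ?_)
    filter_upwards [ae_restrict_mem measurableSet_Icc] with t ht
    exact hgen (Or.inr ⟨s * t, mul_nonneg hs ht.1, isTransOp_translateOp p _⟩)
  exact A.mul_mem hM hT

lemma norm_resolventOp_comp_convOp_le (hp : p ≠ ⊤) (s : ℝ) :
    ‖resolventOp hp s ∘L convOp hp s‖ ≤ 1 :=
  ((resolventOp hp s).opNorm_comp_le _).trans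
    (mul_le_one₀ (norm_averageOp_le _ _ _ _) (norm_nonneg _) (norm_averageOp_le _ _ _ _))

lemma tendsto_resolventOp_comp_convOp (hp : p ≠ ⊤) {s : ℕ → ℝ} (hs : Tendsto s atTop (𝓝 0))
    (f : LpR p) :
    Tendsto (fun n => ‖(resolventOp hp (s n) ∘L convOp hp (s n)) f - f‖) atTop (𝓝 0) := by
  have hM : Tendsto (fun n => resolventOp hp (s n) f) atTop (𝓝 f) :=
    tendsto_integral_orbit unitExp (continuous_phaseOp_apply hp) norm_phaseOp_apply_le
      phaseOp_zero_apply hs f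
  have hT : Tendsto (fun n => convOp hp (s n) f) atTop (𝓝 f) :=
    tendsto_integral_orbit unitUniform (continuous_translateOp_apply hp) norm_translateOp_apply_le
      translateOp_zero_apply hs f
  have hsum : Tendsto (fun n => ‖convOp hp (s n) f - f‖ + ‖resolventOp hp (s n) f - f‖) atTop
      (𝓝 0) := by
    simpa using (tendsto_iff_norm_sub_tendsto_zero.1 hT).add
      (tendsto_iff_norm_sub_tendsto_zero.1 hM)
  refine squeeze_zero (fun _ => norm_nonneg _) (fun n => ?_) hsum
  have hle : ‖resolventOp hp (s n) (convOp hp (s n) f - f)‖ ≤ ‖convOp hp (s n) f - f‖ := by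
    simpa using (resolventOp hp (s n)).le_of_opNorm_le (norm_averageOp_le _ _ _ _)
      (convOp hp (s n) f - f)
  calc ‖(resolventOp hp (s n) ∘L convOp hp (s n)) f - f‖
      = ‖resolventOp hp (s n) (convOp hp (s n) f - f) + (resolventOp hp (s n) f - f)‖ := by
        simp
    _ ≤ _ := (norm_add_le _ _).trans (by gcongr)

end ApproximateIdentity

/-- With `h_n(x) = ni/(x+ni)` and `φ_n = n·χ_{[0,1/n]}` (here indexed by
`n+1` so that `n ≥ 1`), the operators `X_n = M_{h_n} Δ_{φ_n}` are `(p,q)`-integral operators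
belonging to the parabolic algebra, have norm at most `1`, and converge to the identity in
the strong operator topology; thus `A_par^p` contains a bounded approximate identity of
elements of `G^p`. -/
theorem parabolicAlgebra_approximate_identity
    (p q : ℝ≥0∞) [Fact (1 ≤ p)] [Fact (1 ≤ q)]
    (hp : 1 < p) (hp' : p ≠ ⊤) (hq : 1 < q) (hq' : q ≠ ⊤)
    (hpq : 1 / p + 1 / q = 1) :
    ∃ X : ℕ → (LpR p →L[ℂ] LpR p),
      (∀ n : ℕ, ∀ f : LpR p, (X n f : ℝ → ℂ) =ᵐ[volume] fun x =>
        (((n : ℂ) + 1) * Complex.I / ((x : ℂ) + ((n : ℂ) + 1) * Complex.I)) *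
          ∫ y : ℝ,
            (((Set.Icc (0 : ℝ) (1 / ((n : ℝ) + 1))).indicator
                (fun _ => (n : ℝ) + 1) (x - y) : ℝ) : ℂ) * (f : ℝ → ℂ) y) ∧
      (∀ n : ℕ, X n ∈ Gp p q ∧ X n ∈ parabolicAlgebra p ∧ ‖X n‖ ≤ 1) ∧
      (∀ f : LpR p, Tendsto (fun n => ‖X n f - f‖) atTop (nhds 0)) := by
  have ha : ∀ n : ℕ, (1 : ℝ) ≤ (n : ℝ) + 1 := fun n => by simp
  have hX : ∀ n : ℕ, ∀ f : LpR p,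
      ((resolventOp hp' (1 / ((n : ℝ) + 1)) ∘L convOp hp' (1 / ((n : ℝ) + 1))) f : ℝ → ℂ)
        =ᵐ[volume] fun x =>
        (((n : ℂ) + 1) * Complex.I / ((x : ℂ) + ((n : ℂ) + 1) * Complex.I)) *
          ∫ y : ℝ,
            (((Set.Icc (0 : ℝ) (1 / ((n : ℝ) + 1))).indicator
                (fun _ => (n : ℝ) + 1) (x - y) : ℝ) : ℂ) * (f : ℝ → ℂ) y := by
    intro n f
    have ha0 : 0 < (n : ℝ) + 1 := zero_lt_one.trans_le (ha n)
    filter_upwards [isMulOp_resolventOp hp' (1 / ((n : ℝ) + 1)) (convOp hp' _ f),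
      coeFn_convOp hp' ha0 f] with x hx₁ hx₂
    rw [ContinuousLinearMap.comp_apply, hx₁, hx₂]
    congr 1
    have hn : (n : ℂ) + 1 ≠ 0 := by exact_mod_cast ha0.ne'
    have hden : (x : ℂ) + ((n : ℂ) + 1) * Complex.I ≠ 0 := fun h0 => by
      have := congrArg Complex.im h0
      simp at this
      linarith
    have hfac : 1 - Complex.I * ((1 / ((n : ℝ) + 1) : ℝ) : ℂ) * x =
        ((x : ℂ) + ((n : ℂ) + 1) * Complex.I) / (((n : ℂ) + 1) * Complex.I) := by
      push_cast
      field_simp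
      linear_combination (-x : ℂ) * Complex.I_sq
    rw [hfac, one_div_div]
  refine ⟨fun n => resolventOp hp' (1 / ((n : ℝ) + 1)) ∘L convOp hp' (1 / ((n : ℝ) + 1)), hX,
    fun n => ⟨?_, comp_mem_parabolicAlgebra hp' (by positivity),
      norm_resolventOp_comp_convOp_le hp' _⟩,
    tendsto_resolventOp_comp_convOp hp' tendsto_one_div_add_atTop_nhds_zero_nat⟩
  have hφ : MemLp (fun y : ℝ => (((Set.Icc (0 : ℝ) (1 / ((n : ℝ) + 1))).indicator
      (fun _ => (n : ℝ) + 1) y : ℝ) : ℂ)) q volume :=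
    (memLp_indicator_const q measurableSet_Icc _ (Or.inr measure_Icc_lt_top.ne)).ofReal
  obtain ⟨k, hk⟩ := exists_kernel_mul_sub hq' (memLp_mul_I_div_add_mul_I hp hp' (ha n)) hφ
  refine ⟨k, fun f => ?_⟩
  filter_upwards [hX n f, hk] with x hx hkx
  rw [hx, ← integral_const_mul]
  refine integral_congr_ae ?_
  filter_upwards [hkx] with y hy
  rw [hy, mul_assoc]
  push_cast
  rfl

end
end

section
/- Let p ∈ (1,∞) with conjugate exponent q, let k ∈ L^p(ℝ;L^q(ℝ)), and suppose Int k belongs to the Fourier binest algebra A_FB^p. Then for every Borel set A ⊆ ℝ of finite Lebesgue measure and every h ∈ H^q(ℝ), ∫_ℝ (∫_ℝ Θ(k)(x)(y) h(x) χ_A(y) dy) dx = 0. -/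
open MeasureTheory Complex Filter Topology
open scoped ENNReal NNReal

noncomputable section

theorem StronglyMeasurable.exists_uncurried_representative {q : ℝ≥0∞} [Fact (1 ≤ q)] (hq : q ≠ ⊤)
    {k : ℝ → LpR q} (hk : StronglyMeasurable k) :
    ∃ κ : ℝ × ℝ → ℂ, StronglyMeasurable κ ∧ ∀ x, (fun y => κ (x, y)) =ᵐ[volume] k x := by
  classical
  have : Fact (q ≠ ⊤) := ⟨hq⟩
  have : Nonempty (LpR q) := ⟨0⟩
  set d : ℕ → LpR q := TopologicalSpace.denseSeq (LpR q)
  have hd : DenseRange d := TopologicalSpace.denseRange_denseSeq _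
  have hex (n : ℕ) (x : ℝ) : ∃ m, dist (k x) (d m) < (1 / 2 : ℝ) ^ n :=
    hd.exists_dist_lt _ (by positivity)
  have hmeas (n : ℕ) : Measurable fun x => Nat.find (hex n x) :=
    measurable_find _ fun m =>
      (hk.dist stronglyMeasurable_const).measurable measurableSet_Iio
  set a : ℕ → ℝ → LpR q := fun n x => d (Nat.find (hex n x))
  have ha (n : ℕ) (x : ℝ) : dist (k x) (a n x) < (1 / 2 : ℝ) ^ n := Nat.find_spec (hex n x)
  have haκ (n : ℕ) : StronglyMeasurable fun z : ℝ × ℝ => (a n z.1 : ℝ → ℂ) z.2 := by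
    have h1 : Measurable fun w : ℕ × ℝ => (d w.1 : ℝ → ℂ) w.2 :=
      measurable_from_prod_countable_right fun m => (Lp.stronglyMeasurable (d m)).measurable
    exact (h1.comp (((hmeas n).comp measurable_fst).prodMk measurable_snd)).stronglyMeasurable
  refine ⟨fun z => limUnder atTop fun n => (a n z.1 : ℝ → ℂ) z.2,
    StronglyMeasurable.limUnder haκ, fun x => ?_⟩
  have hLp (f g : LpR q) : eLpNorm ((f : ℝ → ℂ) - (g : ℝ → ℂ)) q volume = ENNReal.ofReal (dist f g) := by
    rw [Lp.dist_def, ENNReal.ofReal_toReal]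
    exact ((Lp.memLp f).sub (Lp.memLp g)).eLpNorm_ne_top
  have hconv : ∀ᵐ y : ℝ, ∃ l, Tendsto (fun n => (a n x : ℝ → ℂ) y) atTop (𝓝 l) := by
    refine Lp.ae_tendsto_of_cauchy_eLpNorm (p := q)
      (B := fun N => ENNReal.ofReal (2 * (1 / 2 : ℝ) ^ N))
      (fun n => (Lp.aestronglyMeasurable _)) Fact.out ?_ ?_
    · exact (summable_geometric_two.mul_left 2).tsum_ofReal_ne_top
    · intro N n m hn hm
      rw [hLp]
      refine (ENNReal.ofReal_lt_ofReal_iff (by positivity)).2 ?_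
      have h1 := ha n x
      have h2 := ha m x
      have h3 : (1 / 2 : ℝ) ^ n ≤ (1 / 2 : ℝ) ^ N :=
        pow_le_pow_of_le_one (by norm_num) (by norm_num) hn
      have h4 : (1 / 2 : ℝ) ^ m ≤ (1 / 2 : ℝ) ^ N :=
        pow_le_pow_of_le_one (by norm_num) (by norm_num) hm
      have := dist_triangle_left (a n x) (a m x) (k x)
      linarith
  have hlim : Tendsto (fun n => a n x) atTop (𝓝 (k x)) := by
    rw [tendsto_iff_dist_tendsto_zero]
    refine squeeze_zero (fun n => dist_nonneg) (fun n => ?_)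
      (tendsto_pow_atTop_nhds_zero_of_lt_one (r := (1 / 2 : ℝ)) (by norm_num) (by norm_num))
    rw [dist_comm]
    exact (ha n x).le
  obtain ⟨ns, hns, hsub⟩ := (tendstoInMeasure_of_tendsto_Lp hlim).exists_seq_tendsto_ae
  filter_upwards [hconv, hsub] with y ⟨l, hl⟩ hy
  rw [tendsto_nhds_unique hy (hl.comp hns.tendsto_atTop)]
  exact hl.limUnder_eq

theorem ofReal_add_ne_zero_s5 {u : ℂ} (hu : 0 < u.im) (x : ℝ) : (x : ℂ) + u ≠ 0 := by
  intro h
  have := congrArg Complex.im h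
  simp at this
  linarith

theorem memLp_one_div_ofReal_add {p : ℝ≥0∞} (hp : 1 < p) (hp' : p ≠ ⊤) {u : ℂ}
    (hu : 0 < u.im) : MemLp (fun x : ℝ => 1 / ((x : ℂ) + u)) p := by
  have hcont : Continuous fun x : ℝ => 1 / ((x : ℂ) + u) :=
    continuous_const.div (by fun_prop) (ofReal_add_ne_zero_s5 hu)
  have hp1 : 1 < p.toReal := by
    simpa using (ENNReal.toReal_lt_toReal ENNReal.one_ne_top hp').2 hp
  have hbase : MemLp (fun x : ℝ => (1 + ‖x‖)⁻¹) p := by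
    have hc : Continuous fun x : ℝ => (1 + ‖x‖)⁻¹ :=
      (by fun_prop : Continuous fun x : ℝ => 1 + ‖x‖).inv₀ fun x => by positivity
    rw [← integrable_norm_rpow_iff hc.aestronglyMeasurable (zero_lt_one.trans hp).ne' hp']
    refine (integrable_one_add_norm (E := ℝ) (μ := volume) (r := p.toReal)
      (by simpa using hp1)).congr (ae_of_all _ fun x => ?_)
    have h0 : 0 ≤ 1 + ‖x‖ := by positivity
    simp only [norm_inv, Real.norm_of_nonneg h0]
    rw [Real.rpow_neg h0, Real.inv_rpow h0]
  refine hbase.of_le_mul (c := 1 + (1 + ‖u‖) / u.im) hcont.aestronglyMeasurable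
    (ae_of_all _ fun x => ?_)
  have him : u.im ≤ ‖(x : ℂ) + u‖ := by
    have := (le_abs_self _).trans (Complex.abs_im_le_norm ((x : ℂ) + u))
    simpa using this
  have hx : ‖x‖ ≤ ‖(x : ℂ) + u‖ + ‖u‖ := by
    have := norm_sub_le ((x : ℂ) + u) u
    simpa using this
  have hpos : 0 < ‖(x : ℂ) + u‖ := hu.trans_le him
  have h0 : 0 < 1 + ‖x‖ := by positivity
  rw [norm_div, norm_one, norm_inv, Real.norm_of_nonneg h0.le, ← div_eq_mul_inv,
    div_le_div_iff₀ hpos h0]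
  have h1 : 1 + ‖u‖ ≤ (1 + ‖u‖) / u.im * ‖(x : ℂ) + u‖ := by
    rw [div_mul_eq_mul_div, le_div_iff₀ hu]
    gcongr
  nlinarith

theorem integrable_one_div_mul_one_div {u v : ℂ} (hu : 0 < u.im) (hv : 0 < v.im) :
    Integrable fun x : ℝ => 1 / ((x : ℂ) + u) / ((x : ℂ) + v) := by
  have h2 : (1 : ℝ≥0∞) < 2 := by norm_num
  refine (MemLp.integrable_mul (memLp_one_div_ofReal_add h2 (by simp) hu)
    (memLp_one_div_ofReal_add h2 (by simp) hv)).congr (ae_of_all _ fun x => ?_)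
  simp [div_eq_mul_inv]

theorem one_div_sub_one_div_ofReal_add {u v : ℂ} (hu : 0 < u.im) (hv : 0 < v.im) (x : ℝ) :
    1 / ((x : ℂ) + u) - 1 / ((x : ℂ) + v) = (v - u) * (1 / ((x : ℂ) + u) / ((x : ℂ) + v)) := by
  have h1 := ofReal_add_ne_zero_s5 hu x
  have h2 := ofReal_add_ne_zero_s5 hv x
  field_simp
  ring

theorem integrable_cauchy_sub {u v : ℂ} (hu : 0 < u.im) (hv : 0 < v.im) :
    Integrable fun x : ℝ => 1 / ((x : ℂ) + u) - 1 / ((x : ℂ) + v) := by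
  simp_rw [one_div_sub_one_div_ofReal_add hu hv]
  exact (integrable_one_div_mul_one_div hu hv).const_mul _

theorem tendsto_log_sub_log {ι : Type*} {l : Filter ι} {r : ι → ℝ} (hr : Tendsto r l atTop)
    {c : ℂ} (hc : c ∈ slitPlane) (u v : ℂ) :
    Tendsto (fun i => Complex.log ((r i : ℂ) * c + u) - Complex.log ((r i : ℂ) * c + v)) l
      (𝓝 0) := by
  have hlog (w : ℂ) : Tendsto (fun i => Complex.log ((r i : ℂ) * c + w) - Real.log (r i)) l
      (𝓝 (Complex.log c)) := by
    have h1 : Tendsto (fun i => c + ((r i)⁻¹ : ℝ) * w) l (𝓝 (c + ((0 : ℝ) : ℂ) * w)) :=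
      tendsto_const_nhds.add (((Complex.continuous_ofReal.tendsto _).comp
        (tendsto_inv_atTop_zero.comp hr)).mul_const w)
    simp only [ofReal_zero, zero_mul, add_zero] at h1
    have h2 := h1.clog hc
    refine h2.congr' ?_
    have hne : ∀ᶠ i in l, c + ((r i)⁻¹ : ℝ) * w ≠ 0 :=
      h1.eventually_ne (slitPlane_ne_zero hc)
    filter_upwards [hr.eventually_gt_atTop 0, hne] with i hi hi'
    have : (r i : ℂ) * c + w = (r i : ℂ) * (c + ((r i)⁻¹ : ℝ) * w) := by
      have : (r i : ℂ) ≠ 0 := by exact_mod_cast hi.ne'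
      push_cast
      field_simp
    rw [this, Complex.log_ofReal_mul hi hi']
    ring
  simpa using (hlog u).sub (hlog v)

theorem integral_one_div_mul_one_div {u v : ℂ} (hu : 0 < u.im) (hv : 0 < v.im) :
    ∫ x : ℝ, 1 / ((x : ℂ) + u) / ((x : ℂ) + v) = 0 := by
  have hx (x : ℝ) (w : ℂ) : HasDerivAt (fun x : ℝ => (x : ℂ) + w) 1 x :=
    (Complex.ofRealCLM.hasDerivAt (x := x)).add_const w
  rcases eq_or_ne u v with rfl | huv
  · have hnorm : Tendsto (fun z : ℂ => -z⁻¹) (Bornology.cobounded ℂ) (𝓝 0) := by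
      simpa using (tendsto_inv₀_cobounded (α := ℂ)).neg
    have hlim {l : Filter ℝ} (hl : Tendsto (fun x : ℝ => (x : ℂ) + u) l
        (Bornology.cobounded ℂ)) :
        Tendsto (fun x : ℝ => -((x : ℂ) + u)⁻¹) l (𝓝 0) := hnorm.comp hl
    have hcob : Tendsto (fun x : ℝ => (x : ℂ) + u) (Bornology.cobounded ℝ)
        (Bornology.cobounded ℂ) :=
      (tendsto_add_const_cobounded u).comp (RCLike.tendsto_ofReal_cobounded_cobounded ℂ)
    rw [integral_of_hasDerivAt_of_tendsto (f := fun x : ℝ => -((x : ℂ) + u)⁻¹) (m := 0) (n := 0)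
      (fun x => ?_) (integrable_one_div_mul_one_div hu hv)
      (hlim (hcob.mono_left IsOrderBornology.atBot_le_cobounded)) (hlim (hcob.mono_left IsOrderBornology.atTop_le_cobounded)),
      sub_zero]
    have := ((hx x u).inv (ofReal_add_ne_zero_s5 hu x)).neg
    refine this.congr_deriv ?_
    field_simp
  · have hslit (w : ℂ) (hw : 0 < w.im) (x : ℝ) : -I * ((x : ℂ) + w) ∈ slitPlane := by
      left
      simpa using hw
    have hderiv (x : ℝ) : HasDerivAt (fun x : ℝ =>
        Complex.log (-I * ((x : ℂ) + u)) - Complex.log (-I * ((x : ℂ) + v)))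
        (1 / ((x : ℂ) + u) - 1 / ((x : ℂ) + v)) x := by
      have := (((hx x u).const_mul (-I)).clog_real (hslit u hu x)).sub
        (((hx x v).const_mul (-I)).clog_real (hslit v hv x))
      refine this.congr_deriv ?_
      have h1 := ofReal_add_ne_zero_s5 hu x
      have h2 := ofReal_add_ne_zero_s5 hv x
      have h3 := I_ne_zero
      field_simp
    have h0 := integral_of_hasDerivAt_of_tendsto hderiv (integrable_cauchy_sub hu hv) (m := 0) (n := 0)
      ((tendsto_log_sub_log tendsto_neg_atBot_atTop (c := I) (by simp [slitPlane])
        (-I * u) (-I * v)).congr fun x => by push_cast; ring_nf)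
      ((tendsto_log_sub_log tendsto_id (c := -I) (by simp [slitPlane])
        (-I * u) (-I * v)).congr fun x => by simp only [id]; ring_nf)
    simp_rw [one_div_sub_one_div_ofReal_add hu hv, integral_const_mul, sub_zero] at h0
    exact (mul_eq_zero.1 h0).resolve_left (sub_ne_zero.2 huv.symm)

section Correlation

variable {p q : ℝ≥0∞}

theorem norm_integral_mul_le [ENNReal.HolderConjugate p q] {F g : ℝ → ℂ} (hF : MemLp F p)
    (hg : MemLp g q) :
    ∫ x, ‖F x * g x‖ ≤ (eLpNorm F p).toReal * (eLpNorm g q).toReal := by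
  rw [integral_norm_eq_lintegral_enorm (f := fun x => F x * g x) (hF.1.mul hg.1),
    ← ENNReal.toReal_mul]
  refine ENNReal.toReal_mono (ENNReal.mul_ne_top hF.eLpNorm_ne_top hg.eLpNorm_ne_top) ?_
  simpa [eLpNorm_one_eq_lintegral_enorm] using
    eLpNorm_smul_le_mul_eLpNorm (r := 1) (p := p) (q := q) hg.1 hF.1

theorem memLp_comp_add_right {g : ℝ → ℂ} (hg : MemLp g q) (s : ℝ) :
    MemLp (fun x => g (x + s)) q :=
  hg.comp_measurePreserving (measurePreserving_add_right volume s)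

theorem eLpNorm_comp_add_right {g : ℝ → ℂ} (hg : MemLp g q) (s : ℝ) :
    eLpNorm (fun x => g (x + s)) q = eLpNorm g q :=
  eLpNorm_comp_measurePreserving hg.1 (measurePreserving_add_right volume s)

/-- The correlation of two functions, `s ↦ ∫ F(x) h(x + s) dx`. -/
def correlation (F h : ℝ → ℂ) (s : ℝ) : ℂ := ∫ x, F x * h (x + s)

variable [ENNReal.HolderConjugate p q] {F h : ℝ → ℂ}

theorem integrable_mul_comp_add (hF : MemLp F p) (hh : MemLp h q) (s : ℝ) :
    Integrable fun x => F x * h (x + s) :=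
  MemLp.integrable_mul hF (memLp_comp_add_right hh s)

theorem integral_norm_mul_comp_add_le (hF : MemLp F p) (hh : MemLp h q) (s : ℝ) :
    ∫ x, ‖F x * h (x + s)‖ ≤ (eLpNorm F p).toReal * (eLpNorm h q).toReal := by
  rw [← eLpNorm_comp_add_right hh s]
  exact norm_integral_mul_le hF (memLp_comp_add_right hh s)

theorem norm_correlation_le (hF : MemLp F p) (hh : MemLp h q) (s : ℝ) :
    ‖correlation F h s‖ ≤ (eLpNorm F p).toReal * (eLpNorm h q).toReal :=
  (norm_integral_le_integral_norm _).trans (integral_norm_mul_comp_add_le hF hh s)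

theorem continuous_correlation_of_hasCompactSupport (hF : Continuous F)
    (hFc : HasCompactSupport F) (hh : Continuous h) (hhc : HasCompactSupport h) :
    Continuous (correlation F h) := by
  obtain ⟨M, hM⟩ := hhc.exists_bound_of_continuous hh
  refine continuous_of_dominated (bound := fun x => ‖F x‖ * M)
    (fun s => (hF.mul (hh.comp (by fun_prop))).aestronglyMeasurable)
    (fun s => ae_of_all _ fun x => ?_)
    ((hF.integrable_of_hasCompactSupport hFc).norm.mul_const M)
    (ae_of_all _ fun x => continuous_const.mul (hh.comp (by fun_prop)))
  rw [norm_mul]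
  gcongr
  exact hM _

theorem correlation_eventually_eq_zero (hFc : HasCompactSupport F) (hhc : HasCompactSupport h) :
    ∀ᶠ s in cocompact ℝ, correlation F h s = 0 := by
  obtain ⟨R, hR⟩ := hFc.isCompact.isBounded.subset_closedBall 0
  obtain ⟨S, hS⟩ := hhc.isCompact.isBounded.subset_closedBall 0
  filter_upwards [(isCompact_closedBall (0 : ℝ) (R + S)).compl_mem_cocompact] with s hs
  have : (fun x => F x * h (x + s)) = 0 := by
    funext x
    by_contra hx
    obtain ⟨h1, h2⟩ := mul_ne_zero_iff.1 hx
    have h1 := hR (subset_tsupport _ h1)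
    have h2 := hS (subset_tsupport _ h2)
    refine hs ?_
    rw [mem_closedBall_zero_iff] at *
    calc ‖s‖ = ‖(x + s) - x‖ := by simp
      _ ≤ ‖x + s‖ + ‖x‖ := norm_sub_le _ _
      _ ≤ R + S := by linarith
  simp [correlation, this]

theorem exists_correlation_approx (hp : p ≠ ⊤) (hq : q ≠ ⊤) (hF : MemLp F p) (hh : MemLp h q)
    {ε : ℝ} (hε : 0 < ε) :
    ∃ C : ℝ → ℂ, Continuous C ∧ (∀ᶠ s in cocompact ℝ, C s = 0) ∧
      ∀ s, ‖correlation F h s - C s‖ ≤ ε := by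
  have key (M : ℝ) (hM : 0 ≤ M) (e : ℝ≥0∞)
      (he : e ≤ ENNReal.ofReal (ε / 2 / (M + 1))) : M * e.toReal ≤ ε / 2 := by
    have h1 : e.toReal ≤ ε / 2 / (M + 1) := ENNReal.toReal_le_of_le_ofReal (by positivity) he
    calc M * e.toReal ≤ (M + 1) * (ε / 2 / (M + 1)) := by gcongr; linarith
      _ = ε / 2 := by field_simp
  obtain ⟨g, hgc, hg, hgcont, hgm⟩ := hh.exists_hasCompactSupport_eLpNorm_sub_le hq
    (ε := ENNReal.ofReal (ε / 2 / ((eLpNorm F p).toReal + 1)))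
    (ENNReal.ofReal_pos.2 (by positivity)).ne'
  obtain ⟨G, hGc, hG, hGcont, hGm⟩ := hF.exists_hasCompactSupport_eLpNorm_sub_le hp
    (ε := ENNReal.ofReal (ε / 2 / ((eLpNorm g q).toReal + 1)))
    (ENNReal.ofReal_pos.2 (by positivity)).ne'
  refine ⟨correlation G g, continuous_correlation_of_hasCompactSupport hGcont hGc hgcont hgc,
    correlation_eventually_eq_zero hGc hgc, fun s => ?_⟩
  have hsplit : correlation F h s - correlation G g s =
      correlation F (h - g) s + correlation (F - G) g s := by
    have i1 := integrable_mul_comp_add hF hh s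
    have i2 := integrable_mul_comp_add hF hgm s
    have i3 := integrable_mul_comp_add hGm hgm s
    simp only [correlation, Pi.sub_apply, mul_sub, sub_mul]
    rw [integral_sub i1 i2, integral_sub i2 i3]
    ring
  rw [hsplit]
  refine (norm_add_le _ _).trans ?_
  have h1 := (norm_correlation_le hF (hh.sub hgm) s).trans (key _ ENNReal.toReal_nonneg _ hg)
  have h2 := (norm_correlation_le (hF.sub hGm) hgm s).trans
    ((mul_comm _ _).trans_le (key _ ENNReal.toReal_nonneg _ hG))
  linarith

theorem continuous_correlation (hp : p ≠ ⊤) (hq : q ≠ ⊤) (hF : MemLp F p) (hh : MemLp h q) :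
    Continuous (correlation F h) := by
  refine continuous_of_uniform_approx_of_continuous fun U hU => ?_
  obtain ⟨ε, hε, hU⟩ := Metric.mem_uniformity_dist.1 hU
  obtain ⟨C, hC, -, hb⟩ := exists_correlation_approx hp hq hF hh (half_pos hε)
  exact ⟨C, hC, fun s => hU (by rw [dist_eq_norm]; linarith [hb s])⟩

theorem tendsto_correlation_cocompact (hp : p ≠ ⊤) (hq : q ≠ ⊤) (hF : MemLp F p)
    (hh : MemLp h q) : Tendsto (correlation F h) (cocompact ℝ) (𝓝 0) := by
  rw [Metric.tendsto_nhds]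
  intro ε hε
  obtain ⟨C, -, hC, hb⟩ := exists_correlation_approx hp hq hF hh (half_pos hε)
  filter_upwards [hC] with s hs
  have := hb s
  rw [hs, sub_zero] at this
  rw [dist_zero_right]
  linarith

theorem correlation_swap (F h : ℝ → ℂ) (s : ℝ) : correlation h F s = correlation F h (-s) := by
  rw [correlation, correlation,
    ← integral_add_right_eq_self (μ := volume) (fun x => F x * h (x + -s)) s]
  simp [mul_comm]

theorem integrable_div_ofReal_add (hp : 1 < p) (hp' : p ≠ ⊤) (hh : MemLp h q) {u : ℂ}
    (hu : 0 < u.im) : Integrable fun x : ℝ => h x / ((x : ℂ) + u) := by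
  have : ENNReal.HolderConjugate q p := ENNReal.HolderConjugate.symm
  refine (MemLp.integrable_mul hh (memLp_one_div_ofReal_add hp hp' hu)).congr
    (ae_of_all _ fun x => ?_)
  simp [div_eq_mul_inv]

theorem integral_correlation_mul_cauchy_sub (hp : 1 < p) (hp' : p ≠ ⊤)
    (hF : MemLp F p) (hh : MemLp h q)
    (hhardy : ∀ u : ℂ, 0 < u.im → ∫ x : ℝ, h x / ((x : ℂ) + u) = 0)
    {u v : ℂ} (hu : 0 < u.im) (hv : 0 < v.im) :
    ∫ s : ℝ, correlation F h s * (1 / ((s : ℂ) + u) - 1 / ((s : ℂ) + v)) = 0 := by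
  set K : ℝ → ℂ := fun s => 1 / ((s : ℂ) + u) - 1 / ((s : ℂ) + v) with hK
  have hKi : Integrable K := integrable_cauchy_sub hu hv
  have hmeas : AEStronglyMeasurable (fun z : ℝ × ℝ => F z.2 * h (z.2 + z.1) * K z.1)
      (volume.prod volume) :=
    (hF.1.comp_snd.mul (hh.1.comp_quasiMeasurePreserving
      (quasiMeasurePreserving_add_swap volume volume))).mul hKi.1.comp_fst
  have hint : Integrable (fun z : ℝ × ℝ => F z.2 * h (z.2 + z.1) * K z.1)
      (volume.prod volume) := by
    rw [integrable_prod_iff hmeas]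
    refine ⟨ae_of_all _ fun s => (integrable_mul_comp_add hF hh s).mul_const (K s), ?_⟩
    refine (hKi.norm.const_mul ((eLpNorm F p).toReal * (eLpNorm h q).toReal)).mono'
      hmeas.norm.integral_prod_right' (ae_of_all _ fun s => ?_)
    rw [Real.norm_of_nonneg (integral_nonneg fun _ => norm_nonneg _)]
    simp_rw [norm_mul _ (K _)]
    rw [integral_mul_const]
    gcongr
    exact integral_norm_mul_comp_add_le hF hh s
  simp_rw [correlation, ← integral_mul_const]
  rw [integral_integral_swap hint]
  have hinner (x : ℝ) : ∫ s, h (x + s) * K s = 0 := by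
    have hu' : 0 < (u - x).im := by simpa using hu
    have hv' : 0 < (v - x).im := by simpa using hv
    rw [← integral_sub_right_eq_self (μ := volume) (fun s => h (x + s) * K s) x]
    have (t : ℝ) : h (x + (t - x)) * K (t - x) =
        h t / ((t : ℂ) + (u - x)) - h t / ((t : ℂ) + (v - x)) := by
      simp only [hK, add_sub_cancel, ofReal_sub]
      rw [show (t : ℂ) - x + u = t + (u - x) by ring, show (t : ℂ) - x + v = t + (v - x) by ring]
      ring
    simp_rw [this]
    rw [integral_sub (integrable_div_ofReal_add hp hp' hh hu')
      (integrable_div_ofReal_add hp hp' hh hv'), hhardy _ hu', hhardy _ hv', sub_zero]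
  refine integral_eq_zero_of_ae (ae_of_all _ fun x => ?_)
  simp only [mul_assoc, Pi.zero_apply]
  rw [integral_const_mul, hinner, mul_zero]

theorem integral_correlation_comp_mul_eq (hp : 1 < p) (hp' : p ≠ ⊤) (hq : 1 < q) (hq' : q ≠ ⊤)
    (hF : MemLp F p) (hh : MemLp h q)
    (hF0 : ∀ u : ℂ, 0 < u.im → ∫ x : ℝ, F x / ((x : ℂ) + u) = 0)
    (hh0 : ∀ u : ℂ, 0 < u.im → ∫ x : ℝ, h x / ((x : ℂ) + u) = 0)
    {a b : ℝ} (ha : 0 < a) (hb : 0 < b) :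
    ∫ s : ℝ, correlation F h (a * s) * ((1 + s ^ 2 : ℝ)⁻¹ : ℝ) =
      ∫ s : ℝ, correlation F h (b * s) * ((1 + s ^ 2 : ℝ)⁻¹ : ℝ) := by
  have : ENNReal.HolderConjugate q p := ENNReal.HolderConjugate.symm
  have hcont := continuous_correlation hp' hq' hF hh
  have him {c : ℝ} (hc : 0 < c) : 0 < ((c : ℂ) * I).im := by simpa using hc
  have hbdd {g : ℝ → ℂ} (hg : Integrable g) : Integrable fun s => correlation F h s * g s :=
    hg.bdd_mul hcont.aestronglyMeasurable (ae_of_all _ (norm_correlation_le hF hh))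
  have hscale {c : ℝ} (hc : 0 < c) :
      ∫ s : ℝ, correlation F h (c * s) * ((1 + s ^ 2 : ℝ)⁻¹ : ℝ) =
        ∫ s : ℝ, correlation F h s * (c⁻¹ * (1 + (c⁻¹ * s) ^ 2)⁻¹ : ℝ) := by
    have h1 := Measure.integral_comp_mul_left
      (fun s : ℝ => correlation F h s * ((1 + (c⁻¹ * s) ^ 2)⁻¹ : ℝ)) c
    simp only [inv_mul_cancel_left₀ hc.ne', abs_of_pos (inv_pos.2 hc)] at h1
    rw [h1, ← integral_smul]
    congr 1 with s
    rw [Complex.real_smul]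
    push_cast
    ring
  have hPi {c : ℝ} (hc : 0 < c) :
      Integrable fun s : ℝ => ((c⁻¹ * (1 + (c⁻¹ * s) ^ 2)⁻¹ : ℝ) : ℂ) :=
    ((integrable_inv_one_add_sq.comp_mul_left' (inv_ne_zero hc.ne')).const_mul _).ofReal
  have hK := integral_correlation_mul_cauchy_sub hp hp' hF hh hh0 (him ha) (him hb)
  have hK' := integral_correlation_mul_cauchy_sub hq hq' hh hF hF0 (him ha) (him hb)
  have hKi := integrable_cauchy_sub (him ha) (him hb)
  rw [← integral_neg_eq_self] at hK'
  simp_rw [correlation_swap F h, neg_neg] at hK'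
  rw [hscale ha, hscale hb, ← sub_eq_zero, ← integral_sub (hbdd (hPi ha)) (hbdd (hPi hb))]
  have hsum := integral_add (hbdd hKi) (hbdd hKi.comp_neg)
  rw [hK, hK', add_zero] at hsum
  have hpt (s : ℝ) {c : ℝ} (hc : 0 < c) : ((c⁻¹ * (1 + (c⁻¹ * s) ^ 2)⁻¹ : ℝ) : ℂ) =
      I / 2 * (1 / ((s : ℂ) + c * I) + 1 / (((-s : ℝ) : ℂ) + c * I)) := by
    have h1 := ofReal_add_ne_zero_s5 (him hc) s
    have h2 := ofReal_add_ne_zero_s5 (him hc) (-s)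
    have h3 : (c : ℂ) ≠ 0 := by exact_mod_cast hc.ne'
    have h4 : (c : ℂ) ^ 2 + s ^ 2 ≠ 0 := by
      have : c ^ 2 + s ^ 2 ≠ 0 := by positivity
      exact_mod_cast this
    push_cast at h2 ⊢
    have h5 : (1 + ((c : ℂ)⁻¹ * s) ^ 2) ≠ 0 := by
      intro h
      apply h4
      field_simp at h
      simpa using h
    field_simp
    ring_nf
    simp only [I_sq]
    ring
  have : ∀ s : ℝ, correlation F h s * ((a⁻¹ * (1 + (a⁻¹ * s) ^ 2)⁻¹ : ℝ) : ℂ) -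
      correlation F h s * ((b⁻¹ * (1 + (b⁻¹ * s) ^ 2)⁻¹ : ℝ) : ℂ) =
      I / 2 * (correlation F h s * (1 / ((s : ℂ) + a * I) - 1 / ((s : ℂ) + b * I)) +
        correlation F h s *
          (1 / (((-s : ℝ) : ℂ) + a * I) - 1 / (((-s : ℝ) : ℂ) + b * I))) := by
    intro s
    rw [hpt s ha, hpt s hb]
    ring
  simp_rw [this]
  rw [integral_const_mul, hsum, mul_zero]

/-- Functions in the Hardy spaces of conjugate exponents annihilate each other. -/
theorem integral_mul_eq_zero_of_hardy (hp : 1 < p) (hp' : p ≠ ⊤) (hq : 1 < q) (hq' : q ≠ ⊤)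
    (hF : MemLp F p) (hh : MemLp h q)
    (hF0 : ∀ u : ℂ, 0 < u.im → ∫ x : ℝ, F x / ((x : ℂ) + u) = 0)
    (hh0 : ∀ u : ℂ, 0 < u.im → ∫ x : ℝ, h x / ((x : ℂ) + u) = 0) :
    ∫ x, F x * h x = 0 := by
  have hcont := continuous_correlation hp' hq' hF hh
  set Φ : ℝ → ℂ := fun a => ∫ s : ℝ, correlation F h (a * s) * ((1 + s ^ 2 : ℝ)⁻¹ : ℝ)
  have hΦ {l : Filter ℝ} [l.IsCountablyGenerated] (c : ℂ)
      (hl : ∀ s : ℝ, s ≠ 0 → Tendsto (fun a => correlation F h (a * s)) l (𝓝 c)) :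
      Tendsto Φ l (𝓝 (∫ s : ℝ, c * ((1 + s ^ 2 : ℝ)⁻¹ : ℝ))) := by
    refine tendsto_integral_filter_of_dominated_convergence
      (fun s => (eLpNorm F p).toReal * (eLpNorm h q).toReal * (1 + s ^ 2)⁻¹)
      (Eventually.of_forall fun a => ((hcont.comp (by fun_prop)).aestronglyMeasurable.mul
        integrable_inv_one_add_sq.ofReal.aestronglyMeasurable))
      (Eventually.of_forall fun a => ae_of_all _ fun s => ?_)
      (integrable_inv_one_add_sq.const_mul _) ?_
    · rw [norm_mul, norm_real, Real.norm_of_nonneg (by positivity : 0 ≤ (1 + s ^ 2)⁻¹)]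
      gcongr
      exact norm_correlation_le hF hh _
    · filter_upwards [compl_mem_ae_iff.2 (measure_singleton (0 : ℝ))] with s hs
      exact (hl s hs).mul_const _
  have hzero : Tendsto Φ (𝓝[>] 0) (𝓝 (∫ s : ℝ, correlation F h 0 * ((1 + s ^ 2 : ℝ)⁻¹ : ℝ))) := by
    refine hΦ _ fun s _ => ?_
    have : Tendsto (fun a : ℝ => correlation F h (a * s)) (𝓝 0) (𝓝 (correlation F h (0 * s))) :=
      (hcont.comp (continuous_mul_const s)).tendsto 0
    rw [zero_mul] at this
    exact this.mono_left nhdsWithin_le_nhds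
  have htop : Tendsto Φ atTop (𝓝 (∫ s : ℝ, 0 * (((1 + s ^ 2 : ℝ)⁻¹ : ℝ) : ℂ))) := by
    refine hΦ _ fun s hs => (tendsto_correlation_cocompact hp' hq' hF hh).comp ?_
    rw [← Metric.cobounded_eq_cocompact]
    exact (tendsto_mul_right_cobounded hs).comp
      (tendsto_id.mono_right IsOrderBornology.atTop_le_cobounded)
  have hconst {a : ℝ} (ha : 0 < a) : Φ a = Φ 1 :=
    integral_correlation_comp_mul_eq hp hp' hq hq' hF hh hF0 hh0 ha one_pos
  have e1 : Tendsto Φ (𝓝[>] 0) (𝓝 (Φ 1)) :=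
    tendsto_const_nhds.congr' (eventually_mem_nhdsWithin.mono fun a ha => (hconst ha).symm)
  have e2 : Tendsto Φ atTop (𝓝 (Φ 1)) :=
    tendsto_const_nhds.congr' ((eventually_gt_atTop 0).mono fun a ha => (hconst ha).symm)
  have e := (tendsto_nhds_unique hzero e1).trans (tendsto_nhds_unique htop e2).symm
  rw [integral_const_mul, integral_complex_ofReal, integral_univ_inv_one_add_sq] at e
  have : correlation F h 0 = 0 := by
    have hpi : (Real.pi : ℂ) ≠ 0 := by exact_mod_cast Real.pi_ne_zero
    simpa [hpi] using e
  simpa [correlation] using this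

end Correlation

theorem ae_eq_zero_of_forall_integral_exp_mul_eq_zero {F : ℝ → ℂ} (hF : Integrable F)
    (h : ∀ l : ℝ, ∫ y : ℝ, Complex.exp (I * l * y) * F y = 0) : F =ᵐ[volume] 0 := by
  refine ae_eq_zero_of_integral_contDiff_smul_eq_zero hF.locallyIntegrable fun g hg hgc => ?_
  have hg' : ContDiff ℝ (⊤ : ℕ∞) fun x => (g x : ℂ) := Complex.ofRealCLM.contDiff.comp hg
  have hgc' : HasCompactSupport fun x => (g x : ℂ) :=
    hgc.comp_left (g := Complex.ofReal) ofReal_zero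
  set φ : SchwartzMap ℝ ℂ := hgc'.toSchwartzMap hg' with hφ
  have hφ (x : ℝ) : φ x = g x := rfl
  set ψ := FourierTransform.fourierInv φ with hψ
  have hψφ : FourierTransform.fourier ψ = φ := FourierTransform.fourier_fourierInv_eq φ
  have hflip := VectorFourier.integral_fourierIntegral_smul_eq_flip (L := innerₗ ℝ)
    Real.continuous_fourierChar continuous_inner hF ψ.integrable (ν := volume)
  have hzero (ξ : ℝ) : VectorFourier.fourierIntegral Real.fourierChar volume (innerₗ ℝ) F ξ = 0 := by
    rw [VectorFourier.fourierIntegral, ← h (-(2 * Real.pi * ξ))]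
    congr 1 with y
    rw [Circle.smul_def, Real.fourierChar_apply, smul_eq_mul]
    congr 2
    simp
    ring
  simp only [hzero, zero_smul, integral_zero, flip_innerₗ] at hflip
  rw [hflip]
  congr 1 with x
  have : VectorFourier.fourierIntegral Real.fourierChar volume (innerₗ ℝ) (ψ : ℝ → ℂ) x = φ x := by
    rw [← hψφ, SchwartzMap.fourier_coe]
    rfl
  rw [this, hφ, smul_eq_mul, Complex.real_smul, mul_comm]

theorem measurePreserving_prod_const_sub :
    MeasurePreserving (fun z : ℝ × ℝ => (z.1, z.1 - z.2)) (volume.prod volume)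
      (volume.prod volume) :=
  (MeasurePreserving.id volume).skew_product (g := fun x y => x - y) (by fun_prop)
    (ae_of_all _ fun x => (Measure.measurePreserving_sub_left volume x).map_eq)

section Kernel

variable {p q : ℝ≥0∞} [Fact (1 ≤ q)] [ENNReal.HolderConjugate p q]
  {k : ℝ → LpR q} {κ : ℝ × ℝ → ℂ} {h : ℝ → ℂ}

theorem integrable_kernel_mul (hk : MemLp k p) (hκ : StronglyMeasurable κ)
    (hκk : ∀ x, (fun y => κ (x, y)) =ᵐ[volume] k x) (hh : MemLp h q)
    {ψ : ℝ × ℝ → ℂ} (hψ : AEStronglyMeasurable ψ (volume.prod volume)) {C : ℝ}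
    (hψx : ∀ x, MemLp (fun y => ψ (x, y)) p)
    (hC : ∀ x, (eLpNorm (fun y => ψ (x, y)) p).toReal ≤ C) :
    Integrable (fun z : ℝ × ℝ => κ z * ψ z * h z.1) (volume.prod volume) := by
  have : ENNReal.HolderConjugate q p := ENNReal.HolderConjugate.symm
  have hκq (x : ℝ) : MemLp (fun y => κ (x, y)) q := (memLp_congr_ae (hκk x)).2 (Lp.memLp _)
  have hmeas := (hκ.aestronglyMeasurable.mul hψ).mul (hh.1.comp_fst (ν := volume))
  refine (integrable_prod_iff hmeas).2
    ⟨ae_of_all _ fun x => (MemLp.integrable_mul (hκq x) (hψx x)).mul_const (h x), ?_⟩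
  have hkh : Integrable fun x => C * (‖k x‖ * ‖h x‖) :=
    (MemLp.integrable_mul hk.norm hh.norm).const_mul C
  refine hkh.mono' hmeas.norm.integral_prod_right' (ae_of_all _ fun x => ?_)
  rw [Real.norm_of_nonneg (integral_nonneg fun _ => norm_nonneg _)]
  simp only [Pi.mul_apply, norm_mul _ (h x)]
  rw [integral_mul_const, ← mul_assoc]
  gcongr
  refine (norm_integral_mul_le (hκq x) (hψx x)).trans ?_
  rw [mul_comm, eLpNorm_congr_ae (hκk x), ← Lp.norm_def]
  gcongr
  exact hC x

theorem ae_integral_kernel_mul_eq_zero [Fact (1 ≤ p)] (hp : 1 < p) (hp' : p ≠ ⊤) (hq : 1 < q) (hq' : q ≠ ⊤)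
    (hk : MemLp k p) (hκ : StronglyMeasurable κ)
    (hκk : ∀ x, (fun y => κ (x, y)) =ᵐ[volume] k x)
    {T : LpR p →L[ℂ] LpR p}
    (hT : ∀ f : LpR p, (T f : ℝ → ℂ) =ᵐ[volume] fun x => ∫ y, (k x : ℝ → ℂ) y * (f : ℝ → ℂ) y)
    (hTB : T ∈ fourierBinest p) (hh : MemLp h q)
    (hh0 : ∀ u : ℂ, 0 < u.im → ∫ x : ℝ, h x / ((x : ℂ) + u) = 0)
    {f : ℝ → ℂ} (hf : MemLp f p)
    (hf0 : ∀ u : ℂ, 0 < u.im → ∫ x : ℝ, f x / ((x : ℂ) + u) = 0) :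
    ∀ᵐ y, ∫ x, κ (x, x - y) * f (x - y) * h x = 0 := by
  set J : ℝ × ℝ → ℂ := fun z => κ z * f z.2 * h z.1 with hJdef
  have hf2 : AEStronglyMeasurable (fun z : ℝ × ℝ => f z.2) (volume.prod volume) := hf.1.comp_snd
  have hJ : Integrable J (volume.prod volume) :=
    integrable_kernel_mul hk hκ hκk hh hf2 (C := (eLpNorm f p).toReal) (fun _ => hf)
      (by intro _; exact le_rfl)
  have hG : Integrable (fun z : ℝ × ℝ => J (z.1, z.1 - z.2)) (volume.prod volume) :=
    measurePreserving_prod_const_sub.integrable_comp_of_integrable hJ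
  refine ae_eq_zero_of_forall_integral_exp_mul_eq_zero hG.integral_prod_right fun l => ?_
  have hE (c : ℝ) : Continuous fun y : ℝ => Complex.exp (I * c * y) := by fun_prop
  have hE1 (c y : ℝ) : ‖Complex.exp (I * c * y)‖ = 1 := by
    rw [show I * c * y = ((c * y : ℝ) : ℂ) * I by push_cast; ring, norm_exp_ofReal_mul_I]
  have hEG : Integrable (fun z : ℝ × ℝ => Complex.exp (I * l * z.2) * J (z.1, z.1 - z.2))
      (volume.prod volume) :=
    hG.bdd_mul ((hE l).comp continuous_snd).aestronglyMeasurable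
      (ae_of_all _ fun z => (hE1 l z.2).le)
  simp_rw [← integral_const_mul]
  refine (integral_integral_swap (f := fun x y : ℝ => Complex.exp (I * l * y) * J (x, x - y)) hEG).symm.trans ?_
  have hg : MemLp (fun y : ℝ => Complex.exp (I * (-l : ℝ) * y) * f y) p :=
    hf.of_le ((hE _).aestronglyMeasurable.mul hf.1)
      (ae_of_all _ fun y => by rw [norm_mul, hE1, one_mul])
  have hmem : hg.toLp ∈ mulHardy p fun x => Complex.exp (I * (-l : ℝ) * x) := by
    refine ⟨hf.toLp, fun u hu => ?_, ?_⟩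
    · rw [← hf0 u hu]
      refine integral_congr_ae ?_
      filter_upwards [hf.coeFn_toLp] with x hx
      rw [hx]
    · filter_upwards [hf.coeFn_toLp, hg.coeFn_toLp] with x hx hx'
      rw [hx, hx']
  obtain ⟨f', hf', hTf'⟩ := hTB.2 _ _ hmem
  rw [← integral_mul_eq_zero_of_hardy hp hp' hq hq' (Lp.memLp f') hh hf' hh0]
  refine integral_congr_ae ?_
  filter_upwards [hTf', hT hg.toLp] with x hx hx'
  have h1 : ∫ y, (k x : ℝ → ℂ) y * (hg.toLp : ℝ → ℂ) y =
      ∫ y, κ (x, y) * (Complex.exp (I * (-l : ℝ) * y) * f y) := by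
    refine integral_congr_ae ?_
    filter_upwards [hκk x, hg.coeFn_toLp] with y hy hy'
    rw [hy', ← hy]
  have h2 : (f' : ℝ → ℂ) x = Complex.exp (I * l * x) *
      ∫ y, κ (x, y) * (Complex.exp (I * (-l : ℝ) * y) * f y) := by
    rw [← h1, ← hx', hx, ← mul_assoc, ← Complex.exp_add]
    simp
  rw [h2, ← integral_sub_left_eq_self _ volume x, ← integral_const_mul, ← integral_mul_const]
  congr 1 with y
  simp only [hJdef, sub_sub_cancel]
  rw [show I * l * ((x - y : ℝ) : ℂ) = I * l * x + I * (-l : ℝ) * y by push_cast; ring,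
    Complex.exp_add]
  ring

end Kernel

theorem norm_mul_I_div_le_one {c : ℝ} (hc : 0 < c) (z : ℝ) :
    ‖(c * I : ℂ) * (1 / ((z : ℂ) + c * I))‖ ≤ 1 := by
  have h1 : c ≤ ‖(z : ℂ) + c * I‖ := by
    simpa using (le_abs_self _).trans (Complex.abs_im_le_norm ((z : ℂ) + c * I))
  have h2 := hc.trans_le h1
  rw [norm_mul, norm_div, norm_one, norm_mul, norm_I, mul_one, norm_real,
    Real.norm_of_nonneg hc.le, mul_one_div, div_le_one h2]
  exact h1

theorem tendsto_mul_I_div_atTop (z : ℝ) :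
    Tendsto (fun c : ℝ => (c * I : ℂ) * (1 / ((z : ℂ) + c * I))) atTop (𝓝 1) := by
  have h1 : Tendsto (fun c : ℝ => I / (((c⁻¹ : ℝ) : ℂ) * z + I)) atTop
      (𝓝 (I / (((0 : ℝ) : ℂ) * z + I))) := by
    refine tendsto_const_nhds.div ((((Complex.continuous_ofReal.tendsto _).comp
      tendsto_inv_atTop_zero).mul_const _).add_const _) (by simp)
  simp only [ofReal_zero, zero_mul, zero_add, div_self I_ne_zero] at h1
  refine h1.congr' ?_
  filter_upwards [eventually_gt_atTop 0] with c hc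
  have h2 : (c : ℂ) ≠ 0 := by exact_mod_cast hc.ne'
  have h3 : (z : ℂ) + c * I ≠ 0 := ofReal_add_ne_zero_s5 (by simpa using hc) z
  have h4 : ((c⁻¹ : ℝ) : ℂ) * z + I = (c : ℂ)⁻¹ * (z + c * I) := by
    push_cast
    field_simp
  rw [h4]
  field_simp

/-- If `Int k` belongs to the Fourier binest algebra, then for every Borel
set `A` of finite measure and every `h ∈ H^q(ℝ)`,
`∫∫ Θ(k)(x)(y) h(x) χ_A(y) dy dx = 0`, where `Θ(k)(x)(y) = k(x)(x-y)`. -/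
theorem kernel_orthogonality
    (p q : ℝ≥0∞) [Fact (1 ≤ p)] [Fact (1 ≤ q)]
    (hp : 1 < p) (hp' : p ≠ ⊤) (hq : 1 < q) (hq' : q ≠ ⊤)
    (hpq : 1 / p + 1 / q = 1)
    (k : LpLq p q) (T : LpR p →L[ℂ] LpR p) (hT : IsIntOp p q k T)
    (hTB : T ∈ fourierBinest p)
    (A : Set ℝ) (hA : MeasurableSet A) (hAfin : volume A < ⊤)
    (h : LpR q) (hh : h ∈ hardy q) :
    ∫ x : ℝ, (∫ y : ℝ, ((k : ℝ → LpR q) x : ℝ → ℂ) (x - y) * (h : ℝ → ℂ) x *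
      A.indicator (fun _ => (1 : ℂ)) y) = 0 := by
  have : ENNReal.HolderConjugate p q :=
    ENNReal.holderConjugate_iff.2 (by simpa [one_div] using hpq)
  obtain ⟨κ, hκ, hκk⟩ := StronglyMeasurable.exists_uncurried_representative hq'
    (Lp.stronglyMeasurable k)
  set χ : ℝ → ℂ := A.indicator fun _ => (1 : ℂ) with hχdef
  have hχm : Measurable χ := measurable_const.indicator hA
  have hχ : MemLp χ p := memLp_indicator_const p hA 1 (Or.inr hAfin.ne)
  have hχ1 (y : ℝ) : ‖χ y‖ ≤ 1 := by
    simpa using norm_indicator_le_norm_self (fun _ => (1 : ℂ)) y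
  set Q : ℝ × ℝ → ℂ := fun z => κ (z.1, z.1 - z.2) * χ z.2 * (h : ℝ → ℂ) z.1 with hQdef
  have hQ : Integrable Q (volume.prod volume) := by
    have h1 := integrable_kernel_mul (Lp.memLp k) hκ hκk (Lp.memLp h)
      (ψ := fun z => χ (z.1 - z.2))
      (hχm.comp (measurable_fst.sub measurable_snd)).aestronglyMeasurable
      (fun x => hχ.comp_measurePreserving (Measure.measurePreserving_sub_left volume x))
      (fun x => (congrArg ENNReal.toReal
        (eLpNorm_comp_measurePreserving hχ.1 (Measure.measurePreserving_sub_left volume x))).le)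
    simpa [hQdef, Function.comp_def] using
      measurePreserving_prod_const_sub.integrable_comp_of_integrable h1
  have hu {c : ℝ} (hc : 0 < c) : 0 < (c * I : ℂ).im := by simpa using hc
  have hfm {c : ℝ} (hc : 0 < c) :
      Continuous fun z : ℝ => (c * I : ℂ) * (1 / ((z : ℂ) + c * I)) :=
    continuous_const.mul (continuous_const.div (by fun_prop) (ofReal_add_ne_zero_s5 (hu hc)))
  have hint {c : ℝ} (hc : 0 < c) : Integrable (fun z : ℝ × ℝ =>
      (c * I : ℂ) * (1 / (((z.1 - z.2 : ℝ) : ℂ) + c * I)) * Q z) (volume.prod volume) :=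
    hQ.bdd_mul ((hfm hc).comp (continuous_fst.sub continuous_snd)).aestronglyMeasurable
      (ae_of_all _ fun z => norm_mul_I_div_le_one hc (z.1 - z.2))
  have hzero {c : ℝ} (hc : 0 < c) : ∫ z : ℝ × ℝ,
      (c * I : ℂ) * (1 / (((z.1 - z.2 : ℝ) : ℂ) + c * I)) * Q z ∂(volume.prod volume) = 0 := by
    rw [integral_prod_symm _ (hint hc)]
    refine integral_eq_zero_of_ae ?_
    have hf := (memLp_one_div_ofReal_add hp hp' (hu hc)).const_mul (c * I : ℂ)
    have hf0 (v : ℂ) (hv : 0 < v.im) :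
        ∫ x : ℝ, (c * I : ℂ) * (1 / ((x : ℂ) + c * I)) / ((x : ℂ) + v) = 0 := by
      simp_rw [mul_div_assoc (c * I : ℂ)]
      rw [integral_const_mul, integral_one_div_mul_one_div (hu hc) hv, mul_zero]
    filter_upwards [ae_integral_kernel_mul_eq_zero hp hp' hq hq' (Lp.memLp k) hκ hκk hT hTB
      (Lp.memLp h) hh hf hf0] with y hy
    rw [Pi.zero_apply, ← mul_zero (χ y), ← hy, ← integral_const_mul]
    congr 1 with x
    simp only [hQdef]
    ring
  have hlim : Tendsto (fun c : ℝ => ∫ z : ℝ × ℝ,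
      (c * I : ℂ) * (1 / (((z.1 - z.2 : ℝ) : ℂ) + c * I)) * Q z ∂(volume.prod volume)) atTop
      (𝓝 (∫ z, Q z ∂(volume.prod volume))) := by
    refine tendsto_integral_filter_of_dominated_convergence (fun z => ‖Q z‖) ?_ ?_ hQ.norm
      (ae_of_all _ fun z => ?_)
    · filter_upwards [eventually_gt_atTop 0] with c hc using (hint hc).1
    · filter_upwards [eventually_gt_atTop 0] with c hc
      refine ae_of_all _ fun z => ?_
      rw [norm_mul]
      exact mul_le_of_le_one_left (norm_nonneg _) (norm_mul_I_div_le_one hc _)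
    · simpa using (tendsto_mul_I_div_atTop (z.1 - z.2)).mul_const (Q z)
  have hQ0 : ∫ z, Q z ∂(volume.prod volume) = 0 :=
    tendsto_nhds_unique hlim (tendsto_const_nhds.congr'
      ((eventually_gt_atTop 0).mono fun c hc => (hzero hc).symm))
  rw [integral_prod _ hQ] at hQ0
  rw [← hQ0]
  congr 1 with x
  refine integral_congr_ae ?_
  filter_upwards [(Measure.measurePreserving_sub_left volume x).quasiMeasurePreserving.ae_eq_comp (hκk x)]
    with y hy
  simp only [Function.comp_apply] at hy
  simp only [hQdef, hy]
  ring

end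
end
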